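/- arXiv:0807.1141 — 2 statements merged into one kernel-verified Lean document; each statement's English description precedes it below -/
import Mathlib

section
/- Let G and H be countable abelian groups, each endowed with a proper left-invariant metric. Then G and H are coarsely equivalent if and only if the torsion-free ranks r0(G) and r0(H) are equal and the groups G, H are either both finitely generated or both infinitely generated. -/
/-- A map between metric spaces is bornologous. -/
def Bornologous {X Y : Type*} [MetricSpace X] [MetricSpace Y] (f : X → Y) : Prop :=
  ∀ δ : ℝ, 0 ≤ δ → ∃ ε : ℝ, 0 ≤ ε ∧ ∀ x x' : X, dist x x' ≤ δ → dist (f x) (f x') ≤ ε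

/-- Two metric spaces are coarsely equivalent. -/
def CoarseEquiv (X Y : Type*) [MetricSpace X] [MetricSpace Y] : Prop :=
  ∃ (f : X → Y) (g : Y → X) (K : ℝ), 0 ≤ K ∧ Bornologous f ∧ Bornologous g ∧
    (∀ x : X, dist (g (f x)) x ≤ K) ∧ (∀ y : Y, dist (f (g y)) y ≤ K)

/-- The torsion-free rank of an abelian group:
`sup {n ∈ ℕ : ℤⁿ is isomorphic to a subgroup of G}`. -/
noncomputable def torsionFreeRank (G : Type*) [AddCommGroup G] : ℕ∞ :=
  ⨆ n ∈ {n : ℕ | ∃ f : (Fin n → ℤ) →+ G, Function.Injective f}, (n : ℕ∞)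

theorem cx_split (u v : ℕ) : ∀ c p : ℕ, c * u ≤ p → p ≤ c * v → ∃ E : ℕ → ℕ, E 0 = 0 ∧ E c = p ∧
    ∀ k < c, E k + u ≤ E (k+1) ∧ E (k+1) ≤ E k + v := by
  intro c
  induction c with
  | zero =>
    intro p h1 h2
    exact ⟨fun _ => 0, rfl, by simp at h2; simp [h2], by simp⟩
  | succ c ih =>
    intro p h1 h2
    obtain ⟨d, hd1, hd2, hd3, hd4, hd5⟩ : ∃ d, u ≤ d ∧ d ≤ v ∧ d ≤ p ∧ c * u ≤ p - d ∧ p - d ≤ c * v := by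
      have e1 : (c+1) * u = c * u + u := by ring
      have e2 : (c+1) * v = c * v + v := by ring
      have e3 : u ≤ v := by
        have : (c+1) * u ≤ (c+1) * v := h1.trans h2
        exact Nat.le_of_mul_le_mul_left this (Nat.succ_pos c)
      have e4 : c * u ≤ c * v := Nat.mul_le_mul_left _ e3
      by_cases hc : p - u ≤ c * v
      · exact ⟨u, le_refl _, e3, by omega, by omega, hc⟩
      · exact ⟨p - c * v, by omega, by omega, by omega, by omega, by omega⟩
    obtain ⟨E, hE0, hEc, hE⟩ := ih (p - d) hd4 hd5
    refine ⟨fun k => if k ≤ c then E k else p, by simp [hE0], by simp, ?_⟩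
    intro k hk
    by_cases hkc : k < c
    · have := hE k hkc
      simp only [if_pos (show k ≤ c by omega), if_pos (show k + 1 ≤ c by omega)]
      exact this
    · have : k = c := by omega
      subst this
      simp [hEc]
      omega

theorem cx_split2 {u v A B p : ℕ} (h1 : u * A ≤ p) (h2 : p ≤ v * B) : ∀ n q : ℕ, n * B ≤ q → q ≤ n * A →
    ∃ E : ℕ → ℕ, E 0 = 0 ∧ E q = n * p ∧ (∀ k < q, E k + u ≤ E (k+1) ∧ E (k+1) ≤ E k + v) ∧
      ∀ j ≤ n, ∃ k ≤ q, E k = j * p := by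
  intro n
  induction n with
  | zero =>
    intro q hq1 hq2
    have : q = 0 := by simpa using hq2
    subst this
    exact ⟨fun _ => 0, rfl, by simp, by simp, by intro j hj; exact ⟨0, le_refl _, by simp at hj; simp [hj]⟩⟩
  | succ n ih =>
    intro q hq1 hq2
    obtain ⟨C, -, hCq, hC⟩ := cx_split B A (n+1) q hq1 hq2
    obtain ⟨d, hd1, hd2, hd3, hd4, hd5⟩ : ∃ d, B ≤ d ∧ d ≤ A ∧ d ≤ q ∧ n * B ≤ q - d ∧ q - d ≤ n * A := by
      have e1 : (n+1) * B = n * B + B := by ring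
      have e2 : (n+1) * A = n * A + A := by ring
      have e3 : B ≤ A := by
        have : (n+1) * B ≤ (n+1) * A := hq1.trans hq2
        exact Nat.le_of_mul_le_mul_left this (Nat.succ_pos n)
      have e4 : n * B ≤ n * A := Nat.mul_le_mul_left _ e3
      by_cases hc : q - B ≤ n * A
      · exact ⟨B, le_refl _, e3, by omega, by omega, hc⟩
      · exact ⟨q - n * A, by omega, by omega, by omega, by omega, by omega⟩
    obtain ⟨E, hE0, hEq, hE, hEj⟩ := ih (q - d) hd4 hd5
    obtain ⟨F, hF0, hFd, hF⟩ := cx_split u v d p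
      (by calc d * u ≤ A * u := Nat.mul_le_mul_right _ hd2
            _ = u * A := by ring
            _ ≤ p := h1)
      (by calc p ≤ v * B := h2
            _ ≤ v * d := Nat.mul_le_mul_left _ hd1
            _ = d * v := by ring)
    have key : ∀ k, q - d ≤ k → (if k ≤ q - d then E k else n * p + F (k - (q - d))) = n * p + F (k - (q-d)) := by
      intro k hk
      split_ifs with h
      · have : k = q - d := by omega
        subst this
        simp [hF0, hEq]
      · rfl
    refine ⟨fun k => if k ≤ q - d then E k else n * p + F (k - (q - d)), by simp [hE0], ?_, ?_, ?_⟩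
    · simp only [key q (by omega)]
      rw [show q - (q - d) = d by omega, hFd]; ring
    · intro k hk
      by_cases hkc : k < q - d
      · have := hE k hkc
        simp only [if_pos (show k ≤ q - d by omega), if_pos (show k + 1 ≤ q - d by omega)]
        exact this
      · have h3 := hF (k - (q - d)) (by omega)
        rw [show k - (q - d) + 1 = k + 1 - (q - d) by omega] at h3
        simp only [key k (by omega), key (k+1) (by omega)]
        omega
    · intro j hj
      by_cases hjn : j ≤ n
      · obtain ⟨k, hk, hk2⟩ := hEj j hjn
        exact ⟨k, by omega, by simp [hk, hk2]⟩
      · have : j = n + 1 := by omega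
        subst this
        refine ⟨q, le_refl _, ?_⟩
        simp only [key q (by omega)]
        rw [show q - (q - d) = d by omega, hFd]; ring

theorem cx_big {u v p : ℕ} (_hu : 0 < u) (huv : u < v) (hp : 3 * (u * v) ≤ p) : p / v + 1 < p / u := by
  have hv : 0 < v := by omega
  have h3 : 3 * u ≤ p / v := by
    rw [Nat.le_div_iff_mul_le hv]; linarith
  have h4 : p / v * v ≤ p := Nat.div_mul_le_self p v
  have : p / v + 2 ≤ p / u := by
    rw [Nat.le_div_iff_mul_le _hu]
    have : p / v * (u + 1) ≤ p / v * v := Nat.mul_le_mul_left _ huv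
    nlinarith
  omega

/-- level predicate -/
def CxLev (m m' : ℕ → ℕ) (i n : ℕ) (e : ℕ → ℕ) : Prop :=
  e (m' i) = n * m i ∧ (∀ k < m' i, e k < e (k+1) ∧ e (k+1) ≤ e k + 2) ∧
  (∀ j ≤ i, ∀ y ≤ m' i, m' j ∣ y → m j ∣ e y) ∧
  (∀ j < i, ∀ z ≤ n * m i, m (j+1) ∣ z → ∃ y ≤ m' i, m' j ∣ y ∧ e y = z)

theorem cx_lev (m m' u v : ℕ → ℕ) (hm0 : m 0 = 1) (hm'0 : m' 0 = 1) (hu0 : u 0 = 1) (hv0 : v 0 = 2)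
    (hm'pos : ∀ i, 0 < m' i)
    (hmd : ∀ i j, i ≤ j → m i ∣ m j) (hm'd : ∀ i j, i ≤ j → m' i ∣ m' j)
    (hstep : ∀ i, ∃ p p' A B, m (i+1) = p * m i ∧ m' (i+1) = p' * m' i ∧ u i * A ≤ p ∧ p ≤ v i * B ∧
      p' ≤ u (i+1) * A ∧ v (i+1) * B ≤ p') :
    ∀ i n, ∃ e : ℕ → ℕ, e 0 = 0 ∧ (u i ≤ n → n ≤ v i → CxLev m m' i n e) := by
  intro i
  induction i with
  | zero =>
    intro n
    refine ⟨fun k => n * k, by simp, fun h1 h2 => ⟨by simp [hm0, hm'0], ?_, ?_, by simp⟩⟩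
    · intro k hk
      rw [hu0] at h1; rw [hv0] at h2
      constructor <;> nlinarith
    · intro j hj y hy _
      have : j = 0 := by omega
      subst this
      simp [hm0]
  | succ i ih =>
    choose e he0 he using ih
    intro n
    by_cases hn : u (i+1) ≤ n ∧ n ≤ v (i+1)
    swap
    · exact ⟨fun _ => 0, rfl, fun h1 h2 => absurd ⟨h1, h2⟩ hn⟩
    obtain ⟨p, p', A, B, hp, hp', h1, h2, h3, h4⟩ := hstep i
    obtain ⟨E, hE0, hEq, hE, hEj⟩ := cx_split2 h1 h2 n p'
      ((Nat.mul_le_mul_right _ hn.2).trans h4) (h3.trans (Nat.mul_le_mul_right _ hn.1))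
    set e' : ℕ → ℕ := fun x => E (x / m' i) * m i + e (E (x / m' i + 1) - E (x / m' i)) (x % m' i) with he'
    have hmi := hm'pos i
    have hlev : ∀ q < p', CxLev m m' i (E (q+1) - E q) (e (E (q+1) - E q)) := by
      intro q hq
      have := hE q hq
      exact he _ (by omega) (by omega)
    have hmul : ∀ q, e' (q * m' i) = E q * m i := by
      intro q
      simp only [he']
      rw [Nat.mul_div_cancel _ hmi, Nat.mul_mod_left, he0]; simp
    have star : ∀ q < p', ∀ r ≤ m' i, e' (q * m' i + r) = E q * m i + e (E (q+1) - E q) r := by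
      intro q hq r hr
      rcases Nat.lt_or_ge r (m' i) with hr | hr'
      · simp only [he']
        rw [show q * m' i + r = r + m' i * q by ring, Nat.add_mul_div_left _ _ hmi, Nat.add_mul_mod_self_left,
          Nat.div_eq_of_lt hr, Nat.mod_eq_of_lt hr]
        simp
      · have : r = m' i := le_antisymm hr hr'
        subst this
        rw [show q * m' i + m' i = (q+1) * m' i by ring, hmul, (hlev q hq).1, ← add_mul]
        have := hE q hq
        congr 1; omega
    have hdec : ∀ y ≤ m' (i+1), 0 < p' → ∃ q < p', ∃ r ≤ m' i, y = q * m' i + r := by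
      intro y hy hp0
      rw [hp'] at hy
      rcases Nat.lt_or_ge y (p' * m' i) with h | h
      · refine ⟨y / m' i, ?_, y % m' i, (Nat.mod_lt _ hmi).le, ?_⟩
        · rwa [Nat.div_lt_iff_lt_mul hmi]
        · rw [mul_comm]; exact (Nat.div_add_mod _ _).symm
      · refine ⟨p' - 1, by omega, m' i, le_refl _, ?_⟩
        obtain ⟨t, rfl⟩ : ∃ t, p' = t + 1 := ⟨p' - 1, by omega⟩
        simp only [Nat.add_sub_cancel]
        have := le_antisymm hy h
        rw [this]; ring
    have hp0 : 0 < p' := by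
      have := hm'pos (i+1)
      rw [hp'] at this
      exact Nat.pos_of_mul_pos_right this
    have htop : e' (m' (i+1)) = n * m (i+1) := by rw [hp', hmul, hEq, hp]; ring
    refine ⟨e', by simpa [hE0] using hmul 0, fun _ _ => ⟨htop, ?_, ?_, ?_⟩⟩
    · intro k hk
      have hq : k / m' i < p' := by rw [Nat.div_lt_iff_lt_mul hmi, ← hp']; exact hk
      have hr := Nat.mod_lt k hmi
      have hk2 : k = k / m' i * m' i + k % m' i := by rw [mul_comm]; exact (Nat.div_add_mod _ _).symm
      have := (hlev _ hq).2.1 _ hr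
      rw [show e' (k+1) = e' (k / m' i * m' i + (k % m' i + 1)) by rw [← add_assoc, ← hk2],
        show e' k = e' (k / m' i * m' i + k % m' i) by rw [← hk2], star _ hq _ (by omega), star _ hq _ (by omega)]
      omega
    · intro j hj y hy hjy
      rcases Nat.lt_or_ge i j with hij | hij
      · have : j = i + 1 := by omega
        subst this
        rcases Nat.eq_zero_or_pos y with h0 | h0
        · subst h0
          have : e' 0 = 0 := by simpa [hE0] using hmul 0
          rw [this]; exact dvd_zero _
        · have : y = m' (i+1) := le_antisymm hy (Nat.le_of_dvd h0 hjy)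
          rw [this, htop]; exact dvd_mul_left _ _
      · obtain ⟨q, hq, r, hr, rfl⟩ := hdec y hy hp0
        rw [star q hq r hr]
        refine dvd_add (dvd_mul_of_dvd_right (hmd _ _ hij) _) ((hlev q hq).2.2.1 j hij r hr ?_)
        exact (Nat.dvd_add_right (dvd_mul_of_dvd_right (hm'd _ _ hij) _)).1 hjy
    · intro j hj z hz hjz
      rcases Nat.lt_or_ge j i with hij | hij
      · have hzz : z ≤ E p' * m i := by rw [hEq]; rw [hp] at hz; linarith
        have : ∃ q < p', E q * m i ≤ z ∧ z ≤ E (q+1) * m i := by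
          by_contra hcon
          push Not at hcon
          have : ∀ q, 0 < q → q ≤ p' → E q * m i < z := by
            intro q hq0
            induction q with
            | zero => omega
            | succ q ihq =>
              intro hq1
              apply hcon q (by omega)
              rcases Nat.eq_zero_or_pos q with h | h
              · subst h; simp [hE0]
              · exact (ihq h (by omega)).le
          have := this p' hp0 le_rfl
          omega
        obtain ⟨q, hq, hq1, hq2⟩ := this
        have hEE := hE q hq
        have hd : m (j+1) ∣ z - E q * m i :=
          Nat.dvd_sub hjz (dvd_mul_of_dvd_right (hmd _ _ hij) _)
        obtain ⟨y, hy, hy1, hy2⟩ := (hlev q hq).2.2.2 j hij (z - E q * m i)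
          (by rw [Nat.sub_mul]; omega) hd
        refine ⟨q * m' i + y, ?_, dvd_add (dvd_mul_of_dvd_right (hm'd _ _ hij.le) _) hy1, ?_⟩
        · rw [hp']
          calc q * m' i + y ≤ q * m' i + m' i := by omega
            _ = (q+1) * m' i := by ring
            _ ≤ p' * m' i := Nat.mul_le_mul_right _ hq
        · rw [star q hq y hy, hy2]; omega
      · have : j = i := by omega
        subst this
        obtain ⟨t, rfl⟩ := hjz
        have : t ≤ n ∨ m (j+1) = 0 := by
          rcases Nat.eq_zero_or_pos (m (j+1)) with h | h
          · exact Or.inr h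
          · left
            rw [mul_comm] at hz
            exact Nat.le_of_mul_le_mul_right hz h
        rcases this with ht | ht
        · obtain ⟨k, hk, hk2⟩ := hEj t ht
          refine ⟨k * m' j, by rw [hp']; exact Nat.mul_le_mul_right _ hk, dvd_mul_left _ _, ?_⟩
          rw [hmul, hk2, hp]; ring
        · refine ⟨0, by omega, dvd_zero _, ?_⟩
          rw [ht]
          simpa [hE0] using hmul 0

theorem cx_limit (m m' u v : ℕ → ℕ)
    (hbig : ∀ i, i ≤ m' i)
    (huv : ∀ i, u i ≤ v i)
    (H : ∀ i n, ∃ e : ℕ → ℕ, e 0 = 0 ∧ (u i ≤ n → n ≤ v i → CxLev m m' i n e)) :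
    ∃ e : ℕ → ℕ, StrictMono e ∧ e 0 = 0 ∧ (∀ j y, m' j ∣ y → m j ∣ e y) ∧
      (∀ j z, m (j+1) ∣ z → ∃ y, m' j ∣ y ∧ e y = z) := by
  have H' : ∀ i, ∃ e : ℕ → ℕ, e 0 = 0 ∧ CxLev m m' i (u i) e := by
    intro i
    obtain ⟨e, h0, h⟩ := H i (u i)
    exact ⟨e, h0, h le_rfl (huv i)⟩
  choose e he0 he using H'
  have hle : ∀ i x, x ≤ m' i → x ≤ e i x ∧ e i x ≤ 2 * x := by
    intro i x
    induction x with
    | zero => intro _; simp [he0]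
    | succ x ih =>
      intro hx
      have h1 := ih (by omega)
      have h2 := (he i).2.1 x (by omega)
      omega
  have hmono : ∀ i x y, x < y → y ≤ m' i → e i x < e i y := by
    intro i x y hxy
    induction y with
    | zero => omega
    | succ y ih =>
      intro hy
      have h2 := ((he i).2.1 y (by omega)).1
      rcases Nat.lt_or_ge x y with h | h
      · exact (ih h (by omega)).trans h2
      · have : x = y := by omega
        subst this; exact h2
  let U := Filter.hyperfilter ℕ
  have hU : ∀ N : ℕ, ∀ᶠ i in (U : Filter ℕ), N ≤ i := fun N =>
    Filter.Eventually.filter_mono Nat.hyperfilter_le_atTop (Filter.eventually_ge_atTop N)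
  have hlim : ∀ x, ∃ w, ∀ᶠ i in (U : Filter ℕ), e i x = w := by
    intro x
    have : ∀ᶠ i in (U : Filter ℕ), ∃ w ∈ Set.Iic (2 * x), e i x = w := by
      filter_upwards [hU x] with i hi
      exact ⟨e i x, (hle i x (hi.trans (hbig i))).2, rfl⟩
    rw [Ultrafilter.eventually_exists_mem_iff (Set.finite_Iic _)] at this
    obtain ⟨w, -, hw⟩ := this
    exact ⟨w, hw⟩
  choose f hf using hlim
  refine ⟨f, ?_, ?_, ?_, ?_⟩
  · intro x y hxy
    obtain ⟨i, h1, h2, h3⟩ := ((hf x).and ((hf y).and (hU y))).exists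
    rw [← h1, ← h2]
    exact hmono i x y hxy (h3.trans (hbig i))
  · obtain ⟨i, h1⟩ := (hf 0).exists
    rw [← h1, he0]
  · intro j y hy
    obtain ⟨i, h1, h2, h3⟩ := ((hf y).and ((hU j).and (hU y))).exists
    rw [← h1]
    exact (he i).2.2.1 j h2 y (h3.trans (hbig i)) hy
  · intro j z hz
    have : ∀ᶠ i in (U : Filter ℕ), ∃ y ∈ Set.Iic z, m' j ∣ y ∧ e i y = z := by
      filter_upwards [hU (j+1), hU z] with i hi hi2
      have h5 := hle i (m' i) le_rfl
      rw [(he i).1] at h5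
      obtain ⟨y, hy, hy1, hy2⟩ := (he i).2.2.2 j hi z (hi2.trans ((hbig i).trans h5.1)) hz
      exact ⟨y, by rw [Set.mem_Iic, ← hy2]; exact (hle i y hy).1, hy1, hy2⟩
    rw [Ultrafilter.eventually_exists_mem_iff (Set.finite_Iic _)] at this
    obtain ⟨y, -, hy⟩ := this
    obtain ⟨i, h1, h2⟩ := ((hf y).and hy).exists
    exact ⟨y, h2.1, by rw [← h1, h2.2]⟩

theorem cx_block {m a b : ℕ} (hm : 0 < m) (hab : a ≤ b) (h : ∀ c, m ∣ c → a < c → c ≤ b → False) :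
    a / m = b / m := by
  refine le_antisymm (Nat.div_le_div_right hab) ?_
  by_contra hc
  push Not at hc
  refine h (b / m * m) (dvd_mul_left _ _) ?_ (Nat.div_mul_le_self _ _)
  rwa [← Nat.div_lt_iff_lt_mul hm]

theorem cx_block' {m a b : ℕ} (hm : 0 < m) (hab : a / m = b / m) (c : ℕ) (hc : m ∣ c) (h1 : a < c)
    (h2 : c ≤ b) : False := by
  obtain ⟨t, rfl⟩ := hc
  have : a / m < t := by rw [Nat.div_lt_iff_lt_mul hm, mul_comm]; exact h1
  have : t ≤ b / m := by rw [Nat.le_div_iff_mul_le hm, mul_comm]; exact h2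
  omega

theorem cx_block_sym {m m' : ℕ} (f : ℕ → ℕ)
    (h : ∀ k k', k ≤ k' → k / m = k' / m → f k / m' = f k' / m') :
    ∀ k k', k / m = k' / m → f k / m' = f k' / m' := by
  intro k k' hk
  rcases le_total k k' with h1 | h1
  · exact h k k' h1 hk
  · exact (h k' k h1 hk.symm).symm

theorem cx_coarser {m n a b : ℕ} (hmn : m ∣ n) (h : a / m = b / m) : a / n = b / n := by
  obtain ⟨t, rfl⟩ := hmn
  rw [← Nat.div_div_eq_div_mul, ← Nat.div_div_eq_div_mul, h]

theorem cx_subseq (M M' : ℕ → ℕ) (hM0 : M 0 = 1) (hM'0 : M' 0 = 1)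
    (hMpos : ∀ i, 0 < M i) (hM'pos : ∀ i, 0 < M' i)
    (hMd : ∀ i j, i ≤ j → M i ∣ M j) (hM'd : ∀ i j, i ≤ j → M' i ∣ M' j)
    (hMu : ∀ N, ∃ i, N ≤ M i) (hM'u : ∀ N, ∃ i, N ≤ M' i) :
    ∃ a b u v : ℕ → ℕ, StrictMono a ∧ StrictMono b ∧ a 0 = 0 ∧ b 0 = 0 ∧ u 0 = 1 ∧ v 0 = 2 ∧ 
      (∀ i, u i ≤ v i) ∧ (∀ i, M' (b i) < M' (b (i+1))) ∧
      ∀ i, ∃ p p' A B, M (a (i+1)) = p * M (a i) ∧ M' (b (i+1)) = p' * M' (b i) ∧ u i * A ≤ p ∧ p ≤ v i * B ∧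
      p' ≤ u (i+1) * A ∧ v (i+1) * B ≤ p' := by
  have big : ∀ (M : ℕ → ℕ), (∀ i, 0 < M i) → (∀ i j, i ≤ j → M i ∣ M j) → (∀ N, ∃ i, N ≤ M i) →
      ∀ a N, ∃ a' > a, ∃ p, N ≤ p ∧ M a' = p * M a := by
    intro M hp hd hu a N
    obtain ⟨t, ht⟩ := hu (N * M a)
    obtain ⟨p, hp'⟩ := hd a (max t (a+1)) (by omega)
    refine ⟨max t (a+1), by omega, p, ?_, by rw [hp', mul_comm]⟩
    have h1 : M t ≤ M (max t (a+1)) := Nat.le_of_dvd (hp _) (hd _ _ (le_max_left _ _))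
    rw [hp', mul_comm (M a)] at h1
    exact Nat.le_of_mul_le_mul_right (ht.trans h1) (hp a)
  let S := {s : (ℕ × ℕ) × (ℕ × ℕ) // 0 < s.2.1 ∧ s.2.1 < s.2.2}
  have step : ∀ s : S, ∃ t : S, s.1.1.1 < t.1.1.1 ∧ s.1.1.2 < t.1.1.2 ∧ M' s.1.1.2 < M' t.1.1.2 ∧
      ∃ p p' A B, M t.1.1.1 = p * M s.1.1.1 ∧ M' t.1.1.2 = p' * M' s.1.1.2 ∧ s.1.2.1 * A ≤ p ∧
        p ≤ s.1.2.2 * B ∧ p' ≤ t.1.2.1 * A ∧ t.1.2.2 * B ≤ p' := by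
    rintro ⟨⟨⟨a, b⟩, ⟨u, v⟩⟩, hu, huv⟩
    simp only at hu huv
    obtain ⟨a', ha', p, hp, hpa⟩ := big M hMpos hMd hMu a (3 * (u * v))
    have hAB := cx_big hu huv hp
    set A := p / u
    set B := p / v + 1
    have hB0 : 0 < B := Nat.succ_pos _
    have hA0 : 0 < A := by omega
    obtain ⟨b', hb', p', hp', hpb⟩ := big M' hM'pos hM'd hM'u b (3 * (B * A))
    have hAB' := cx_big hB0 hAB hp'
    refine ⟨⟨⟨⟨a', b'⟩, ⟨p' / A + 1, p' / B⟩⟩, by simp, hAB'⟩, ha', hb', ?_, p, p', A, B, hpa, hpb, ?_, ?_, ?_, ?_⟩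
    · simp only
      rw [hpb]
      have h1 : 1 ≤ B * A := Nat.mul_pos hB0 hA0
      have := hM'pos b
      nlinarith
    · exact Nat.mul_div_le _ _
    · simp only
      exact (Nat.lt_mul_div_succ p (by omega)).le
    · simp only
      rw [mul_comm]
      exact (Nat.lt_mul_div_succ p' hA0).le
    · exact Nat.div_mul_le_self _ _
  choose nx hnx using step
  let s : ℕ → S := fun i => Nat.rec ⟨((0,0),(1,2)), by simp⟩ (fun _ x => nx x) i
  have hs : ∀ i, s (i+1) = nx (s i) := fun i => rfl
  refine ⟨fun i => (s i).1.1.1, fun i => (s i).1.1.2, fun i => (s i).1.2.1, fun i => (s i).1.2.2,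
    strictMono_nat_of_lt_succ fun i => ?_, strictMono_nat_of_lt_succ fun i => ?_, rfl, rfl, rfl, rfl,
    fun i => (s i).2.2.le, fun i => ?_, fun i => ?_⟩
  · rw [hs]; exact (hnx (s i)).1
  · rw [hs]; exact (hnx (s i)).2.1
  · simp only [hs]; exact (hnx (s i)).2.2.1
  · simp only [hs]; exact (hnx (s i)).2.2.2

theorem cx_numeric (M M' : ℕ → ℕ) (hM0 : M 0 = 1) (hM'0 : M' 0 = 1)
    (hMpos : ∀ i, 0 < M i) (hM'pos : ∀ i, 0 < M' i)
    (hMd : ∀ i j, i ≤ j → M i ∣ M j) (hM'd : ∀ i j, i ≤ j → M' i ∣ M' j)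
    (hMu : ∀ N, ∃ i, N ≤ M i) (hM'u : ∀ N, ∃ i, N ≤ M' i) :
    ∃ f g : ℕ → ℕ, (∀ i, ∃ j, ∀ k k', k / M i = k' / M i → f k / M' j = f k' / M' j) ∧
      (∀ i, ∃ j, ∀ k k', k / M' i = k' / M' i → g k / M j = g k' / M j) ∧
      (∃ j, ∀ k, g (f k) / M j = k / M j) ∧ (∀ y, f (g y) = y) := by
  obtain ⟨a, b, u, v, ha, hb, ha0, hb0, hu0, hv0, huv, hlt, hst⟩ :=
    cx_subseq M M' hM0 hM'0 hMpos hM'pos hMd hM'd hMu hM'u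
  have hmd : ∀ i j, i ≤ j → M (a i) ∣ M (a j) := fun i j h => hMd _ _ (ha.monotone h)
  have hm'd : ∀ i j, i ≤ j → M' (b i) ∣ M' (b j) := fun i j h => hM'd _ _ (hb.monotone h)
  have H := cx_lev (fun i => M (a i)) (fun i => M' (b i)) u v (by simp [ha0, hM0]) (by simp [hb0, hM'0])
    hu0 hv0 (fun i => hM'pos _) hmd hm'd hst
  obtain ⟨e, he, he0, h1, h2⟩ := cx_limit (fun i => M (a i)) (fun i => M' (b i)) u v
    (fun i => (strictMono_nat_of_lt_succ (f := fun i => M' (b i)) hlt).id_le i) huv H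
  have hf : ∀ k, ∃ y, e y ≤ k ∧ k < e (y+1) := by
    intro k
    refine ⟨Nat.findGreatest (fun y => e y ≤ k) k, ?_, ?_⟩
    · exact Nat.findGreatest_spec (P := fun y => e y ≤ k) (Nat.zero_le k) (by simp [he0])
    · by_contra hc
      push Not at hc
      have := Nat.le_findGreatest (P := fun y => e y ≤ k) ((he.id_le _).trans hc) hc
      simp only [id] at this
      omega
  choose f hf1 hf2 using hf
  have hfle : ∀ y k, e y ≤ k → y ≤ f k := by
    intro y k hy
    have := he.lt_iff_lt.1 (hy.trans_lt (hf2 k))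
    omega
  have hflt : ∀ y k, k < e y → f k < y := fun y k hy => he.lt_iff_lt.1 ((hf1 k).trans_lt hy)
  refine ⟨f, e, ?_, ?_, ?_, ?_⟩
  · intro i
    refine ⟨b i, cx_block_sym f ?_⟩
    intro k k' hkk hk
    have hk := cx_coarser (hMd i (a i) (ha.id_le i)) hk
    refine cx_block (hM'pos _) (hfle _ _ ((hf1 k).trans hkk)) ?_
    intro c hc hc1 hc2
    refine cx_block' (hMpos _) hk (e c) (h1 i c hc) ?_ ?_
    · by_contra hcon
      push Not at hcon
      have := hfle _ _ hcon
      omega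
    · exact (he.monotone hc2).trans (hf1 k')
  · intro i
    refine ⟨a (i+1), cx_block_sym e ?_⟩
    intro k k' hkk hk
    have hk := cx_coarser (hM'd i (b i) (hb.id_le i)) hk
    refine cx_block (hMpos _) (he.monotone hkk) ?_
    intro c hc hc1 hc2
    obtain ⟨y, hy, rfl⟩ := h2 i c hc
    exact cx_block' (hM'pos _) hk y hy (he.lt_iff_lt.1 hc1) (he.le_iff_le.1 hc2)
  · refine ⟨a 1, fun k => cx_block (hMpos _) (hf1 k) ?_⟩
    intro c hc hc1 hc2
    obtain ⟨y, hy, rfl⟩ := h2 0 c hc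
    have h3 := he.lt_iff_lt.1 hc1
    have h4 := hfle _ _ hc2
    omega
  · intro y
    have h3 := hfle y (e y) le_rfl
    have h4 := hflt (y+1) (e y) (he (Nat.lt_succ_self y))
    omega

/-- finite differences -/
def CxFD {G H : Type*} [AddCommGroup G] [AddCommGroup H] (f : G → H) : Prop :=
  ∀ s : G, (Set.range fun x => f (x + s) - f x).Finite

/-- algebraic coarse equivalence -/
def CxAlg (G H : Type*) [AddCommGroup G] [AddCommGroup H] : Prop :=
  ∃ (f : G → H) (g : H → G), CxFD f ∧ CxFD g ∧ (Set.range fun x => g (f x) - x).Finite ∧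
    (Set.range fun y => f (g y) - y).Finite

/-- Tower of finite extensions -/
structure CxTower {G : Type*} [AddCommGroup G] (L : AddSubgroup G) (M : ℕ → ℕ) (τ : ℕ → G) : Prop where
  zero : M 0 = 1
  pos : ∀ i, 0 < M i
  dvd : ∀ i j, i ≤ j → M i ∣ M j
  unb : ∀ N, ∃ i, N ≤ M i
  add : ∀ i d r, r < M i → τ (M i * d + r) = τ (M i * d) + τ r
  inj : ∀ k k', τ k - τ k' ∈ L → k = k'
  tr : ∀ s, ∃ i, ∀ r < M i, ∃ r1 < M i, τ r + s - τ r1 ∈ L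

theorem CxTower.surj {G : Type*} [AddCommGroup G] {L : AddSubgroup G} {M : ℕ → ℕ} {τ : ℕ → G}
    (h : CxTower L M τ) (x : G) : ∃ k, x - τ k ∈ L := by
  have h0 : τ 0 = 0 := by
    have := h.add 0 0 0 (h.pos 0)
    simpa using this
  obtain ⟨i, hi⟩ := h.tr x
  obtain ⟨r1, -, h1⟩ := hi 0 (h.pos i)
  exact ⟨r1, by simpa [h0] using h1⟩

theorem CxTower.diff_finite {G : Type*} [AddCommGroup G] {L : AddSubgroup G} {M : ℕ → ℕ} {τ : ℕ → G}
    (h : CxTower L M τ) (i : ℕ) : ∃ S : Set G, S.Finite ∧ ∀ k k', k / M i = k' / M i → τ k - τ k' ∈ S := by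
  refine ⟨Set.image2 (fun r r' => τ r - τ r') (Set.Iio (M i)) (Set.Iio (M i)),
    Set.Finite.image2 _ (Set.finite_Iio _) (Set.finite_Iio _), ?_⟩
  intro k k' hk
  refine ⟨k % M i, Nat.mod_lt _ (h.pos i), k' % M i, Nat.mod_lt _ (h.pos i), ?_⟩
  have h1 := h.add i (k / M i) (k % M i) (Nat.mod_lt _ (h.pos i))
  have h2 := h.add i (k' / M i) (k' % M i) (Nat.mod_lt _ (h.pos i))
  rw [Nat.div_add_mod] at h1 h2
  simp only
  rw [h1, h2, hk]; abel

theorem cx_fd {G H : Type*} [AddCommGroup G] [AddCommGroup H] {L : AddSubgroup G} {L' : AddSubgroup H}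
    {M M' : ℕ → ℕ} {τ : ℕ → G} {τ' : ℕ → H} (hT : CxTower L M τ) (hT' : CxTower L' M' τ')
    (θ : L →+ H) (f : ℕ → ℕ) (hf : ∀ i, ∃ j, ∀ k k', k / M i = k' / M i → f k / M' j = f k' / M' j)
    (κ : G → ℕ) (hκ : ∀ x, x - τ (κ x) ∈ L) :
    CxFD (fun x => θ ⟨x - τ (κ x), hκ x⟩ + τ' (f (κ x))) := by
  intro s
  obtain ⟨i, hi⟩ := hT.tr s
  obtain ⟨j, hj⟩ := hf i
  obtain ⟨S', hS', hS'2⟩ := hT'.diff_finite j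
  have hfin : (Set.image2 (fun r r' => τ r + s - τ r') (Set.Iio (M i)) (Set.Iio (M i))).Finite :=
    Set.Finite.image2 _ (Set.finite_Iio _) (Set.finite_Iio _)
  have hfin2 : ((fun l : L => (l : G)) ⁻¹'
      (Set.image2 (fun r r' => τ r + s - τ r') (Set.Iio (M i)) (Set.Iio (M i)))).Finite :=
    hfin.preimage Subtype.val_injective.injOn
  refine (Set.Finite.image2 (fun a b => a + b) (hfin2.image θ) hS').subset ?_
  rintro _ ⟨x, rfl⟩
  set k := κ x with hk
  have hr : k % M i < M i := Nat.mod_lt _ (hT.pos i)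
  obtain ⟨r1, hr1, hr2⟩ := hi (k % M i) hr
  have h1 := hT.add i (k / M i) (k % M i) hr
  rw [Nat.div_add_mod] at h1
  have h2 := hT.add i (k / M i) r1 hr1
  have hk1 : κ (x + s) = M i * (k / M i) + r1 := by
    apply hT.inj
    have e : τ (κ (x+s)) - τ (M i * (k / M i) + r1) =
        -((x + s) - τ (κ (x + s))) + (x - τ k) + (τ (k % M i) + s - τ r1) := by
      rw [h2, h1]; abel
    rw [e]
    exact L.add_mem (L.add_mem (L.neg_mem (hκ _)) (hκ _)) hr2
  have hdiv : (M i * (k / M i) + r1) / M i = k / M i := by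
    rw [add_comm, Nat.add_mul_div_left _ _ (hT.pos i), Nat.div_eq_of_lt hr1, zero_add]
  refine ⟨_, ⟨⟨x + s - τ (κ (x+s)), hκ _⟩ - ⟨x - τ k, hκ x⟩, ?_, rfl⟩, _,
    hS'2 (f (κ (x+s))) (f k) (hj _ _ (by rw [hk1, hdiv])), ?_⟩
  · refine ⟨k % M i, hr, r1, hr1, ?_⟩
    simp only [AddSubgroup.coe_sub]
    rw [hk1, h2, h1]; abel
  · simp only [map_sub]
    abel

theorem cx_alg_of_tower {G H : Type*} [AddCommGroup G] [AddCommGroup H] {L : AddSubgroup G} {L' : AddSubgroup H}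
    {M M' : ℕ → ℕ} {τ : ℕ → G} {τ' : ℕ → H} (hT : CxTower L M τ) (hT' : CxTower L' M' τ')
    (θ : L ≃+ L') : CxAlg G H := by
  obtain ⟨f, g, hf, hg, ⟨j, hgf⟩, hfg⟩ := cx_numeric M M' hT.zero hT'.zero hT.pos hT'.pos hT.dvd hT'.dvd
    hT.unb hT'.unb
  choose κ hκ using hT.surj
  choose κ' hκ' using hT'.surj
  have hu : ∀ (l : L) k, κ (l + τ k) = k := by
    intro l k
    apply hT.inj
    have := L.sub_mem l.2 (hκ (l + τ k))
    convert this using 1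
    abel
  have hu' : ∀ (l : L') k, κ' (l + τ' k) = k := by
    intro l k
    apply hT'.inj
    have := L'.sub_mem l.2 (hκ' (l + τ' k))
    convert this using 1
    abel
  refine ⟨_, _, cx_fd hT hT' (L'.subtype.comp θ.toAddMonoidHom) f hf κ hκ,
    cx_fd hT' hT (L.subtype.comp θ.symm.toAddMonoidHom) g hg κ' hκ', ?_, ?_⟩
  · obtain ⟨S, hS, hS2⟩ := hT.diff_finite j
    refine hS.subset ?_
    rintro _ ⟨x, rfl⟩
    have h1 := hS2 _ _ (hgf (κ x))
    convert h1 using 1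
    simp only [AddMonoidHom.comp_apply, AddSubgroup.subtype_apply, AddEquiv.coe_toAddMonoidHom]
    simp only [hu', add_sub_cancel_right, Subtype.coe_eta, AddEquiv.symm_apply_apply]
    abel
  · refine (Set.finite_singleton (0:H)).subset ?_
    rintro _ ⟨x, rfl⟩
    simp only [AddMonoidHom.comp_apply, AddSubgroup.subtype_apply, AddEquiv.coe_toAddMonoidHom]
    simp only [hu, add_sub_cancel_right, Subtype.coe_eta, AddEquiv.apply_symm_apply, hfg]
    simp

theorem cx_exists_tower {G : Type*} [AddCommGroup G] [Countable G] (L : AddSubgroup G)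
    (htor : ∀ x : G, ∃ n : ℕ, 0 < n ∧ n • x ∈ L)
    (hinf : ∀ S : Set G, S.Finite → ∃ x, ∀ s ∈ S, x - s ∉ L) :
    ∃ (M : ℕ → ℕ) (τ : ℕ → G), CxTower L M τ := by
  classical
  obtain ⟨g, hg⟩ := exists_surjective_nat G
  obtain ⟨K, hK0, hKs⟩ : ∃ K : ℕ → AddSubgroup G, K 0 = L ∧ ∀ i, K (i+1) = K i ⊔ AddSubgroup.zmultiples (g i) :=
    ⟨fun i => Nat.rec L (fun j A => A ⊔ AddSubgroup.zmultiples (g j)) i, rfl, fun _ => rfl⟩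
  have hLK : ∀ i, L ≤ K i := by
    intro i
    induction i with
    | zero => exact hK0.ge
    | succ i ih => rw [hKs]; exact ih.trans le_sup_left
  have hex : ∀ i, ∃ n : ℕ, 0 < n ∧ n • g i ∈ K i := fun i => by
    obtain ⟨n, hn, h⟩ := htor (g i)
    exact ⟨n, hn, hLK i h⟩
  have hex2 : ∀ i, ∃ n : ℕ, 0 < n ∧ n • g i ∈ K i ∧ ∀ n' : ℕ, 0 < n' → n' • g i ∈ K i → n ≤ n' := fun i =>
    ⟨Nat.find (hex i), (Nat.find_spec (hex i)).1, (Nat.find_spec (hex i)).2,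
      fun n h1 h2 => Nat.find_min' (hex i) ⟨h1, h2⟩⟩
  choose p hp0 hpm hpmin using hex2
  let M : ℕ → ℕ := fun i => ∏ j ∈ Finset.range i, p j
  have hM0 : M 0 = 1 := by simp [M]
  have hMs : ∀ i, M (i+1) = M i * p i := fun i => Finset.prod_range_succ _ _
  have hMpos : ∀ i, 0 < M i := fun i => Finset.prod_pos fun j _ => hp0 j
  have hMd : ∀ i j, i ≤ j → M i ∣ M j := fun i j hij =>
    Finset.prod_dvd_prod_of_subset _ _ _ (Finset.range_mono hij)
  let dig : ℕ → ℕ → ℕ := fun j k => (k / M j) % p j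
  have dig_lo : ∀ i d r j, j < i → dig j (M i * d + r) = dig j r := by
    intro i d r j hj
    obtain ⟨t, ht⟩ := hMd (j+1) i hj
    simp only [dig]
    rw [ht, hMs, show M j * p j * t * d + r = r + M j * (p j * (t * d)) by ring,
      Nat.add_mul_div_left _ _ (hMpos j), Nat.add_mul_mod_self_left]
  have dig_hi : ∀ i d r j, i ≤ j → r < M i → dig j (M i * d + r) = dig j (M i * d) := by
    intro i d r j hj hr
    obtain ⟨t, ht⟩ := hMd i j hj
    simp only [dig]
    rw [ht, ← Nat.div_div_eq_div_mul, ← Nat.div_div_eq_div_mul, add_comm, Nat.add_mul_div_left _ _ (hMpos i),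
      Nat.div_eq_of_lt hr, Nat.mul_div_cancel_left _ (hMpos i), zero_add]
  have dig_zero : ∀ j r, r < M j → dig j r = 0 := by
    intro j r hr
    simp [dig, Nat.div_eq_of_lt hr]
  have dig_mul : ∀ i d j, j < i → dig j (M i * d) = 0 := by
    intro i d j hj
    have := dig_lo i d 0 j hj
    rw [add_zero] at this
    rw [this, dig_zero _ _ (hMpos j)]
  let T : ℕ → ℕ → G := fun N k => ∑ j ∈ Finset.range N, dig j k • g j
  have hTs : ∀ i k, T (i+1) k = T i k + dig i k • g i := fun i k => Finset.sum_range_succ _ _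
  have hTmod : ∀ i d r, T i (M i * d + r) = T i r := by
    intro i d r
    refine Finset.sum_congr rfl fun j hj => ?_
    rw [dig_lo i d r j (Finset.mem_range.1 hj)]
  have hTK : ∀ i k, T i k ∈ K i := by
    intro i k
    induction i with
    | zero => simp [T, (K 0).zero_mem]
    | succ i ih =>
      rw [hTs, hKs]
      exact add_mem (AddSubgroup.mem_sup_left ih)
        (AddSubgroup.mem_sup_right (nsmul_mem (AddSubgroup.mem_zmultiples _) _))
  have hText : ∀ i j k, i ≤ j → k < M i → T j k = T i k := by
    intro i j k hij hk
    induction j, hij using Nat.le_induction with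
    | base => rfl
    | succ j hij ih =>
      rw [hTs, ih, dig_zero j k (hk.trans_le (Nat.le_of_dvd (hMpos j) (hMd i j hij)))]
      simp
  have hTinj : ∀ i k k', k < M i → k' < M i → T i k - T i k' ∈ L → k = k' := by
    intro i
    induction i with
    | zero => intro k k' h1 h2 _; omega
    | succ i ih =>
      have key : ∀ k k', k < M (i+1) → k' < M (i+1) → T (i+1) k - T (i+1) k' ∈ L → dig i k' ≤ dig i k → k = k' := by
        intro k k' h1 h2 h3 hle
        rw [hTs, hTs] at h3
        have h4 : (dig i k - dig i k') • g i ∈ K i := by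
          have e : (dig i k - dig i k') • g i =
              (T i k + dig i k • g i - (T i k' + dig i k' • g i)) - T i k + T i k' := by
            rw [sub_nsmul _ hle]; abel
          rw [e]
          exact add_mem (sub_mem (hLK i h3) (hTK _ _)) (hTK _ _)
        have h5 : dig i k = dig i k' := by
          by_contra hne
          have h6 := hpmin i _ (by omega) h4
          have h7 : dig i k < p i := Nat.mod_lt _ (hp0 i)
          omega
        rw [h5, add_sub_add_right_eq_sub] at h3
        have hd : ∀ k, k < M (i+1) → dig i k = k / M i := by
          intro k hk
          apply Nat.mod_eq_of_lt
          rw [Nat.div_lt_iff_lt_mul (hMpos i), mul_comm, ← hMs]; exact hk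
        rw [hd k h1, hd k' h2] at h5
        have e1 := hTmod i (k / M i) (k % M i)
        have e2 := hTmod i (k' / M i) (k' % M i)
        rw [Nat.div_add_mod] at e1 e2
        rw [e1, e2] at h3
        have h6 := ih _ _ (Nat.mod_lt _ (hMpos i)) (Nat.mod_lt _ (hMpos i)) h3
        rw [← Nat.div_add_mod k (M i), ← Nat.div_add_mod k' (M i), h5, h6]
      intro k k' h1 h2 h3
      rcases le_total (dig i k') (dig i k) with h | h
      · exact key k k' h1 h2 h3 h
      · refine (key k' k h2 h1 ?_ h).symm
        rw [← neg_sub]; exact L.neg_mem h3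
  have hTsurj : ∀ i, ∀ x ∈ K i, ∃ r < M i, x - T i r ∈ L := by
    intro i
    induction i with
    | zero => intro x hx; exact ⟨0, hMpos 0, by rw [hK0] at hx; simpa [T] using hx⟩
    | succ i ih =>
      intro x hx
      rw [hKs, AddSubgroup.mem_sup] at hx
      obtain ⟨y, hy, z, hz, rfl⟩ := hx
      obtain ⟨n, rfl⟩ := AddSubgroup.mem_zmultiples_iff.1 hz
      have hpz : (0:ℤ) < p i := by exact_mod_cast hp0 i
      obtain ⟨d, hd⟩ := Int.eq_ofNat_of_zero_le (Int.emod_nonneg n hpz.ne')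
      have hdp : d < p i := by
        have := Int.emod_lt_of_pos n hpz
        omega
      obtain ⟨r, hr, hr2⟩ := ih (y + (n / p i) • (p i • g i)) (add_mem hy (zsmul_mem (hpm i) _))
      refine ⟨M i * d + r, ?_, ?_⟩
      · rw [hMs]
        calc M i * d + r < M i * d + M i := by omega
          _ = M i * (d+1) := by ring
          _ ≤ M i * p i := Nat.mul_le_mul_left _ hdp
      · rw [hTs, hTmod]
        have : dig i (M i * d + r) = d := by
          simp only [dig]
          rw [add_comm, Nat.add_mul_div_left _ _ (hMpos i), Nat.div_eq_of_lt hr, zero_add, Nat.mod_eq_of_lt hdp]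
        rw [this]
        convert hr2 using 1
        have e : n • g i = (n / p i) • (p i • g i) + d • g i := by
          conv_lhs => rw [← Int.mul_ediv_add_emod n (p i), hd]
          rw [add_zsmul, mul_comm, mul_zsmul, natCast_zsmul, natCast_zsmul]
        rw [e]; abel
  have hgK : ∀ x, ∃ i, x ∈ K i := by
    intro x
    obtain ⟨j, rfl⟩ := hg x
    exact ⟨j+1, by rw [hKs]; exact AddSubgroup.mem_sup_right (AddSubgroup.mem_zmultiples _)⟩
  have hMmono : ∀ i j, i ≤ j → M i ≤ M j := fun i j h => Nat.le_of_dvd (hMpos j) (hMd i j h)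
  have hunb : ∀ N, ∃ i, N < M i := by
    intro N
    by_contra hcon
    push Not at hcon
    -- M eventually maximal
    obtain ⟨i0, hi0⟩ : ∃ i0, ∀ i, M i ≤ M i0 := by
      have hb : BddAbove (Set.range M) := ⟨N, by rintro _ ⟨i, rfl⟩; exact hcon i⟩
      obtain ⟨i0, h0⟩ := Nat.sSup_mem (Set.range_nonempty M) hb
      exact ⟨i0, fun i => by rw [h0]; exact le_csSup hb ⟨i, rfl⟩⟩
    obtain ⟨x, hx⟩ := hinf (T i0 '' Set.Iio (M i0)) ((Set.finite_Iio _).image _)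
    obtain ⟨i, hi⟩ := hgK x
    obtain ⟨r, hr, hr2⟩ := hTsurj i x hi
    have hr3 := hr.trans_le (hi0 i)
    refine hx (T i0 r) ⟨r, hr3, rfl⟩ ?_
    have : T i0 r = T i r := by
      rcases le_total i i0 with h | h
      · exact hText i i0 r h hr
      · exact (hText i0 i r h hr3).symm
    rwa [this]
  choose N hN using hunb
  let τ : ℕ → G := fun k => T (N k) k
  have hτ : ∀ i k, k < M i → τ k = T i k := by
    intro i k hk
    rcases le_total i (N k) with h | h
    · exact hText i _ k h hk
    · exact (hText _ i k h (hN k)).symm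
  refine ⟨M, τ, hM0, hMpos, hMd, fun n => ⟨N n, (hN n).le⟩, ?_, ?_, ?_⟩
  · intro i d r hr
    have h1 := hN (M i * d + r)
    rw [hτ _ _ h1, hτ (N (M i * d + r)) (M i * d) (by omega), hτ _ r (lt_of_le_of_lt (Nat.le_add_left _ _) h1)]
    simp only [T]
    rw [← Finset.sum_add_distrib]
    refine Finset.sum_congr rfl fun j _ => ?_
    rw [← add_nsmul]
    congr 1
    rcases Nat.lt_or_ge j i with h | h
    · rw [dig_lo i d r j h, dig_mul i d j h, zero_add]
    · rw [dig_hi i d r j h hr, dig_zero j r (hr.trans_le (hMmono i j h)), add_zero]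
  · intro k k' h
    have h1 : k < M (max (N k) (N k')) := (hN k).trans_le (hMmono _ _ (le_max_left _ _))
    have h2 : k' < M (max (N k) (N k')) := (hN k').trans_le (hMmono _ _ (le_max_right _ _))
    rw [hτ _ _ h1, hτ _ _ h2] at h
    exact hTinj _ _ _ h1 h2 h
  · intro s
    obtain ⟨i, hi⟩ := hgK s
    refine ⟨i, fun r hr => ?_⟩
    obtain ⟨r1, hr1, h1⟩ := hTsurj i (τ r + s) (add_mem (by rw [hτ i r hr]; exact hTK _ _) hi)
    exact ⟨r1, hr1, by rw [hτ i r1 hr1]; exact h1⟩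

theorem cx_free (G : Type) [AddCommGroup G] :
    ∃ (s : Set G) (L : AddSubgroup G), Cardinal.mk s = Module.rank ℤ G ∧ Nonempty ((s →₀ ℤ) ≃+ L) ∧
      (∀ x : G, ∃ n : ℕ, 0 < n ∧ n • x ∈ L) ∧
      (¬ AddGroup.FG G → ∀ S : Set G, S.Finite → ∃ x, ∀ t ∈ S, x - t ∉ L) ∧
      (AddGroup.FG G → ∃ S : Set G, S.Finite ∧ ∀ x, ∃ t ∈ S, x - t ∈ L) := by
  classical
  obtain ⟨s, hs, hmax⟩ := exists_maximal_linearIndepOn ℤ (id : G → G)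
  rw [Set.image_id] at hmax
  have hli : LinearIndependent ℤ (Subtype.val : s → G) := hs
  set L0 := Submodule.span ℤ s with hL0
  have htor : ∀ x : G, ∃ n : ℕ, 0 < n ∧ n • x ∈ L0 := by
    intro x
    by_cases hx : x ∈ s
    · exact ⟨1, one_pos, by simpa using Submodule.subset_span hx⟩
    · obtain ⟨a, ha, h⟩ := hmax x hx
      refine ⟨a.natAbs, Int.natAbs_pos.2 ha, ?_⟩
      rcases Int.natAbs_eq a with h1 | h1
      · rw [← natCast_zsmul, ← h1]; exact h
      · rw [← natCast_zsmul, ← neg_neg ((a.natAbs : ℤ)), ← h1, neg_zsmul]; exact L0.neg_mem h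
  have hrank : Cardinal.mk s = Module.rank ℤ G := by
    rw [← rank_quotient_add_rank_of_isDomain L0, rank_span_set hs]
    have : Module.rank ℤ (G ⧸ L0) = 0 := by
      rw [rank_eq_zero_iff]
      intro x
      obtain ⟨y, rfl⟩ := Submodule.Quotient.mk_surjective _ x
      obtain ⟨n, hn, h⟩ := htor y
      refine ⟨n, by exact_mod_cast hn.ne', ?_⟩
      rw [← Submodule.Quotient.mk_smul, Submodule.Quotient.mk_eq_zero, natCast_zsmul]
      exact h
    rw [this, zero_add]
  let φ : (s →₀ ℤ) →+ G := (Finsupp.linearCombination ℤ (Subtype.val : s → G)).toAddMonoidHom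
  have hφ : Function.Injective φ := hli
  have hφr : ∀ x, x ∈ φ.range ↔ x ∈ L0 := by
    intro x
    have : L0 = LinearMap.range (Finsupp.linearCombination ℤ (Subtype.val : s → G)) := by
      rw [Finsupp.range_linearCombination, Subtype.range_coe]
    rw [this]; rfl
  by_cases hinf : ¬ AddGroup.FG G ∧ ∃ S : Set G, S.Finite ∧ ∀ x, ∃ t ∈ S, x - t ∈ L0
  · obtain ⟨hfg, S, hS, hcov⟩ := hinf
    have hsinf : s.Infinite := by
      intro hfin
      apply hfg
      rw [← Module.Finite.iff_addGroup_fg]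
      refine ⟨⟨(hfin.union hS).toFinset, ?_⟩⟩
      rw [eq_top_iff]
      intro x _
      obtain ⟨t, ht, h⟩ := hcov x
      rw [Set.Finite.coe_toFinset, ← sub_add_cancel x t]
      exact add_mem (Submodule.span_mono Set.subset_union_left h)
        (Submodule.subset_span (Or.inr ht))
    let ψ : (s →₀ ℤ) →+ G := φ.comp (2 • AddMonoidHom.id _)
    have hψa : ∀ c, ψ c = φ (2 • c) := fun c => rfl
    have hψ : Function.Injective ψ := by
      intro a b h
      have := hφ h
      ext i
      have := DFunLike.congr_fun this i
      simp at this
      exact this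
    refine ⟨s, ψ.range, hrank, ⟨AddMonoidHom.ofInjective hψ⟩, ?_, ?_, fun h => absurd h hfg⟩
    · intro x
      obtain ⟨n, hn, h⟩ := htor x
      obtain ⟨c, hc⟩ := (hφr _).2 h
      refine ⟨2 * n, by omega, c, ?_⟩
      rw [hψa, map_nsmul, hc, mul_nsmul']
    · intro _ S2 hS2
      by_contra hcon
      push Not at hcon
      choose t ht ht2 using hcon
      have := hsinf.to_subtype
      have := hS2.to_subtype
      obtain ⟨i, j, hij, h⟩ := Finite.exists_ne_map_eq_of_infinite (fun i : s => (⟨t i, ht i⟩ : S2))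
      have h' : t i = t j := congrArg Subtype.val h
      have hm : (i : G) - j ∈ ψ.range := by
        have := ψ.range.sub_mem (ht2 i) (ht2 j)
        rw [h', sub_sub_sub_cancel_right] at this
        exact this
      obtain ⟨c, hc⟩ := hm
      have e : φ (Finsupp.single i 1 - Finsupp.single j 1) = i - j := by
        simp [φ]
      rw [hψa, ← e] at hc
      have := DFunLike.congr_fun (hφ hc) i
      simp [Finsupp.single_apply, hij.symm] at this
      omega
  · refine ⟨s, φ.range, hrank, ⟨AddMonoidHom.ofInjective hφ⟩, ?_, ?_, ?_⟩
    · intro x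
      simp only [hφr]
      exact htor x
    · intro hfg S hS
      push Not at hinf
      simp only [hφr]
      exact hinf hfg S hS
    · intro hfg
      have : Module.Finite ℤ G := Module.Finite.iff_addGroup_fg.2 hfg
      have hft : Finite (G ⧸ L0) := by
        apply Module.finite_of_fg_torsion
        intro x
        obtain ⟨y, rfl⟩ := Submodule.Quotient.mk_surjective _ x
        obtain ⟨n, hn, h⟩ := htor y
        refine ⟨⟨n, mem_nonZeroDivisors_of_ne_zero (by exact_mod_cast hn.ne')⟩, ?_⟩
        rw [Submonoid.mk_smul, ← Submodule.Quotient.mk_smul, Submodule.Quotient.mk_eq_zero, natCast_zsmul]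
        exact h
      refine ⟨Set.range (fun q : G ⧸ L0 => Quotient.out q), Set.finite_range _, ?_⟩
      intro x
      refine ⟨_, ⟨Submodule.Quotient.mk x, rfl⟩, ?_⟩
      rw [hφr, ← Submodule.Quotient.eq]
      exact (Quotient.out_eq _).symm

theorem cx_alg_of_finite {G H : Type} [AddCommGroup G] [AddCommGroup H] {L : AddSubgroup G} {L' : AddSubgroup H}
    (θ : L ≃+ L') {S : Set G} (hS : S.Finite) (hc : ∀ x, ∃ t ∈ S, x - t ∈ L)
    {S' : Set H} (hS' : S'.Finite) (hc' : ∀ x, ∃ t ∈ S', x - t ∈ L') : CxAlg G H := by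
  have fd : ∀ {G H : Type} [AddCommGroup G] [AddCommGroup H] {L : AddSubgroup G} (θ : L →+ H) {S : Set G}
      (hS : S.Finite) (ρ : G → G) (h1 : ∀ x, ρ x ∈ S) (h2 : ∀ x, x - ρ x ∈ L),
      CxFD (fun x => θ ⟨x - ρ x, h2 x⟩) := by
    intro G H _ _ L θ S hS ρ h1 h2 s
    have hfin : (Set.image2 (fun r r' => r + s - r') S S).Finite := Set.Finite.image2 _ hS hS
    have hfin2 : ((fun l : L => (l : G)) ⁻¹' (Set.image2 (fun r r' => r + s - r') S S)).Finite :=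
      hfin.preimage Subtype.val_injective.injOn
    refine (hfin2.image θ).subset ?_
    rintro _ ⟨x, rfl⟩
    refine ⟨⟨x + s - ρ (x+s), h2 _⟩ - ⟨x - ρ x, h2 x⟩, ⟨ρ x, h1 _, ρ (x+s), h1 _, ?_⟩, by simp⟩
    simp only [AddSubgroup.coe_sub]; abel
  have cl : ∀ {G H : Type} [AddCommGroup G] [AddCommGroup H] {L : AddSubgroup G} {L' : AddSubgroup H}
      (θ : L ≃+ L') {S : Set G} (hS : S.Finite) {S' : Set H} (hS' : S'.Finite)
      (ρ : G → G) (h1 : ∀ x, ρ x ∈ S) (h2 : ∀ x, x - ρ x ∈ L)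
      (ρ' : H → H) (h1' : ∀ x, ρ' x ∈ S') (h2' : ∀ x, x - ρ' x ∈ L'),
      (Set.range fun x => (L.subtype.comp θ.symm.toAddMonoidHom)
          ⟨(L'.subtype.comp θ.toAddMonoidHom) ⟨x - ρ x, h2 x⟩
            - ρ' ((L'.subtype.comp θ.toAddMonoidHom) ⟨x - ρ x, h2 x⟩), h2' _⟩ - x).Finite := by
    intro G H _ _ L L' θ S hS S' hS' ρ h1 h2 ρ' h1' h2'
    have hfin2 : ((fun l : L' => (l : H)) ⁻¹' S').Finite := hS'.preimage Subtype.val_injective.injOn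
    refine (Set.Finite.image2 (fun (a : L') (b : G) => - (θ.symm a : G) - b) hfin2 hS).subset ?_
    rintro _ ⟨x, rfl⟩
    set l : L := ⟨x - ρ x, h2 x⟩ with hl
    have hm : ρ' (θ l : H) ∈ L' := by
      have := L'.sub_mem (θ l).2 (h2' (θ l : H))
      simpa using this
    refine ⟨⟨ρ' (θ l), hm⟩, h1' _, ρ x, h1 x, ?_⟩
    have e : (⟨(θ l : H) - ρ' (θ l), h2' _⟩ : L') = θ l - ⟨ρ' (θ l), hm⟩ := by
      ext; simp
    simp only [AddMonoidHom.comp_apply, AddSubgroup.subtype_apply, AddEquiv.coe_toAddMonoidHom]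
    rw [e, map_sub, AddEquiv.symm_apply_apply, AddSubgroup.coe_sub]
    simp only [hl]; abel
  choose ρ h1 h2 using hc
  choose ρ' h1' h2' using hc'
  refine ⟨_, _, fd (L'.subtype.comp θ.toAddMonoidHom) hS ρ h1 h2,
    fd (L.subtype.comp θ.symm.toAddMonoidHom) hS' ρ' h1' h2',
    cl θ hS hS' ρ h1 h2 ρ' h1' h2', cl θ.symm hS' hS ρ' h1' h2' ρ h1 h2⟩

theorem cx_alg_symm {G H : Type} [AddCommGroup G] [AddCommGroup H] (h : CxAlg G H) : CxAlg H G := by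
  obtain ⟨f, g, a, b, c, d⟩ := h
  exact ⟨g, f, b, a, d, c⟩

theorem cx_fg {G H : Type} [AddCommGroup G] [AddCommGroup H] (h : CxAlg G H)
    (hG : AddGroup.FG G) : AddGroup.FG H := by
  obtain ⟨f, g, hf, hg, -, hc⟩ := h
  obtain ⟨S, hS, hSf⟩ := AddGroup.fg_iff.1 hG
  refine AddGroup.fg_iff.2 ⟨(⋃ s ∈ S, Set.range fun x => f (x+s) - f x) ∪
    (Set.range fun y => f (g y) - y) ∪ {f 0}, ?_,
    ((hSf.biUnion fun s _ => hf s).union hc).union (Set.finite_singleton _)⟩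
  set K := AddSubgroup.closure ((⋃ s ∈ S, Set.range fun x => f (x+s) - f x) ∪
    (Set.range fun y => f (g y) - y) ∪ {f 0}) with hK
  have h0 : f 0 ∈ K := AddSubgroup.subset_closure (Or.inr rfl)
  have h1 : ∀ x, ∀ s ∈ S, f (x+s) - f x ∈ K := fun x s hs =>
    AddSubgroup.subset_closure (Or.inl (Or.inl (Set.mem_biUnion hs ⟨x, rfl⟩)))
  have h2 : ∀ y, f (g y) - y ∈ K := fun y =>
    AddSubgroup.subset_closure (Or.inl (Or.inr ⟨y, rfl⟩))
  have h3 : ∀ s : G, ∀ x, f (x + s) - f x ∈ K := by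
    intro s
    have hs : s ∈ AddSubgroup.closure S := by rw [hS]; trivial
    induction hs using AddSubgroup.closure_induction with
    | mem s hs => exact fun x => h1 x s hs
    | zero => intro x; simp
    | add a b _ _ ha hb =>
      intro x
      have := K.add_mem (hb (x + a)) (ha x)
      rwa [sub_add_sub_cancel, add_assoc] at this
    | neg a _ ha =>
      intro x
      have := K.neg_mem (ha (x + -a))
      simpa using this
  rw [eq_top_iff]
  intro y _
  have a1 := K.add_mem (h3 (g y) 0) h0
  have a2 := K.sub_mem a1 (h2 y)
  simpa using a2

theorem cx_growth {n k C K : ℕ} (h : ∀ R : ℕ, (R+1)^n ≤ K * (2 * (C * (n * R)) + 1)^k) : n ≤ k := by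
  by_contra hlt
  push Not at hlt
  obtain ⟨m, rfl⟩ : ∃ m, n = k + 1 + m := ⟨n - (k+1), by omega⟩
  set n := k + 1 + m
  set K' := K * (2 * C * n + 1)^k
  have h1 := h K'
  have h2 : K * (2 * (C * (n * K')) + 1)^k ≤ K' * (K'+1)^k := by
    have : 2 * (C * (n * K')) + 1 ≤ (2 * C * n + 1) * (K' + 1) := by nlinarith
    calc _ ≤ K * ((2 * C * n + 1) * (K' + 1))^k := by gcongr
      _ = _ := by rw [mul_pow, ← mul_assoc]
  have h3 : (K'+1) * (K'+1)^k ≤ (K'+1)^n := by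
    rw [← pow_succ']
    exact Nat.pow_le_pow_right (by omega) (by omega)
  have h4 : 0 < (K'+1)^k := by positivity
  nlinarith

theorem cx_rank_le {G H : Type} [AddCommGroup G] [AddCommGroup H] (h : CxAlg G H) :
    torsionFreeRank G ≤ torsionFreeRank H := by
  classical
  obtain ⟨f, g, hf, -, hc, -⟩ := h
  refine iSup₂_le ?_
  rintro n ⟨φ, hφ⟩
  set D := hc.toFinset with hD
  have hDm : ∀ x, g (f x) - x ∈ D := fun x => by rw [hD, Set.Finite.mem_toFinset]; exact ⟨x, rfl⟩
  set B : Set H := ⋃ i : Fin n, Set.range fun x => f (x + φ (Pi.single i 1)) - f x with hB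
  have hBf : B.Finite := Set.finite_iUnion fun i => hf _
  have hBm : ∀ i x, f (x + φ (Pi.single i 1)) - f x ∈ B := fun i x => Set.mem_iUnion.2 ⟨i, x, rfl⟩
  set H' := AddSubgroup.closure B with hH'
  have : AddGroup.FG H' := by
    rw [AddGroup.fg_iff_addSubgroup_fg]
    exact ⟨hBf.toFinset, by simp [hH']⟩
  obtain ⟨k, ι, hι, p, hp, e, ⟨ψ⟩⟩ := AddCommGroup.equiv_free_prod_directSum_zmod H'
  have hk : (k : ℕ∞) ≤ torsionFreeRank H := by
    refine le_iSup₂_of_le k ?_ le_rfl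
    refine ⟨(H'.subtype.comp ψ.symm.toAddMonoidHom).comp ((AddMonoidHom.inl _ _).comp
      (Finsupp.linearEquivFunOnFinite ℤ ℤ (Fin k)).symm.toAddEquiv.toAddMonoidHom), ?_⟩
    refine (Subtype.val_injective.comp ψ.symm.injective).comp ?_
    exact (Prod.mk_left_injective _).comp (LinearEquiv.injective _)
  refine le_trans ?_ hk
  norm_cast
  set T := DirectSum ι fun i => ZMod (p i ^ e i)
  have : Finite T := by
    have := fun i => Fact.mk (hp i)
    have : ∀ i, NeZero (p i ^ e i) := fun i => ⟨pow_ne_zero _ (hp i).ne_zero⟩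
    exact Finite.of_equiv _ (DirectSum.addEquivProd (fun i => ZMod (p i ^ e i))).symm.toEquiv
  have := Fintype.ofFinite T
  -- the norm bound
  obtain ⟨C, hC⟩ : ∃ C : ℕ, ∀ b : H', (b : H) ∈ B → ∀ j, ((ψ b).1 j).natAbs ≤ C := by
    have h1 : ((fun b : H' => (b : H)) ⁻¹' B).Finite := hBf.preimage Subtype.val_injective.injOn
    obtain ⟨C, hC⟩ := (h1.image fun b => ∑ j, ((ψ b).1 j).natAbs).bddAbove
    refine ⟨C, fun b hb j => le_trans ?_ (hC ⟨b, hb, rfl⟩)⟩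
    exact Finset.single_le_sum (f := fun j => ((ψ b).1 j).natAbs) (fun _ _ => Nat.zero_le _) (Finset.mem_univ j)
  have key : ∀ N : ℕ, ∀ x : Fin n → ℕ, ∑ i, x i = N →
      ∃ b : H', (b : H) = f (φ fun i => (x i : ℤ)) - f 0 ∧ ∀ j, ((ψ b).1 j).natAbs ≤ C * N := by
    intro N
    induction N with
    | zero =>
      intro x hx
      have : (fun i => (x i : ℤ)) = 0 := by
        ext i
        have := (Finset.sum_eq_zero_iff.1 hx) i (Finset.mem_univ i)
        simp [this]
      exact ⟨0, by simp [this], by simp⟩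
    | succ N ih =>
      intro x hx
      obtain ⟨i, -, hi⟩ : ∃ i ∈ Finset.univ, x i ≠ 0 := by
        apply Finset.exists_ne_zero_of_sum_ne_zero
        omega
      set x' : Fin n → ℕ := Function.update x i (x i - 1) with hx'
      have hxx : x = x' + Pi.single i 1 := by
        ext l
        by_cases hl : l = i
        · subst hl; simp [hx']; omega
        · simp [hx', hl]
      have hs : ∑ l, x' l = N := by
        have : ∑ l, x l = ∑ l, x' l + 1 := by
          conv_lhs => rw [hxx]
          simp [Finset.sum_add_distrib]
        omega
      obtain ⟨b, hb, hbb⟩ := ih x' hs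
      have e1 : (fun l => (x l : ℤ)) = (fun l => (x' l : ℤ)) + Pi.single i 1 := by
        ext l
        rw [hxx]
        by_cases hl : l = i
        · subst hl; simp
        · simp [hl]
      have hm := hBm i (φ fun l => (x' l : ℤ))
      refine ⟨⟨_, AddSubgroup.subset_closure hm⟩ + b, ?_, ?_⟩
      · rw [AddSubgroup.coe_add, hb, e1, map_add]; simp
      · intro j
        rw [map_add, Prod.fst_add, Finsupp.add_apply, mul_add, mul_one]
        refine (Int.natAbs_add_le _ _).trans ?_
        rw [add_comm]
        exact Nat.add_le_add (hbb j) (hC _ hm j)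
  choose b hb hbb using key
  apply cx_growth (C := C) (K := D.card * Fintype.card T)
  intro R
  set F : (Fin n → Fin (R+1)) → (Fin k → ℤ) × T := fun x =>
    (fun j => (ψ (b _ (fun i => (x i : ℕ)) rfl)).1 j, (ψ (b _ (fun i => (x i : ℕ)) rfl)).2) with hF
  set c := C * (n * R)
  have := Finset.card_le_mul_card_image_of_maps_to (s := Finset.univ) (f := F)
    (t := (Fintype.piFinset fun _ => Finset.Icc (-(c:ℤ)) c) ×ˢ Finset.univ) (n := D.card) ?_ ?_
  · rw [Finset.card_product, Fintype.card_piFinset] at this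
    simp only [Finset.card_univ, Fintype.card_pi, Fintype.card_fin, Finset.prod_const, Int.card_Icc] at this
    have e2 : ((c:ℤ) + 1 - -(c:ℤ)).toNat = 2 * c + 1 := by omega
    rw [e2] at this
    calc _ ≤ _ := this
      _ = _ := by ring
  · intro x _
    rw [Finset.mem_product]
    refine ⟨?_, Finset.mem_univ _⟩
    rw [Fintype.mem_piFinset]
    intro j
    have h1 := hbb _ (fun i => (x i : ℕ)) rfl j
    have h2 : ∑ i, (x i : ℕ) ≤ n * R := by
      have := Finset.sum_le_card_nsmul Finset.univ (fun i => (x i : ℕ)) R (fun i _ => by omega)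
      simpa using this
    have h3 := h1.trans (Nat.mul_le_mul_left C h2)
    rw [Finset.mem_Icc]
    simp only [hF]
    change _ ≤ c at h3
    omega
  · intro y _
    by_cases hne : ∃ x0, F x0 = y
    · obtain ⟨x0, rfl⟩ := hne
      have inj : ∀ x, F x = F x0 → f (φ fun i => ((x i : ℕ) : ℤ)) = f (φ fun i => ((x0 i : ℕ) : ℤ)) := by
        intro x hx
        have hx2 : ψ (b _ (fun i => (x i : ℕ)) rfl) = ψ (b _ (fun i => (x0 i : ℕ)) rfl) := by
          rw [hF] at hx
          have hx5 := congrArg Prod.snd hx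
          refine Prod.ext ?_ hx5
          ext j
          exact congrFun (congrArg Prod.fst hx) j
        have hx3 := congrArg Subtype.val (ψ.injective hx2)
        rw [hb, hb] at hx3
        exact sub_left_injective hx3
      refine Finset.card_le_card_of_injOn
        (fun x => g (f (φ fun i => ((x i : ℕ) : ℤ))) - φ fun i => ((x i : ℕ) : ℤ)) ?_ ?_
      · intro x _
        exact hDm _
      · intro x hx x' hx' hxx
        simp only [Finset.coe_filter, Finset.mem_univ, true_and, Set.mem_ofPred_eq] at hx hx'
        simp only [inj x hx, inj x' hx'] at hxx
        have := hφ (sub_right_injective hxx)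
        ext i
        have := congrFun this i
        exact_mod_cast this
    · rw [Finset.filter_eq_empty_iff.2]
      · simp
      · intro x _ hx
        exact hne ⟨x, hx⟩

theorem cx_born_iff {G H : Type} [AddCommGroup G] [AddCommGroup H] [MetricSpace G] [MetricSpace H]
    (hGinv : ∀ g x y : G, dist (g + x) (g + y) = dist x y)
    (hGprop : ∀ (x : G) (r : ℝ), {y : G | dist x y ≤ r}.Finite)
    (hHinv : ∀ g x y : H, dist (g + x) (g + y) = dist x y)
    (hHprop : ∀ (x : H) (r : ℝ), {y : H | dist x y ≤ r}.Finite) (f : G → H) :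
    Bornologous f ↔ CxFD f := by
  have dG : ∀ x y : G, dist x y = dist 0 (y - x) := fun x y => by
    rw [← hGinv x 0 (y - x)]; simp
  have dH : ∀ x y : H, dist x y = dist 0 (y - x) := fun x y => by
    rw [← hHinv x 0 (y - x)]; simp
  constructor
  · intro h s
    obtain ⟨ε, -, hε⟩ := h (dist 0 s) dist_nonneg
    refine (hHprop 0 ε).subset ?_
    rintro _ ⟨x, rfl⟩
    have := hε x (x + s) (by rw [dG]; simp)
    rwa [dH] at this
  · intro h δ _
    have hfin : (⋃ s ∈ {y : G | dist 0 y ≤ δ}, Set.range fun x => f (x + s) - f x).Finite :=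
      (hGprop 0 δ).biUnion fun s _ => h s
    obtain ⟨ε, hε⟩ := (hfin.image fun y => dist 0 y).bddAbove
    refine ⟨max ε 0, le_max_right _ _, fun x x' hx => le_trans ?_ (le_max_left _ _)⟩
    rw [dG] at hx
    rw [dH]
    refine hε ⟨_, Set.mem_biUnion hx ⟨x, rfl⟩, ?_⟩
    simp

theorem cx_close_iff {G : Type} [AddCommGroup G] [MetricSpace G]
    (hGinv : ∀ g x y : G, dist (g + x) (g + y) = dist x y)
    (hGprop : ∀ (x : G) (r : ℝ), {y : G | dist x y ≤ r}.Finite) (f : G → G) :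
    (∃ K : ℝ, 0 ≤ K ∧ ∀ x, dist (f x) x ≤ K) ↔ (Set.range fun x => f x - x).Finite := by
  have dG : ∀ x y : G, dist x y = dist 0 (y - x) := fun x y => by
    rw [← hGinv x 0 (y - x)]; simp
  constructor
  · rintro ⟨K, -, h⟩
    refine (hGprop 0 K).subset ?_
    rintro _ ⟨x, rfl⟩
    have := h x
    rwa [dist_comm, dG] at this
  · intro h
    obtain ⟨ε, hε⟩ := (h.image fun y => dist 0 y).bddAbove
    refine ⟨max ε 0, le_max_right _ _, fun x => le_trans ?_ (le_max_left _ _)⟩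
    rw [dist_comm, dG]
    exact hε ⟨_, ⟨x, rfl⟩, rfl⟩

theorem cx_coarse_iff {G H : Type} [AddCommGroup G] [AddCommGroup H] [MetricSpace G] [MetricSpace H]
    (hGinv : ∀ g x y : G, dist (g + x) (g + y) = dist x y)
    (hGprop : ∀ (x : G) (r : ℝ), {y : G | dist x y ≤ r}.Finite)
    (hHinv : ∀ g x y : H, dist (g + x) (g + y) = dist x y)
    (hHprop : ∀ (x : H) (r : ℝ), {y : H | dist x y ≤ r}.Finite) :
    CoarseEquiv G H ↔ CxAlg G H := by
  constructor
  · rintro ⟨f, g, K, hK, hf, hg, h1, h2⟩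
    exact ⟨f, g, (cx_born_iff hGinv hGprop hHinv hHprop f).1 hf,
      (cx_born_iff hHinv hHprop hGinv hGprop g).1 hg,
      (cx_close_iff hGinv hGprop fun x => g (f x)).1 ⟨K, hK, h1⟩,
      (cx_close_iff hHinv hHprop fun x => f (g x)).1 ⟨K, hK, h2⟩⟩
  · rintro ⟨f, g, hf, hg, h1, h2⟩
    obtain ⟨K1, hK1, h1⟩ := (cx_close_iff hGinv hGprop fun x => g (f x)).2 h1
    obtain ⟨K2, hK2, h2⟩ := (cx_close_iff hHinv hHprop fun x => f (g x)).2 h2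
    exact ⟨f, g, max K1 K2, le_max_of_le_left hK1,
      (cx_born_iff hGinv hGprop hHinv hHprop f).2 hf,
      (cx_born_iff hHinv hHprop hGinv hGprop g).2 hg,
      fun x => (h1 x).trans (le_max_left _ _), fun x => (h2 x).trans (le_max_right _ _)⟩

theorem cx_rank_eq (G : Type) [AddCommGroup G] :
    torsionFreeRank G = Cardinal.toENat (Module.rank ℤ G) := by
  have key : ∀ n : ℕ, (∃ f : (Fin n → ℤ) →+ G, Function.Injective f) ↔
      (n : ℕ∞) ≤ Cardinal.toENat (Module.rank ℤ G) := by
    intro n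
    rw [Cardinal.natCast_le_toENat, Module.le_rank_iff_exists_linearMap]
    constructor
    · rintro ⟨f, hf⟩
      exact ⟨f.toIntLinearMap, hf⟩
    · rintro ⟨f, hf⟩
      exact ⟨f.toAddMonoidHom, hf⟩
  apply le_antisymm
  · exact iSup₂_le fun n hn => (key n).1 hn
  · refine ENat.forall_natCast_le_iff_le.1 fun n hn => ?_
    exact le_iSup₂_of_le n ((key n).2 hn) le_rfl

theorem cx_alg_of_eq {G H : Type} [AddCommGroup G] [AddCommGroup H] [Countable G] [Countable H]
    (hr : torsionFreeRank G = torsionFreeRank H) (hfg : AddGroup.FG G ↔ AddGroup.FG H) :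
    CxAlg G H := by
  rw [cx_rank_eq, cx_rank_eq] at hr
  have hr' : Module.rank ℤ G = Module.rank ℤ H :=
    Cardinal.toENat_injOn ((rank_le_card ℤ G).trans Cardinal.mk_le_aleph0)
      ((rank_le_card ℤ H).trans Cardinal.mk_le_aleph0) hr
  obtain ⟨s, L, hs, ⟨α⟩, h1, h2, h3⟩ := cx_free G
  obtain ⟨s', L', hs', ⟨α'⟩, h1', h2', h3'⟩ := cx_free H
  obtain ⟨σ⟩ := Cardinal.eq.1 (hs.trans (hr'.trans hs'.symm))
  let θ : L ≃+ L' := (α.symm.trans (Finsupp.domCongr σ)).trans α'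
  by_cases hG : AddGroup.FG G
  · obtain ⟨S, hS, hc⟩ := h3 hG
    obtain ⟨S', hS', hc'⟩ := h3' (hfg.1 hG)
    exact cx_alg_of_finite θ hS hc hS' hc'
  · obtain ⟨M, τ, hT⟩ := cx_exists_tower L h1 (h2 hG)
    obtain ⟨M', τ', hTower⟩ := cx_exists_tower L' h1' (h2' fun h => hG (hfg.2 h))
    exact cx_alg_of_tower hT hTower θ

/-- Two countable abelian groups with proper left-invariant metrics are coarsely
equivalent iff their torsion-free ranks coincide and they are either both finitely
generated or both infinitely generated. -/
theorem coarse_equiv_iff_rank_eq_of_abelian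
    (G H : Type) [AddCommGroup G] [AddCommGroup H] [Countable G] [Countable H]
    [MetricSpace G] [MetricSpace H]
    (hGinv : ∀ g x y : G, dist (g + x) (g + y) = dist x y)
    (hGprop : ∀ (x : G) (r : ℝ), {y : G | dist x y ≤ r}.Finite)
    (hHinv : ∀ g x y : H, dist (g + x) (g + y) = dist x y)
    (hHprop : ∀ (x : H) (r : ℝ), {y : H | dist x y ≤ r}.Finite) :
    CoarseEquiv G H ↔
      (torsionFreeRank G = torsionFreeRank H ∧ (AddGroup.FG G ↔ AddGroup.FG H)) := by
  rw [cx_coarse_iff hGinv hGprop hHinv hHprop]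
  constructor
  · intro h
    exact ⟨le_antisymm (cx_rank_le h) (cx_rank_le (cx_alg_symm h)), cx_fg h, cx_fg (cx_alg_symm h)⟩
  · rintro ⟨hr, hfg⟩
    exact cx_alg_of_eq hr hfg
end

section
/- Two countable locally finite-by-abelian groups G and H, each endowed with a proper left-invariant metric, are coarsely equivalent if and only if asdim(G) = asdim(H) and the groups G, H are either both finitely generated or both infinitely generated. -/
/-- `asdim X ≤ n`: for every `D ≥ 0` there is a cover of `X` of finite mesh that splits
into `n+1` many `D`-discrete subfamilies. -/
def ASDimLE (X : Type*) [MetricSpace X] (n : ℕ) : Prop :=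
  ∀ D : ℝ, 0 ≤ D → ∃ U : Fin (n + 1) → Set (Set X),
    (∀ x : X, ∃ i : Fin (n + 1), ∃ u ∈ U i, x ∈ u) ∧
    (∃ m : ℝ, ∀ i : Fin (n + 1), ∀ u ∈ U i, EMetric.diam u ≤ ENNReal.ofReal m) ∧
    (∀ i : Fin (n + 1), ∀ u ∈ U i, ∀ v ∈ U i, u ≠ v → ∀ x ∈ u, ∀ y ∈ v, D ≤ dist x y)

/-- The asymptotic dimension of a metric space, the least `n` with `ASDimLE X n`,
and `∞` if there is no such `n`. -/
noncomputable def asdim (X : Type*) [MetricSpace X] : ℕ∞ :=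
  ⨅ n ∈ {n : ℕ | ASDimLE X n}, (n : ℕ∞)

/-- A group is finite-by-abelian: it has a finite normal subgroup with abelian quotient. -/
def FiniteByAbelian (G : Type*) [Group G] : Prop :=
  ∃ N : Subgroup G, N.Normal ∧ Finite N ∧ ∀ a b : G, a * b * a⁻¹ * b⁻¹ ∈ N

/-- A group is locally finite-by-abelian: every finitely generated subgroup is
finite-by-abelian. -/
def LocallyFiniteByAbelian (G : Type*) [Group G] : Prop :=
  ∀ K : Subgroup G, Group.FG K → FiniteByAbelian K


section M1

theorem ASDimLE.of_color {X : Type*} [MetricSpace X] {n : ℕ}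
    (h : ∀ D : ℝ, 0 ≤ D → ∃ (T : Type) (c : X → Fin (n + 1)) (u : X → T) (M : ℝ),
      (∀ x y, c x = c y → u x = u y → dist x y ≤ M) ∧
      (∀ x y, c x = c y → dist x y ≤ D → u x = u y)) : ASDimLE X n := by
  intro D hD
  obtain ⟨T, c, u, M, h1, h2⟩ := h D hD
  refine ⟨fun i => {s | ∃ t, s = {x | c x = i ∧ u x = t}}, ?_, ⟨M, ?_⟩, ?_⟩
  · intro x
    exact ⟨c x, _, ⟨u x, rfl⟩, rfl, rfl⟩
  · rintro i _ ⟨t, rfl⟩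
    apply Metric.ediam_le
    rintro x ⟨hx, hx'⟩ y ⟨hy, hy'⟩
    rw [edist_dist]
    exact ENNReal.ofReal_le_ofReal (h1 x y (hx.trans hy.symm) (hx'.trans hy'.symm))
  · rintro i _ ⟨t, rfl⟩ _ ⟨t', rfl⟩ hne x ⟨hx, hx'⟩ y ⟨hy, hy'⟩
    by_contra hlt
    push Not at hlt
    apply hne
    have := h2 x y (hx.trans hy.symm) hlt.le
    rw [← hx', ← hy', this]

theorem ASDimLE.color {X : Type*} [MetricSpace X] {n : ℕ} (h : ASDimLE X n) (D : ℝ) (hD : 0 ≤ D) :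
    ∃ (c : X → Fin (n + 1)) (u : X → Set X) (M : ℝ),
      (∀ x y, c x = c y → u x = u y → dist x y ≤ M) ∧
      (∀ x y, c x = c y → dist x y ≤ D → u x = u y) := by
  obtain ⟨U, hU, ⟨m, hm⟩, hD'⟩ := h (D + 1) (by linarith)
  choose c u hu hx using hU
  refine ⟨c, u, max m 0, ?_, ?_⟩
  · intro x y hc huxy
    have h1 := hm _ _ (hu x)
    have h2 : edist x y ≤ ENNReal.ofReal m :=
      (Metric.edist_le_ediam_of_mem (hx x) (huxy ▸ hx y)).trans h1
    rw [edist_dist] at h2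
    rcases le_total 0 m with h0 | h0
    · exact ((ENNReal.ofReal_le_ofReal_iff h0).1 h2).trans (le_max_left _ _)
    · rw [ENNReal.ofReal_of_nonpos h0] at h2
      have := ENNReal.ofReal_eq_zero.1 (le_antisymm h2 bot_le)
      exact this.trans (le_max_right _ _)
  · intro x y hc hd
    by_contra hne
    have := hD' (c x) _ (hu x) (u y) (hc ▸ hu y) hne x (hx x) y (hx y)
    linarith

theorem ASDimLE.of_coarse {X Y : Type*} [MetricSpace X] [MetricSpace Y] {n : ℕ}
    (h : CoarseEquiv X Y) (hY : ASDimLE Y n) : ASDimLE X n := by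
  obtain ⟨f, g, K, hK, hf, hg, hgf, -⟩ := h
  intro D hD
  obtain ⟨ε, hε, hfε⟩ := hf D hD
  obtain ⟨U, hU, ⟨m, hm⟩, hD'⟩ := hY (ε + 1) (by linarith)
  obtain ⟨ε', hε', hgε⟩ := hg (max m 0) (le_max_right _ _)
  refine ⟨fun i => (fun u => f ⁻¹' u) '' U i, ?_, ⟨ε' + 2 * K, ?_⟩, ?_⟩
  · intro x
    obtain ⟨i, u, hu, hx⟩ := hU (f x)
    exact ⟨i, _, ⟨u, hu, rfl⟩, hx⟩
  · rintro i _ ⟨u, hu, rfl⟩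
    apply Metric.ediam_le
    intro x hx y hy
    rw [edist_dist]
    apply ENNReal.ofReal_le_ofReal
    have h1 : edist (f x) (f y) ≤ ENNReal.ofReal (max m 0) :=
      ((Metric.edist_le_ediam_of_mem (s := u) (x := f x) (y := f y) hx hy).trans (hm i u hu)).trans
        (ENNReal.ofReal_le_ofReal (le_max_left _ _))
    rw [edist_dist, ENNReal.ofReal_le_ofReal_iff (le_max_right _ _)] at h1
    have h2 := hgε _ _ h1
    have h3 := hgf x
    have h4 := hgf y
    have h5 := dist_triangle x (g (f x)) y
    have h6 := dist_triangle (g (f x)) (g (f y)) y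
    rw [dist_comm x (g (f x))] at h5
    linarith
  · rintro i _ ⟨u, hu, rfl⟩ _ ⟨v, hv, rfl⟩ hne x hx y hy
    by_contra hlt
    push Not at hlt
    have h1 := hfε _ _ hlt.le
    have h2 := hD' i u hu v hv (fun h => hne (by rw [h])) _ hx _ hy
    linarith

theorem CoarseEquiv.symm' {X Y : Type*} [MetricSpace X] [MetricSpace Y]
    (h : CoarseEquiv X Y) : CoarseEquiv Y X := by
  obtain ⟨f, g, K, hK, hf, hg, hgf, hfg⟩ := h
  exact ⟨g, f, K, hK, hg, hf, hfg, hgf⟩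

theorem asdim_eq_of_coarse {X Y : Type*} [MetricSpace X] [MetricSpace Y]
    (h : CoarseEquiv X Y) : asdim X = asdim Y := by
  have : ∀ n, ASDimLE X n ↔ ASDimLE Y n := fun n =>
    ⟨fun hX => ASDimLE.of_coarse h.symm' hX, fun hY => ASDimLE.of_coarse h hY⟩
  unfold asdim
  simp only [this]

theorem fg_of_coarse {G H : Type} [Group G] [Group H] [MetricSpace G] [MetricSpace H]
    (hGinv : ∀ g x y : G, dist (g * x) (g * y) = dist x y)
    (hHinv : ∀ g x y : H, dist (g * x) (g * y) = dist x y)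
    (hHprop : ∀ (x : H) (r : ℝ), {y : H | dist x y ≤ r}.Finite)
    (h : CoarseEquiv G H) (hG : Group.FG G) : Group.FG H := by
  obtain ⟨f, g, K, hK, hf, hg, hgf, hfg⟩ := h
  obtain ⟨S, hS⟩ := (Group.fg_def.1 hG)
  obtain ⟨δ, hδ0, hδ⟩ : ∃ δ : ℝ, 0 ≤ δ ∧ ∀ s ∈ S, dist (1 : G) s ≤ δ := by
    refine ⟨∑ s ∈ S, dist (1 : G) s, Finset.sum_nonneg fun _ _ => dist_nonneg, fun s hs => ?_⟩
    exact Finset.single_le_sum (f := fun s => dist (1 : G) s) (fun _ _ => dist_nonneg) hs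
  obtain ⟨ε, hε, hfε⟩ := hf δ hδ0
  set B : Set H := {y | dist (1 : H) y ≤ max ε K} with hB
  set T : Subgroup H := Subgroup.closure B with hT
  have key : ∀ y z : H, dist y z ≤ max ε K → y⁻¹ * z ∈ T := by
    intro y z hyz
    apply Subgroup.subset_closure
    change dist 1 (y⁻¹ * z) ≤ _
    rw [← hHinv y]
    simpa using hyz
  have step : ∀ x : G, x ∈ Subgroup.closure (S : Set G) → (f 1)⁻¹ * f x ∈ T := by
    intro x hx
    induction hx using Subgroup.closure_induction_right with
    | one => simp
    | mul_right x hx y hy ih =>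
      have : (f x)⁻¹ * f (x * y) ∈ T := by
        apply key
        refine (hfε _ _ ?_).trans (le_max_left _ _)
        have := hGinv x 1 y
        rw [mul_one] at this
        rw [this]; exact hδ y hy
      have := T.mul_mem ih this
      simpa [mul_assoc] using this
    | mul_inv_cancel x hx y hy ih =>
      have : (f x)⁻¹ * f (x * y⁻¹) ∈ T := by
        apply key
        refine (hfε _ _ ?_).trans (le_max_left _ _)
        have := hGinv (x * y⁻¹) 1 y
        rw [mul_one, inv_mul_cancel_right] at this
        rw [dist_comm, this]; exact hδ y hy
      have := T.mul_mem ih this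
      simpa [mul_assoc] using this
  have all : ∀ y : H, (f 1)⁻¹ * y ∈ T := by
    intro y
    have h1 := step (g y) (by rw [hS]; trivial)
    have h2 := key (f (g y)) y ((hfg y).trans (le_max_right _ _))
    simpa [mul_assoc] using T.mul_mem h1 h2
  have hf1 : (f 1)⁻¹ ∈ T := by simpa using all 1
  rw [Group.fg_def, Subgroup.fg_iff]
  refine ⟨B, ?_, hHprop _ _⟩
  rw [eq_top_iff]
  intro y _
  have := T.mul_mem (T.inv_mem hf1) (all y)
  simpa using this

end M1

section M3

theorem kolm_aux (w L j t : ℤ) (r : ℕ) (hw : 0 < w) (hL : L = (r + 1) * w) (hj0 : 0 ≤ j) (hj : j ≤ r)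
    (h : (t - j * w) % L < w) : (t % L) / w = j := by
  have hLpos : 0 < L := by rw [hL]; positivity
  have h0 := Int.emod_nonneg (t - j * w) hLpos.ne'
  have h1 := Int.mul_ediv_add_emod (t - j * w) L
  set ρ := (t - j * w) % L
  set q := (t - j * w) / L
  have ht : t = (j * w + ρ) + L * q := by linarith
  have hlt : j * w + ρ < L := by rw [hL]; nlinarith
  have : t % L = j * w + ρ := by
    rw [ht, Int.add_mul_emod_self_left]
    exact Int.emod_eq_of_lt (by positivity) hlt
  rw [this, mul_comm, Int.add_comm, Int.add_mul_ediv_left _ _ hw.ne', Int.ediv_eq_zero_of_lt h0 h, zero_add]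

theorem kolm_aux2 (w L x y : ℤ) (hw : 0 < w) (hL : 0 < L) (hx : w ≤ x % L) (hy : w ≤ y % L)
    (h : |x - y| < w) : x / L = y / L := by
  have h1 := Int.mul_ediv_add_emod x L
  have h2 := Int.mul_ediv_add_emod y L
  have h3 := Int.emod_lt_of_pos x hL
  have h4 := Int.emod_lt_of_pos y hL
  have h5 := abs_lt.1 h
  rcases lt_trichotomy (x / L) (y / L) with h' | h' | h'
  · exfalso
    have : L * (x / L + 1) ≤ L * (y / L) := by gcongr; omega
    linarith
  · exact h'
  · exfalso
    have : L * (y / L + 1) ≤ L * (x / L) := by gcongr; omega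
    linarith

theorem kolm {ι : Type} [Fintype ι] (D : ℕ) :
    ∃ (c : (ι → ℤ) → Fin (Fintype.card ι + 1)) (u : (ι → ℤ) → (ι → ℤ)) (L : ℤ),
      (∀ x y, c x = c y → u x = u y → ∀ i, |x i - y i| ≤ L) ∧
      (∀ x y, c x = c y → (∀ i, |x i - y i| ≤ D) → u x = u y) := by
  classical
  set r := Fintype.card ι
  set w : ℤ := D + 1
  have hw : 0 < w := by positivity
  set L : ℤ := (r + 1) * w with hL
  have hLpos : 0 < L := by positivity
  have ex : ∀ x : ι → ℤ, ∃ j : Fin (r + 1), ∀ i, w ≤ (x i - j * w) % L := by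
    intro x
    by_contra hcon
    push Not at hcon
    choose b hb using hcon
    have hinj : Function.Injective b := by
      intro j k hjk
      have h1 := kolm_aux w L j (x (b j)) r hw hL (by positivity) (by have := j.2; omega) (hb j)
      have h2 := kolm_aux w L k (x (b k)) r hw hL (by positivity) (by have := k.2; omega) (hb k)
      rw [hjk, h2] at h1
      ext
      exact_mod_cast h1.symm
    have := Fintype.card_le_of_injective b hinj
    simp at this
    omega
  choose c hc using ex
  refine ⟨c, fun x i => (x i - c x * w) / L, L, ?_, ?_⟩
  · intro x y hcx hu i
    have h := congrFun hu i
    simp only [hcx] at h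
    have h1 := Int.mul_ediv_add_emod (x i - c y * w) L
    have h2 := Int.mul_ediv_add_emod (y i - c y * w) L
    have h3 := Int.emod_lt_of_pos (x i - c y * w) hLpos
    have h4 := Int.emod_lt_of_pos (y i - c y * w) hLpos
    have h5 := Int.emod_nonneg (x i - c y * w) hLpos.ne'
    have h6 := Int.emod_nonneg (y i - c y * w) hLpos.ne'
    rw [h] at h1
    rw [abs_le]; constructor <;> linarith
  · intro x y hcx hd
    funext i
    have h1 := hc x i
    have h2 := hc y i
    simp only [hcx] at h1 ⊢
    refine kolm_aux2 w L _ _ hw hLpos h1 h2 ?_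
    have := hd i
    rw [sub_sub_sub_cancel_right]
    omega

end M3

section M4

variable {ι : Type} [DecidableEq ι]

/-- Shift of the `j`-th coordinate by one. -/
def shp (x : ι → ℤ) (j : ι) : ι → ℤ := Function.update x j (x j + 1)

theorem shp_comm (x : ι → ℤ) (j k : ι) : shp (shp x j) k = shp (shp x k) j := by
  by_cases h : j = k
  · subst h; rfl
  · unfold shp
    rw [Function.update_of_ne h, Function.update_of_ne (Ne.symm h), Function.update_comm h]

/-- cubical cup product of coboundaries mod 2. -/
def om : List ((ι → ℤ) → ZMod 2) → Finset ι → (ι → ℤ) → ZMod 2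
  | [], _, _ => 1
  | f :: fs, T, x => ∑ j ∈ T, (f (shp x j) + f x) * om fs (T.erase j) (shp x j)

theorem zz (a : ZMod 2) : a + a = 0 := CharTwo.add_self_eq_zero a

theorem sum_symm_zero (T : Finset ι) (h : ι → ι → ZMod 2) (hs : ∀ j k, h j k = h k j) :
    ∑ j ∈ T, ∑ k ∈ T.erase j, h j k = 0 := by
  induction T using Finset.induction_on with
  | empty => simp
  | insert a T ha ih =>
    rw [Finset.sum_insert ha, Finset.erase_insert ha]
    have : ∑ j ∈ T, ∑ k ∈ (insert a T).erase j, h j k =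
        ∑ j ∈ T, (h j a + ∑ k ∈ T.erase j, h j k) := by
      apply Finset.sum_congr rfl
      intro j hj
      have hne : a ≠ j := fun h => ha (h ▸ hj)
      rw [Finset.erase_insert_of_ne hne, Finset.sum_insert (by simp [ha])]
    rw [this, Finset.sum_add_distrib, ih, add_zero]
    simp_rw [hs a]
    exact zz _

theorem sum_swap (T : Finset ι) (h : ι → ι → ZMod 2) :
    ∑ j ∈ T, ∑ k ∈ T.erase j, h j k = ∑ j ∈ T, ∑ k ∈ T.erase j, h k j := by
  have := sum_symm_zero T (fun j k => h j k + h k j) (fun j k => add_comm _ _)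
  simp only [Finset.sum_add_distrib] at this
  exact (CharTwo.add_eq_zero.1 this)

theorem om_closed (fs : List ((ι → ℤ) → ZMod 2)) : ∀ (T : Finset ι) (x : ι → ℤ),
    ∑ j ∈ T, (om fs (T.erase j) (shp x j) + om fs (T.erase j) x) = 0 := by
  induction fs with
  | nil => intro T x; simp [om, zz]
  | cons f fs ih =>
    intro T x
    simp only [om]
    have e1 : ∀ j k, (T.erase j).erase k = (T.erase k).erase j := fun j k => Finset.erase_right_comm
    set W : ι → ι → (ι → ℤ) → ZMod 2 := fun j k y => om fs ((T.erase j).erase k) y with hW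
    have hWs : ∀ j k, W j k = W k j := by intro j k; simp only [hW]; rw [e1]
    have expand : ∑ j ∈ T, (∑ k ∈ T.erase j, (f (shp (shp x j) k) + f (shp x j)) * W j k (shp (shp x j) k)
        + ∑ k ∈ T.erase j, (f (shp x k) + f x) * W j k (shp x k)) =
        ∑ j ∈ T, ∑ k ∈ T.erase j, f (shp (shp x j) k) * W j k (shp (shp x j) k)
        + ∑ j ∈ T, f (shp x j) * ∑ k ∈ T.erase j, (W j k (shp (shp x j) k))
        + (∑ j ∈ T, ∑ k ∈ T.erase j, f (shp x k) * W j k (shp x k)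
        + f x * ∑ j ∈ T, ∑ k ∈ T.erase j, W j k (shp x k)) := by
      simp only [Finset.mul_sum, Finset.sum_add_distrib, add_mul]
    refine expand.trans ?_
    rw [sum_symm_zero T (fun j k => f (shp (shp x j) k) * W j k (shp (shp x j) k))
      (fun j k => by rw [hWs j k, shp_comm]), zero_add]
    rw [sum_swap T (fun j k => f (shp x k) * W j k (shp x k))]
    rw [← add_assoc, ← Finset.sum_add_distrib]
    have h1 : ∑ j ∈ T, (f (shp x j) * ∑ k ∈ T.erase j, W j k (shp (shp x j) k) +
        ∑ k ∈ T.erase j, f (shp x j) * W k j (shp x j)) = 0 := by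
      apply Finset.sum_eq_zero
      intro j hj
      rw [← Finset.mul_sum, ← mul_add, ← Finset.sum_add_distrib]
      have := ih (T.erase j) (shp x j)
      simp_rw [hWs _ j]
      rw [this, mul_zero]
    rw [h1, zero_add]
    have h2 : ∑ j ∈ T, ∑ k ∈ T.erase j, W j k (shp x k) = 0 := by
      have h3 := sum_symm_zero T (fun j k => W j k x) (fun j k => by rw [hWs])
      have h4 : ∑ j ∈ T, ∑ k ∈ T.erase j, (W j k (shp x k) + W j k x) = 0 :=
        Finset.sum_eq_zero fun j _ => ih (T.erase j) x
      simp only [Finset.sum_add_distrib] at h4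
      rw [h3, add_zero] at h4
      exact h4
    rw [h2, mul_zero]

theorem om_zero (fs : List ((ι → ℤ) → ZMod 2)) (f : (ι → ℤ) → ZMod 2) (hf : f ∈ fs) (j : ι) (c : ZMod 2) :
    ∀ (T : Finset ι) (x : ι → ℤ), j ∉ T → (∀ y : ι → ℤ, y j = x j → f y = c) → om fs T x = 0 := by
  induction fs with
  | nil => simp at hf
  | cons g fs ih =>
    intro T x hj hc
    rw [om]
    apply Finset.sum_eq_zero
    intro k hk
    have hne : j ≠ k := fun h => hj (h ▸ hk)
    have hx : shp x k j = x j := by unfold shp; rw [Function.update_of_ne hne]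
    rcases List.mem_cons.1 hf with h | h
    · subst h
      rw [hc _ hx, hc x rfl, zz, zero_mul]
    · rw [ih h, mul_zero]
      · simp [hj]
      · intro y hy; exact hc y (hy.trans hx)

theorem om_ne (fs : List ((ι → ℤ) → ZMod 2)) :
    ∀ (T : Finset ι) (x : ι → ℤ), om fs T x ≠ 0 → ∀ f ∈ fs, ∃ p q : ι → ℤ, f p ≠ f q ∧
      ∀ i, x i ≤ p i ∧ p i ≤ x i + (if i ∈ T then 1 else 0) ∧
        x i ≤ q i ∧ q i ≤ x i + (if i ∈ T then 1 else 0) := by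
  induction fs with
  | nil => simp
  | cons g fs ih =>
    intro T x h f hf
    rw [om] at h
    obtain ⟨j, hj, hne⟩ := Finset.exists_ne_zero_of_sum_ne_zero h
    rcases List.mem_cons.1 hf with h' | h'
    · subst h'
      refine ⟨shp x j, x, ?_, ?_⟩
      · intro heq
        rw [heq, zz, zero_mul] at hne
        exact hne rfl
      · intro i
        unfold shp
        by_cases hij : i = j
        · subst hij; simp [hj]
        · rw [Function.update_of_ne hij]; split_ifs <;> simp
    · obtain ⟨p, q, hpq, hb⟩ := ih (T.erase j) (shp x j) (right_ne_zero_of_mul hne) f h'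
      refine ⟨p, q, hpq, fun i => ?_⟩
      have := hb i
      unfold shp at this
      by_cases hij : i = j
      · subst hij
        simp [hj] at this ⊢
        omega
      · rw [Function.update_of_ne hij] at this
        simpa [hij] using this

variable [Fintype ι]

/-- box in directions `T` through `x0`. -/
noncomputable def bx (m : ℕ) (T : Finset ι) (x0 : ι → ℤ) : Finset (ι → ℤ) :=
  Fintype.piFinset fun i => if i ∈ T then Finset.Ico (0 : ℤ) m else {x0 i}

theorem mem_bx {m : ℕ} {T : Finset ι} {x0 x : ι → ℤ} :
    x ∈ bx m T x0 ↔ ∀ i, if i ∈ T then 0 ≤ x i ∧ x i < m else x i = x0 i := by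
  unfold bx
  rw [Fintype.mem_piFinset]
  apply forall_congr'
  intro i
  split_ifs <;> simp

theorem bx_slice (m : ℕ) (T : Finset ι) (x0 : ι → ℤ) (j : ι) (hj : j ∈ T) (h : (ι → ℤ) → ZMod 2) :
    ∑ x ∈ bx m T x0, h x = ∑ t ∈ Finset.Ico (0 : ℤ) m, ∑ x ∈ bx m (T.erase j) (Function.update x0 j t), h x := by
  rw [← Finset.sum_fiberwise_of_maps_to (s := bx m T x0) (t := Finset.Ico (0 : ℤ) m) (g := fun x => x j)]
  · apply Finset.sum_congr rfl
    intro t ht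
    rw [Finset.mem_Ico] at ht
    apply Finset.sum_congr _ fun _ _ => rfl
    ext x
    rw [Finset.mem_filter, mem_bx, mem_bx]
    constructor
    · rintro ⟨h1, h2⟩ i
      have := h1 i
      by_cases hij : i = j
      · subst hij; simp [h2]
      · simpa [hij] using this
    · intro h1
      have hjj : x j = t := by have := h1 j; simpa using this
      refine ⟨fun i => ?_, hjj⟩
      by_cases hij : i = j
      · subst hij; simp [hj, hjj, ht]
      · simpa [hij] using h1 i
  · intro x hx
    have := mem_bx.1 hx j
    simp [hj] at this
    simpa using this

theorem tele (c : ℤ → ZMod 2) (m : ℕ) : ∑ t ∈ Finset.Ico (0 : ℤ) m, (c (t + 1) + c t) = c m + c 0 := by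
  induction m with
  | zero => simp [zz]
  | succ m ih =>
    have : Finset.Ico (0 : ℤ) ((m + 1 : ℕ) : ℤ) = insert (m : ℤ) (Finset.Ico (0 : ℤ) m) := by
      ext t; simp only [Finset.mem_Ico, Finset.mem_insert]; omega
    rw [this, Finset.sum_insert (by simp), ih]
    push_cast
    have := zz (c m)
    linear_combination this

theorem bx_tele (m : ℕ) (T : Finset ι) (x0 : ι → ℤ) (j : ι) (hj : j ∈ T) (h : (ι → ℤ) → ZMod 2) :
    ∑ x ∈ bx m T x0, (h (shp x j) + h x) =
      ∑ x ∈ bx m (T.erase j) (Function.update x0 j m), h x +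
      ∑ x ∈ bx m (T.erase j) (Function.update x0 j 0), h x := by
  rw [bx_slice m T x0 j hj, ← tele (fun t => ∑ x ∈ bx m (T.erase j) (Function.update x0 j t), h x)]
  apply Finset.sum_congr rfl
  intro t _
  rw [Finset.sum_add_distrib]
  congr 1
  apply Finset.sum_bij' (fun x _ => shp x j) (fun x _ => Function.update x j (x j - 1))
  · intro x hx
    rw [mem_bx] at hx ⊢
    intro i
    have := hx i
    by_cases hij : i = j
    · subst hij; simp [shp] at this ⊢; try exact this
    · simpa [hij, shp] using this
  · intro x hx
    rw [mem_bx] at hx ⊢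
    intro i
    have := hx i
    by_cases hij : i = j
    · subst hij; simp at this ⊢; omega
    · simpa [hij, shp] using this
  · intro x hx; simp [shp]
  · intro x hx; simp [shp]
  · intro x hx; rfl

theorem om_sum (m : ℕ) (f : ι → (ι → ℤ) → ZMod 2)
    (h0 : ∀ (i : ι) (x : ι → ℤ), x i = 0 → f i x = 0)
    (h1 : ∀ (i : ι) (x : ι → ℤ), x i = (m : ℤ) → f i x = 1) (l : List ι) (hl : l.Nodup) :
    ∀ x0 : ι → ℤ, ∑ x ∈ bx m l.toFinset x0, om (l.map f) l.toFinset x = 1 := by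
  induction l with
  | nil =>
    intro x0
    have : bx m (∅ : Finset ι) x0 = {x0} := by
      ext x; rw [mem_bx]; simp [funext_iff]
    simp [om, this]
  | cons i l ih =>
    intro x0
    rw [List.nodup_cons] at hl
    set T := (i :: l).toFinset with hT
    have hiT : i ∈ T := by simp [hT]
    have hTe : T.erase i = l.toFinset := by
      rw [hT, List.toFinset_cons, Finset.erase_insert (by simpa using hl.1)]
    have step : ∀ x, om ((i :: l).map f) T x = ∑ j ∈ T,
        (f i (shp x j) * om (l.map f) (T.erase j) (shp x j) + f i x * om (l.map f) (T.erase j) x) := by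
      intro x
      have hc := om_closed (l.map f) T x
      rw [List.map_cons, om]
      have : ∀ j ∈ T, (f i (shp x j) + f i x) * om (l.map f) (T.erase j) (shp x j) =
          (f i (shp x j) * om (l.map f) (T.erase j) (shp x j) + f i x * om (l.map f) (T.erase j) x) +
          f i x * (om (l.map f) (T.erase j) (shp x j) + om (l.map f) (T.erase j) x) := by
        intro j _
        linear_combination (-1 : ZMod 2) * zz (f i x * om (l.map f) (T.erase j) x)
      rw [Finset.sum_congr rfl this, Finset.sum_add_distrib, ← Finset.mul_sum, hc, mul_zero, add_zero]
    simp_rw [step]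
    rw [Finset.sum_comm]
    rw [← Finset.add_sum_erase _ _ hiT]
    have hrest : ∑ j ∈ T.erase i, ∑ x ∈ bx m T x0,
        (f i (shp x j) * om (l.map f) (T.erase j) (shp x j) + f i x * om (l.map f) (T.erase j) x) = 0 := by
      apply Finset.sum_eq_zero
      intro j hj
      have hjl : j ∈ l := by rw [hTe] at hj; simpa using hj
      rw [bx_tele m T x0 j (Finset.mem_of_mem_erase hj) (fun x => f i x * om (l.map f) (T.erase j) x)]
      rw [Finset.sum_eq_zero, Finset.sum_eq_zero, add_zero]
      · intro x hx
        have hxj : x j = 0 := by have := mem_bx.1 hx j; simpa using this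
        rw [om_zero (l.map f) (f j) (List.mem_map_of_mem hjl) j 0 _ _ (by simp)
          (fun y hy => h0 j y (hy.trans hxj)), mul_zero]
      · intro x hx
        have hxj : x j = m := by have := mem_bx.1 hx j; simpa using this
        rw [om_zero (l.map f) (f j) (List.mem_map_of_mem hjl) j 1 _ _ (by simp)
          (fun y hy => h1 j y (hy.trans hxj)), mul_zero]
    rw [hrest, add_zero, bx_tele m T x0 i hiT (fun x => f i x * om (l.map f) (T.erase i) x), hTe]
    rw [Finset.sum_eq_zero (s := bx m l.toFinset (Function.update x0 i 0)), add_zero]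
    · rw [← ih hl.2 (Function.update x0 i m)]
      apply Finset.sum_congr rfl
      intro x hx
      have hxj : x i = m := by have := mem_bx.1 hx i; simpa [hl.1] using this
      rw [h1 i x hxj, one_mul]
    · intro x hx
      have hxj : x i = 0 := by have := mem_bx.1 hx i; simpa [hl.1] using this
      rw [h0 i x hxj, zero_mul]

theorem poincare_miranda (m : ℕ) (f : ι → (ι → ℤ) → ZMod 2)
    (h0 : ∀ (i : ι) (x : ι → ℤ), x i = 0 → f i x = 0)
    (h1 : ∀ (i : ι) (x : ι → ℤ), x i = (m : ℤ) → f i x = 1) :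
    ∃ x : ι → ℤ, ∀ i, ∃ p q : ι → ℤ, f i p ≠ f i q ∧
      ∀ k, x k ≤ p k ∧ p k ≤ x k + 1 ∧ x k ≤ q k ∧ q k ≤ x k + 1 := by
  have h := om_sum m f h0 h1 (Finset.univ : Finset ι).toList (Finset.nodup_toList _) 0
  have hne : ∑ x ∈ bx m (Finset.univ : Finset ι).toList.toFinset 0,
    om ((Finset.univ : Finset ι).toList.map f) (Finset.univ : Finset ι).toList.toFinset x ≠ 0 := by
    rw [h]; decide
  obtain ⟨x, -, hx⟩ := Finset.exists_ne_zero_of_sum_ne_zero hne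
  refine ⟨x, fun i => ?_⟩
  obtain ⟨p, q, hpq, hb⟩ := om_ne _ _ _ hx (f i) (List.mem_map_of_mem (by simp))
  refine ⟨p, q, hpq, fun k => ?_⟩
  have := hb k
  simpa using this

end M4

theorem lebesgue {ι : Type} [Fintype ι] {T : Type*} (c : (ι → ℤ) → ι) (u : (ι → ℤ) → T) (L : ℕ)
    (hb : ∀ x y, c x = c y → u x = u y → ∀ i, |x i - y i| ≤ L)
    (hs : ∀ x y, c x = c y → (∀ i, |x i - y i| ≤ 2) → u x = u y) : False := by
  classical
  let P : ι → (ι → ℤ) → Prop := fun i x =>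
    (∃ y, c y = i ∧ (∀ k, |x k - y k| ≤ 1) ∧ ∃ z, c z = i ∧ u z = u y ∧ (L : ℤ) + 2 ≤ z i) ∨
    ((¬ ∃ y, c y = i ∧ (∀ k, |x k - y k| ≤ 1)) ∧ (L : ℤ) + 2 ≤ x i)
  obtain ⟨x, hx⟩ := poincare_miranda (2 * L + 4) (fun i x => if P i x then 1 else 0) (by
    intro i x hxi
    rw [if_neg]
    rintro (⟨y, hy, hxy, z, hz, huz, hzi⟩ | ⟨-, h⟩)
    · have h1 := abs_le.1 (hxy i)
      have h2 := abs_le.1 (hb z y (hz.trans hy.symm) huz i)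
      omega
    · omega) (by
    intro i x hxi
    rw [if_pos]
    by_cases h : ∃ y, c y = i ∧ (∀ k, |x k - y k| ≤ 1)
    · obtain ⟨y, hy, hxy⟩ := h
      refine Or.inl ⟨y, hy, hxy, y, hy, rfl, ?_⟩
      have h1 := abs_le.1 (hxy i)
      push_cast at hxi
      omega
    · refine Or.inr ⟨h, ?_⟩
      push_cast at hxi
      omega)
  obtain ⟨p, q, hne, hpq⟩ := hx (c x)
  have key : ∀ p : ι → ℤ, (∀ k, x k ≤ p k ∧ p k ≤ x k + 1) →
      (P (c x) p ↔ ∃ z, c z = c x ∧ u z = u x ∧ (L : ℤ) + 2 ≤ z (c x)) := by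
    intro p hp
    have hpx : ∀ k, |p k - x k| ≤ 1 := fun k => by
      rw [abs_le]; have := hp k; omega
    constructor
    · rintro (⟨y, hy, hxy, z, hz, huz, hzi⟩ | ⟨h, -⟩)
      · refine ⟨z, hz, huz.trans (hs y x hy fun i => ?_), hzi⟩
        have h1 := abs_le.1 (hxy i)
        have h2 := abs_le.1 (hpx i)
        rw [abs_le]; omega
      · exact absurd ⟨x, rfl, hpx⟩ h
    · rintro ⟨z, hz⟩
      exact Or.inl ⟨x, rfl, hpx, z, hz⟩
  apply hne
  have h1 := key p fun k => ⟨(hpq k).1, (hpq k).2.1⟩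
  have h2 := key q fun k => ⟨(hpq k).2.2.1, (hpq k).2.2.2⟩
  simp only [h1, h2]


section M2b

/-- balanced break points -/
def brk (N t k : ℕ) : ℕ := k * N / t

/-- index of the balanced piece containing `j` -/
def pc (N t j : ℕ) : ℕ := ((j + 1) * t - 1) / N

theorem brk_zero (N t : ℕ) : brk N t 0 = 0 := by simp [brk]

theorem brk_top (N t : ℕ) (ht : 0 < t) : brk N t t = N := by
  simp [brk, Nat.mul_div_cancel_left _ ht]

theorem brk_mono (N t : ℕ) {k k' : ℕ} (h : k ≤ k') : brk N t k ≤ brk N t k' :=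
  Nat.div_le_div_right (Nat.mul_le_mul_right _ h)

theorem brk_le_iff (N t k j : ℕ) (ht : 0 < t) (hN : 0 < N) : brk N t k ≤ j ↔ k ≤ pc N t j := by
  unfold brk pc
  rw [Nat.le_div_iff_mul_le hN, ← Nat.lt_succ_iff, Nat.div_lt_iff_lt_mul ht]
  have : 0 < (j + 1) * t := by positivity
  simp only [Nat.succ_eq_add_one]
  omega

theorem pc_spec (N t j : ℕ) (ht : 0 < t) (hN : 0 < N) :
    brk N t (pc N t j) ≤ j ∧ j < brk N t (pc N t j + 1) := by
  refine ⟨(brk_le_iff N t _ j ht hN).2 le_rfl, ?_⟩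
  by_contra h
  push Not at h
  have := (brk_le_iff N t _ j ht hN).1 h
  omega

theorem pc_unique (N t j k : ℕ) (ht : 0 < t) (hN : 0 < N) (h1 : brk N t k ≤ j)
    (h2 : j < brk N t (k + 1)) : pc N t j = k := by
  have h3 := (brk_le_iff N t _ j ht hN).1 h1
  have h4 := mt (brk_le_iff N t (k+1) j ht hN).2 (by omega)
  omega

theorem pc_lt (N t j : ℕ) (ht : 0 < t) (hN : 0 < N) (hj : j < N) : pc N t j < t := by
  by_contra h
  push Not at h
  have := (brk_le_iff N t t j ht hN).2 h
  rw [brk_top N t ht] at this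
  omega

/-- gap -/
def gp (N t k : ℕ) : ℕ := brk N t (k + 1) - brk N t k

theorem gp_mem (N t k b : ℕ) (ht : 0 < t) (h1 : t * b ≤ N) (h2 : N < t * (b + 1)) :
    gp N t k = b ∨ gp N t k = b + 1 := by
  have hd : N = t * b + (N - t * b) := by omega
  obtain ⟨c, hc⟩ : ∃ c, N = t * b + c := ⟨_, hd⟩
  have hct : c < t := by rw [hc, mul_add] at h2; omega
  have e : ∀ k, brk N t k = k * b + k * c / t := by
    intro k
    unfold brk
    rw [hc, mul_add, show k * (t * b) = t * (k * b) by ring, Nat.mul_add_div ht]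
  unfold gp
  rw [e, e]
  have h3 : k * c / t ≤ (k + 1) * c / t := Nat.div_le_div_right (Nat.mul_le_mul_right _ (by omega))
  have h4 : (k + 1) * c / t ≤ k * c / t + 1 := by
    rw [← Nat.add_div_right _ ht]
    apply Nat.div_le_div_right
    rw [add_mul]; omega
  have h5 : (k + 1) * b = k * b + b := by ring
  omega

theorem gp_zero (N t b : ℕ) (ht : 0 < t) (h1 : t * b ≤ N) (h2 : N < t * (b + 1)) :
    gp N t 0 = b := by
  unfold gp brk
  simp
  exact Nat.div_eq_of_lt_le (by linarith) (by linarith)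

/-- numeric data for the interleaving -/
structure NumDat where
  p : ℕ → ℕ
  r : ℕ → ℕ
  a : ℕ → ℕ
  i : ℕ → ℕ
  N : ℕ → ℕ
  M : ℕ → ℕ
  p0 : 2 * r 0 ≤ p 0
  r0 : 0 < r 0
  a0 : a 0 = 1
  apos : ∀ n, 0 < a n
  ipos : ∀ n, 0 < i n
  hp : ∀ n, p (n + 1) = N n * p n
  hr : ∀ n, r (n + 1) = M n * r n
  M1 : ∀ n, (i n + 1) * a n ≤ M n
  M2 : ∀ n, M n < i n * (a n + 1)
  N1 : ∀ n, (a (n + 1) + 1) * i n ≤ N n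
  N2 : ∀ n, N n < a (n + 1) * (i n + 1)

namespace NumDat
variable (Q : NumDat)

/-- `t` is an admissible type at level `n`. -/
def ok (n t : ℕ) : Prop := t = Q.a n ∨ t = Q.a n + 1

theorem ok.pos {Q : NumDat} {n t : ℕ} (h : Q.ok n t) : 0 < t := by
  have := Q.apos n
  rcases h with h | h <;> omega

theorem Npos (n : ℕ) : 0 < Q.N n := by
  have := Q.N1 n; have := Q.ipos n; have := Q.apos (n+1)
  have : 0 < (Q.a (n + 1) + 1) * Q.i n := by positivity
  omega

theorem Mpos (n : ℕ) : 0 < Q.M n := by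
  have := Q.M1 n; have := Q.ipos n; have := Q.apos n
  have : 0 < (Q.i n + 1) * Q.a n := by positivity
  omega

theorem ppos (n : ℕ) : 0 < Q.p n := by
  induction n with
  | zero => have := Q.p0; have := Q.r0; omega
  | succ n ih => rw [Q.hp]; exact Nat.mul_pos (Q.Npos n) ih

theorem rpos (n : ℕ) : 0 < Q.r n := by
  induction n with
  | zero => exact Q.r0
  | succ n ih => rw [Q.hr]; exact Nat.mul_pos (Q.Mpos n) ih

theorem pdvd {m n : ℕ} (h : m ≤ n) : Q.p m ∣ Q.p n := by
  induction n, h using Nat.le_induction with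
  | base => rfl
  | succ n _ ih => rw [Q.hp]; exact Dvd.dvd.mul_left ih _

theorem rdvd {m n : ℕ} (h : m ≤ n) : Q.r m ∣ Q.r n := by
  induction n, h using Nat.le_induction with
  | base => rfl
  | succ n _ ih => rw [Q.hr]; exact Dvd.dvd.mul_left ih _

/-- the piece of X-subblock index `j`: F-block index, offset, F gap count, start, type -/
def kk (n t j : ℕ) : ℕ := pc (Q.N n) t j
def ii (n t k : ℕ) : ℕ := gp (Q.N n) t k
def ss (n t j : ℕ) : ℕ := j - brk (Q.N n) t (Q.kk n t j)
def tt (n t j : ℕ) : ℕ := gp (Q.M n) (Q.ii n t (Q.kk n t j)) (Q.ss n t j)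
def bb (n t j : ℕ) : ℕ := brk (Q.M n) (Q.ii n t (Q.kk n t j)) (Q.ss n t j)

/-- the local maps -/
def fm : ℕ → ℕ → ℕ → ℕ
  | 0, t, x => min x (t * Q.r 0 - 1)
  | n + 1, t, x => Q.kk n t (x / Q.p n) * Q.r (n + 1) +
      (Q.bb n t (x / Q.p n) * Q.r n + fm n (Q.tt n t (x / Q.p n)) (x % Q.p n))

theorem N_bd {n t : ℕ} (h : Q.ok (n + 1) t) : t * Q.i n ≤ Q.N n ∧ Q.N n < t * (Q.i n + 1) := by
  have h1 := Q.N1 n; have h2 := Q.N2 n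
  rcases h with h | h <;> subst h <;> constructor <;> nlinarith

theorem M_bd {n i : ℕ} (h : i = Q.i n ∨ i = Q.i n + 1) : i * Q.a n ≤ Q.M n ∧ Q.M n < i * (Q.a n + 1) := by
  have h1 := Q.M1 n; have h2 := Q.M2 n
  rcases h with h | h <;> subst h <;> constructor <;> nlinarith

theorem ii_mem {n t : ℕ} (h : Q.ok (n + 1) t) (k : ℕ) : Q.ii n t k = Q.i n ∨ Q.ii n t k = Q.i n + 1 :=
  gp_mem _ _ _ _ h.pos (Q.N_bd h).1 (Q.N_bd h).2

theorem ii_pos {n t : ℕ} (h : Q.ok (n + 1) t) (k : ℕ) : 0 < Q.ii n t k := by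
  have := Q.ipos n
  rcases Q.ii_mem h k with h | h <;> omega

theorem ok_tt {n t : ℕ} (h : Q.ok (n + 1) t) (j : ℕ) : Q.ok n (Q.tt n t j) :=
  gp_mem _ _ _ _ (Q.ii_pos h _) (Q.M_bd (Q.ii_mem h _)).1 (Q.M_bd (Q.ii_mem h _)).2

theorem kk_lt {n t j : ℕ} (h : Q.ok (n + 1) t) (hj : j < Q.N n) : Q.kk n t j < t :=
  pc_lt _ _ _ h.pos (Q.Npos n) hj

theorem ss_lt {n t j : ℕ} (h : Q.ok (n + 1) t) : Q.ss n t j < Q.ii n t (Q.kk n t j) := by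
  have := pc_spec (Q.N n) t j h.pos (Q.Npos n)
  unfold ss ii gp kk
  omega

theorem bb_tt {n t j : ℕ} (h : Q.ok (n + 1) t) : Q.bb n t j + Q.tt n t j ≤ Q.M n := by
  have h1 : Q.bb n t j + Q.tt n t j = brk (Q.M n) (Q.ii n t (Q.kk n t j)) (Q.ss n t j + 1) := by
    unfold bb tt gp
    have := brk_mono (Q.M n) (Q.ii n t (Q.kk n t j)) (Nat.le_succ (Q.ss n t j))
    simp only [Nat.succ_eq_add_one] at this
    omega
  rw [h1]
  calc _ ≤ _ := brk_mono _ _ (Q.ss_lt h : Q.ss n t j + 1 ≤ _)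
    _ = _ := brk_top _ _ (Q.ii_pos h _)

theorem div_lt {n x : ℕ} (hx : x < Q.p (n + 1)) : x / Q.p n < Q.N n := by
  rw [Nat.div_lt_iff_lt_mul (Q.ppos n), ← Q.hp]; exact hx

theorem fm_lt : ∀ (n t x : ℕ), Q.ok n t → x < Q.p n → Q.fm n t x < t * Q.r n := by
  intro n
  induction n with
  | zero =>
    intro t x h hx
    have := Q.r0
    have : 0 < t * Q.r 0 := Nat.mul_pos h.pos this
    simp only [fm]; omega
  | succ n ih =>
    intro t x h hx
    have h1 := ih _ (x % Q.p n) (Q.ok_tt h (x / Q.p n)) (Nat.mod_lt _ (Q.ppos n))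
    have h2 := Q.kk_lt h (Q.div_lt hx)
    have h3 := Q.bb_tt (j := x / Q.p n) h
    rw [fm]
    have h4 : Q.bb n t (x / Q.p n) * Q.r n + Q.fm n (Q.tt n t (x / Q.p n)) (x % Q.p n) < Q.r (n + 1) := by
      rw [Q.hr]; nlinarith
    nlinarith

theorem fm_inner {n t x : ℕ} (h : Q.ok (n + 1) t) :
    Q.bb n t (x / Q.p n) * Q.r n + Q.fm n (Q.tt n t (x / Q.p n)) (x % Q.p n) < Q.r (n + 1) := by
  have h1 := Q.fm_lt _ _ (x % Q.p n) (Q.ok_tt h (x / Q.p n)) (Nat.mod_lt _ (Q.ppos n))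
  have h3 := Q.bb_tt (j := x / Q.p n) h
  rw [Q.hr]; nlinarith

theorem fm_div_r {n t x : ℕ} (h : Q.ok (n + 1) t) : Q.fm (n + 1) t x / Q.r (n + 1) = Q.kk n t (x / Q.p n) := by
  rw [fm, mul_comm, Nat.mul_add_div (Q.rpos _), Nat.div_eq_of_lt (Q.fm_inner h), add_zero]

theorem fm_mod_r {n t x : ℕ} (h : Q.ok (n + 1) t) : Q.fm (n + 1) t x % Q.r (n + 1) =
    Q.bb n t (x / Q.p n) * Q.r n + Q.fm n (Q.tt n t (x / Q.p n)) (x % Q.p n) := by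
  rw [fm, mul_comm, Nat.mul_add_mod, Nat.mod_eq_of_lt (Q.fm_inner h)]

theorem div_mod_of_dvd {p q x : ℕ} (h : p ∣ q) (hp : 0 < p) : x / p = (x / q) * (q / p) + x % q / p := by
  obtain ⟨c, rfl⟩ := h
  rw [Nat.mul_div_cancel_left _ hp]
  conv_lhs => rw [← Nat.div_add_mod x (p * c)]
  rw [mul_assoc, Nat.mul_add_div hp]
  ring

theorem div_eq_of_dvd {p q x y : ℕ} (h : p ∣ q) (hxy : x / p = y / p) : x / q = y / q := by
  obtain ⟨c, rfl⟩ := h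
  rw [← Nat.div_div_eq_div_mul, ← Nat.div_div_eq_div_mul, hxy]

theorem div_eq_iff_of_dvd {p q x y : ℕ} (h : p ∣ q) (hp : 0 < p) :
    x / p = y / p ↔ x / q = y / q ∧ x % q / p = y % q / p := by
  constructor
  · intro hxy
    have h1 := div_eq_of_dvd h hxy
    refine ⟨h1, ?_⟩
    rw [div_mod_of_dvd h hp, div_mod_of_dvd (x := y) h hp, h1] at hxy
    omega
  · rintro ⟨h1, h2⟩
    rw [div_mod_of_dvd h hp, div_mod_of_dvd (x := y) h hp, h1, h2]

theorem fm_fwd : ∀ (n t x x' m : ℕ), Q.ok n t → m < n → x / Q.p m = x' / Q.p m →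
    Q.fm n t x / Q.r (m + 1) = Q.fm n t x' / Q.r (m + 1) := by
  intro n
  induction n with
  | zero => intro t x x' m h hm; omega
  | succ n ih =>
    intro t x x' m h hm hxx
    obtain ⟨h1, h2⟩ := (div_eq_iff_of_dvd (Q.pdvd (show m ≤ n by omega)) (Q.ppos m)).1 hxx
    rw [div_eq_iff_of_dvd (Q.rdvd (show m + 1 ≤ n + 1 by omega)) (Q.rpos _), Q.fm_div_r h, Q.fm_div_r h,
      Q.fm_mod_r h, Q.fm_mod_r h, h1]
    refine ⟨rfl, ?_⟩
    rcases Nat.lt_or_ge m n with hmn | hmn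
    · have := ih _ _ _ m (Q.ok_tt h (x' / Q.p n)) hmn h2
      obtain ⟨c, hc⟩ := Q.rdvd (show m + 1 ≤ n by omega)
      rw [hc, mul_left_comm, Nat.mul_add_div (Q.rpos _), Nat.mul_add_div (Q.rpos _), this]
    · have : m = n := by omega
      subst this
      have h3 := Q.fm_inner (x := x) h
      have h4 := Q.fm_inner (x := x') h
      rw [h1] at h3
      rw [Nat.div_eq_of_lt h3, Nat.div_eq_of_lt h4]

theorem fm_bwd : ∀ (n t x x' m : ℕ), Q.ok n t → m ≤ n → x < Q.p n → x' < Q.p n →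
    Q.fm n t x / Q.r m = Q.fm n t x' / Q.r m → x / Q.p m = x' / Q.p m := by
  intro n
  induction n with
  | zero =>
    intro t x x' m h hm hx hx' _
    have : m = 0 := by omega
    subst this
    rw [Nat.div_eq_of_lt hx, Nat.div_eq_of_lt hx']
  | succ n ih =>
    intro t x x' m h hm hx hx' hff
    rcases Nat.lt_or_ge n m with hmn | hmn
    · have : m = n + 1 := by omega
      subst this
      rw [Nat.div_eq_of_lt hx, Nat.div_eq_of_lt hx']
    obtain ⟨h1, h2⟩ := (div_eq_iff_of_dvd (Q.rdvd hm) (Q.rpos _)).1 hff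
    rw [Q.fm_div_r h, Q.fm_div_r h] at h1
    rw [Q.fm_mod_r h, Q.fm_mod_r h] at h2
    set j := x / Q.p n with hj
    set j' := x' / Q.p n with hj'
    have b1 := Q.fm_lt _ _ (x % Q.p n) (Q.ok_tt h j) (Nat.mod_lt _ (Q.ppos n))
    have b2 := Q.fm_lt _ _ (x' % Q.p n) (Q.ok_tt h j') (Nat.mod_lt _ (Q.ppos n))
    -- same n-block index
    have h3 := div_eq_of_dvd (Q.rdvd hmn) h2
    rw [mul_comm, Nat.mul_add_div (Q.rpos _), mul_comm, Nat.mul_add_div (Q.rpos _)] at h3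
    have c1 := (Nat.div_lt_iff_lt_mul (Q.rpos n)).2 b1
    have c2 := (Nat.div_lt_iff_lt_mul (Q.rpos n)).2 b2
    have hs : Q.ss n t j = Q.ss n t j' := by
      have hi := Q.ii_pos h (Q.kk n t j)
      have e : ∀ j, Q.bb n t j + Q.tt n t j = brk (Q.M n) (Q.ii n t (Q.kk n t j)) (Q.ss n t j + 1) := by
        intro j
        unfold bb tt gp
        have := brk_mono (Q.M n) (Q.ii n t (Q.kk n t j)) (Nat.le_succ (Q.ss n t j))
        simp only [Nat.succ_eq_add_one] at this
        omega
      have e1 := e j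
      have e2 := e j'
      rw [← pc_unique (Q.M n) (Q.ii n t (Q.kk n t j)) _ (Q.ss n t j) hi (Q.Mpos n)
        (Nat.le_add_right (Q.bb n t j) _) (by rw [← e1]; exact Nat.add_lt_add_left c1 _)]
      rw [h3]
      apply pc_unique _ _ _ _ hi (Q.Mpos n)
      · rw [h1]; exact Nat.le_add_right (Q.bb n t j') _
      · rw [h1, ← e2]; exact Nat.add_lt_add_left c2 _
    have hjj : j = j' := by
      have s1 := pc_spec (Q.N n) t j h.pos (Q.Npos n)
      have s2 := pc_spec (Q.N n) t j' h.pos (Q.Npos n)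
      unfold ss at hs
      unfold kk at hs h1
      rw [h1] at hs s1
      omega
    rw [div_eq_iff_of_dvd (Q.pdvd hmn) (Q.ppos _)]
    refine ⟨hjj, ?_⟩
    rw [hjj] at h2 b1
    apply ih _ _ _ m (Q.ok_tt h j') hmn (Nat.mod_lt _ (Q.ppos n)) (Nat.mod_lt _ (Q.ppos n))
    obtain ⟨c, hc⟩ := Q.rdvd hmn
    have h5 : Q.bb n t j' * Q.r n = Q.r m * (Q.bb n t j' * c) := by rw [hc]; ring
    rw [h5, Nat.mul_add_div (Q.rpos _), Nat.mul_add_div (Q.rpos _)] at h2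
    omega

theorem fm_surj : ∀ (n t y : ℕ), Q.ok n t → y < t * Q.r n → ∃ x < Q.p n, Q.fm n t x = y := by
  intro n
  induction n with
  | zero =>
    intro t y h hy
    refine ⟨y, ?_, ?_⟩
    · have h2 := Q.p0
      have : t ≤ 2 := by
        have := Q.a0
        rcases h with h | h <;> omega
      nlinarith
    · simp only [fm]; omega
  | succ n ih =>
    intro t y h hy
    set k := y / Q.r (n + 1) with hk
    set w := y % Q.r (n + 1) with hw
    have hkt : k < t := by rw [hk, Nat.div_lt_iff_lt_mul (Q.rpos _)]; exact hy
    have hwr : w < Q.M n * Q.r n := by rw [← Q.hr]; exact Nat.mod_lt _ (Q.rpos _)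
    set q := w / Q.r n with hq
    have hqM : q < Q.M n := by rw [hq, Nat.div_lt_iff_lt_mul (Q.rpos _)]; exact hwr
    set i := Q.ii n t k with hi
    have hipos : 0 < i := Q.ii_pos h k
    set s := pc (Q.M n) i q with hs
    have hsi : s < i := pc_lt _ _ _ hipos (Q.Mpos n) hqM
    have hsp := pc_spec (Q.M n) i q hipos (Q.Mpos n)
    rw [← hs] at hsp
    set j := brk (Q.N n) t k + s with hj
    have hjlt : j < brk (Q.N n) t (k + 1) := by
      have h1 : i = brk (Q.N n) t (k + 1) - brk (Q.N n) t k := rfl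
      omega
    have hjk : Q.kk n t j = k := pc_unique _ _ _ _ h.pos (Q.Npos n) (by omega) hjlt
    have hjs : Q.ss n t j = s := by unfold ss; rw [hjk]; omega
    have hjN : j < Q.N n := by
      have := brk_mono (Q.N n) t (show k + 1 ≤ t by omega)
      rw [brk_top _ _ h.pos] at this
      omega
    have hbb : Q.bb n t j = brk (Q.M n) i s := by unfold bb; rw [hjk, hjs]
    have htt : Q.tt n t j = brk (Q.M n) i (s + 1) - brk (Q.M n) i s := by unfold tt; rw [hjk, hjs]; rfl
    have hwq : w = q * Q.r n + w % Q.r n := by rw [hq, mul_comm]; exact (Nat.div_add_mod _ _).symm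
    have hmod : w % Q.r n < Q.r n := Nat.mod_lt _ (Q.rpos n)
    obtain ⟨x0, hx0, hfx⟩ := ih (Q.tt n t j) (w - Q.bb n t j * Q.r n) (Q.ok_tt h j) (by
      rw [htt, hbb]
      have h1 : w < brk (Q.M n) i (s + 1) * Q.r n := by
        have : (q + 1) * Q.r n ≤ brk (Q.M n) i (s + 1) * Q.r n := Nat.mul_le_mul_right _ hsp.2
        rw [add_mul] at this
        omega
      rw [Nat.sub_mul]
      have h2 : brk (Q.M n) i s * Q.r n ≤ q * Q.r n := Nat.mul_le_mul_right _ hsp.1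
      omega)
    have hxd : (j * Q.p n + x0) / Q.p n = j := by
      rw [mul_comm, Nat.mul_add_div (Q.ppos n), Nat.div_eq_of_lt hx0, add_zero]
    have hxm : (j * Q.p n + x0) % Q.p n = x0 := by
      rw [mul_comm, Nat.mul_add_mod, Nat.mod_eq_of_lt hx0]
    refine ⟨j * Q.p n + x0, ?_, ?_⟩
    · rw [Q.hp]; nlinarith
    · rw [fm, hxd, hxm, hfx, hjk]
      have h2 : brk (Q.M n) i s * Q.r n ≤ q * Q.r n := Nat.mul_le_mul_right _ hsp.1
      have h3 : y = k * Q.r (n + 1) + w := by rw [hk, hw, mul_comm]; exact (Nat.div_add_mod _ _).symm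
      rw [hbb]; omega

theorem fm_ext_succ (n x : ℕ) (hx : x < Q.p n) :
    Q.fm (n + 1) (Q.a (n + 1)) x = Q.fm n (Q.a n) x := by
  have hok : Q.ok (n + 1) (Q.a (n + 1)) := Or.inl rfl
  have hb := Q.N_bd hok
  have e0 : x / Q.p n = 0 := Nat.div_eq_of_lt hx
  have hg : gp (Q.N n) (Q.a (n + 1)) 0 = Q.i n := gp_zero _ _ _ hok.pos hb.1 hb.2
  have hk : Q.kk n (Q.a (n + 1)) 0 = 0 := by
    apply pc_unique _ _ _ _ hok.pos (Q.Npos n)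
    · rw [brk_zero]
    · have := Q.ipos n
      unfold gp at hg
      rw [brk_zero] at hg
      omega
  have hi : Q.ii n (Q.a (n + 1)) 0 = Q.i n := hg
  have hs : Q.ss n (Q.a (n + 1)) 0 = 0 := by simp [ss]
  have hM := Q.M_bd (n := n) (Or.inl rfl)
  have htt : Q.tt n (Q.a (n + 1)) 0 = Q.a n := by
    unfold tt; rw [hk, hs, hi]
    exact gp_zero _ _ _ (Q.ipos n) hM.1 hM.2
  rw [fm, e0, hk, htt, bb, hs, brk_zero, Nat.mod_eq_of_lt hx]
  simp

theorem ple {m n : ℕ} (h : m ≤ n) : Q.p m ≤ Q.p n := Nat.le_of_dvd (Q.ppos n) (Q.pdvd h)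

theorem fm_ext {m n x : ℕ} (h : m ≤ n) (hx : x < Q.p m) :
    Q.fm n (Q.a n) x = Q.fm m (Q.a m) x := by
  induction n, h using Nat.le_induction with
  | base => rfl
  | succ n hmn ih => rw [Q.fm_ext_succ n x (lt_of_lt_of_le hx (Q.ple hmn)), ih]

theorem exists_map (hup : ∀ x, ∃ n, x < Q.p n) (hur : ∀ x, ∃ n, x < Q.r n) :
    ∃ f g : ℕ → ℕ, (∀ y, f (g y) = y) ∧
      (∀ n x x', x / Q.p n = x' / Q.p n → f x / Q.r (n + 1) = f x' / Q.r (n + 1)) ∧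
      (∀ n x x', f x / Q.r n = f x' / Q.r n → x / Q.p n = x' / Q.p n) := by
  choose L hL using hup
  have hc : ∀ x n, L x ≤ n → Q.fm (L x) (Q.a (L x)) x = Q.fm n (Q.a n) x :=
    fun x n h => (Q.fm_ext h (hL x)).symm
  have hlt : ∀ x n, L x ≤ n → x < Q.p n := fun x n h => lt_of_lt_of_le (hL x) (Q.ple h)
  have hs : Function.Surjective (fun x => Q.fm (L x) (Q.a (L x)) x) := by
    intro y
    obtain ⟨n, hn⟩ := hur y
    obtain ⟨x, hx, hxy⟩ := Q.fm_surj n (Q.a n) y (Or.inl rfl) (by have := Q.apos n; nlinarith)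
    refine ⟨x, ?_⟩
    show Q.fm (L x) (Q.a (L x)) x = y
    rw [hc x (max (L x) n) (le_max_left _ _), Q.fm_ext (le_max_right _ _) hx, hxy]
  obtain ⟨g, hg⟩ := hs.hasRightInverse
  refine ⟨fun x => Q.fm (L x) (Q.a (L x)) x, g, hg, ?_, ?_⟩
  · intro n x x' h
    set m := max (max (L x) (L x')) (n + 1)
    show Q.fm (L x) (Q.a (L x)) x / _ = Q.fm (L x') (Q.a (L x')) x' / _
    rw [hc x m (by omega), hc x' m (by omega)]
    exact Q.fm_fwd m _ x x' n (Or.inl rfl) (by omega) h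
  · intro n x x' h
    set m := max (max (L x) (L x')) (n + 1)
    change Q.fm (L x) (Q.a (L x)) x / _ = Q.fm (L x') (Q.a (L x')) x' / _ at h
    rw [hc x m (by omega), hc x' m (by omega)] at h
    exact Q.fm_bwd m _ x x' n (Or.inl rfl) (by omega) (hlt _ _ (by omega)) (hlt _ _ (by omega)) h

theorem p_unb (x : ℕ) : ∃ n, x < Q.p n := by
  refine ⟨x, ?_⟩
  induction x with
  | zero => exact Q.ppos 0
  | succ n ih =>
    rw [Q.hp]
    have h1 := Q.N1 n
    have h2 := Q.apos (n + 1)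
    have h3 := Q.ipos n
    have : 2 ≤ Q.N n := by nlinarith
    nlinarith

theorem r_unb (x : ℕ) : ∃ n, x < Q.r n := by
  refine ⟨x, ?_⟩
  induction x with
  | zero => exact Q.rpos 0
  | succ n ih =>
    rw [Q.hr]
    have h1 := Q.M1 n
    have h2 := Q.apos n
    have h3 := Q.ipos n
    have : 2 ≤ Q.M n := by nlinarith
    nlinarith

end NumDat

theorem sel_aux (a M : ℕ) (ha : 0 < a) (hM : 2 * a * (a + 1) ≤ M) :
    ∃ i, 0 < i ∧ (i + 1) * a ≤ M ∧ M < i * (a + 1) := by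
  refine ⟨M / (a + 1) + 1, Nat.succ_pos _, ?_, ?_⟩
  · have h1 := Nat.div_mul_le_self M (a + 1)
    have h2 : 2 * a ≤ M / (a + 1) := by rw [Nat.le_div_iff_mul_le (by omega)]; exact hM
    nlinarith
  · have := Nat.lt_div_mul_add (a := M) (b := a + 1) (by omega)
    linarith

theorem dvd_seq {p : ℕ → ℕ} (hd : ∀ n, p n ∣ p (n + 1)) {m n : ℕ} (h : m ≤ n) : p m ∣ p n := by
  induction n, h using Nat.le_induction with
  | base => rfl
  | succ n _ ih => exact ih.trans (hd n)

theorem sel_large {p : ℕ → ℕ} (hp : ∀ n, 0 < p n) (hd : ∀ n, p n ∣ p (n + 1))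
    (hu : ∀ K, ∃ n, K < p n) (P K : ℕ) : ∃ P' N, P < P' ∧ p P' = N * p P ∧ K ≤ N := by
  obtain ⟨n, hn⟩ := hu (K * p P)
  obtain ⟨N, hN⟩ := dvd_seq hd (show P ≤ max n (P + 1) by omega)
  refine ⟨max n (P + 1), N, by omega, by rw [hN, mul_comm], ?_⟩
  have h2 := Nat.le_of_dvd (hp _) (dvd_seq hd (show n ≤ max n (P + 1) by omega))
  by_contra h
  push Not at h
  rw [hN] at h2
  have := hp P
  nlinarith

theorem nat_tree (p r : ℕ → ℕ) (hp : ∀ n, 0 < p n) (hr : ∀ n, 0 < r n)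
    (hdp : ∀ n, p n ∣ p (n + 1)) (hdr : ∀ n, r n ∣ r (n + 1))
    (hup : ∀ K, ∃ n, K < p n) (hur : ∀ K, ∃ n, K < r n) :
    ∃ f g : ℕ → ℕ, (∀ y, f (g y) = y) ∧ (∃ m, ∀ x, g (f x) / p m = x / p m) ∧
      (∀ n, ∃ m, ∀ x x', x / p n = x' / p n → f x / r m = f x' / r m) ∧
      (∀ n, ∃ m, ∀ y y', y / r n = y' / r n → g y / p m = g y' / p m) := by
  have step : ∀ s : ℕ × ℕ × {a : ℕ // 0 < a}, ∃ (s' : ℕ × ℕ × {a : ℕ // 0 < a}) (i N M : ℕ),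
      s.1 < s'.1 ∧ s.2.1 < s'.2.1 ∧ p s'.1 = N * p s.1 ∧ r s'.2.1 = M * r s.2.1 ∧ 0 < i ∧
      (i + 1) * s.2.2.1 ≤ M ∧ M < i * (s.2.2.1 + 1) ∧
      (s'.2.2.1 + 1) * i ≤ N ∧ N < s'.2.2.1 * (i + 1) := by
    rintro ⟨P, R, a, ha⟩
    obtain ⟨R', M, hR, hRM, hM⟩ := sel_large hr hdr hur R (2 * a * (a + 1))
    obtain ⟨i, hi, hi1, hi2⟩ := sel_aux a M ha hM
    obtain ⟨P', N, hP, hPN, hN⟩ := sel_large hp hdp hup P (2 * i * (i + 1))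
    obtain ⟨a', ha', ha1, ha2⟩ := sel_aux i N hi hN
    exact ⟨⟨P', R', a', ha'⟩, i, N, M, hP, hR, hPN, hRM, hi, hi1, hi2, ha1, ha2⟩
  choose nx ni nN nM h using step
  obtain ⟨P0, hP0⟩ := hup (2 * r 0)
  let st : ℕ → ℕ × ℕ × {a : ℕ // 0 < a} := fun n => nx^[n] (P0, 0, ⟨1, one_pos⟩)
  have hst : ∀ n, st (n + 1) = nx (st n) := fun n => Function.iterate_succ_apply' _ _ _
  let Q : NumDat :=
    { p := fun n => p (st n).1
      r := fun n => r (st n).2.1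
      a := fun n => (st n).2.2.1
      i := fun n => ni (st n)
      N := fun n => nN (st n)
      M := fun n => nM (st n)
      p0 := hP0.le
      r0 := hr _
      a0 := rfl
      apos := fun n => (st n).2.2.2
      ipos := fun n => (h (st n)).2.2.2.2.1
      hp := fun n => by rw [hst]; exact (h (st n)).2.2.1
      hr := fun n => by rw [hst]; exact (h (st n)).2.2.2.1
      M1 := fun n => (h (st n)).2.2.2.2.2.1
      M2 := fun n => (h (st n)).2.2.2.2.2.2.1
      N1 := fun n => by rw [hst]; exact (h (st n)).2.2.2.2.2.2.2.1
      N2 := fun n => by rw [hst]; exact (h (st n)).2.2.2.2.2.2.2.2 }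
  have hPn : ∀ n, n ≤ (st n).1 := by
    intro n
    induction n with
    | zero => omega
    | succ n ih => rw [hst]; have := (h (st n)).1; omega
  have hRn : ∀ n, n ≤ (st n).2.1 := by
    intro n
    induction n with
    | zero => omega
    | succ n ih => rw [hst]; have := (h (st n)).2.1; omega
  obtain ⟨f, g, hfg, h1, h2⟩ := Q.exists_map Q.p_unb Q.r_unb
  refine ⟨f, g, hfg, ⟨(st 0).1, fun x => ?_⟩, fun n => ⟨(st (n + 1)).2.1, fun x x' hx => ?_⟩,
    fun n => ⟨(st n).1, fun y y' hy => ?_⟩⟩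
  · apply h2 0
    rw [hfg]
  · exact h1 n x x' (NumDat.div_eq_of_dvd (dvd_seq hdp (hPn n)) hx)
  · apply h2 n
    rw [hfg, hfg]
    exact NumDat.div_eq_of_dvd (dvd_seq hdr (hRn n)) hy

end M2b

section M2a

theorem enum_set {α : Type*} (s : Set α) (hs : s.Finite) (a : α) : ∃ ψ : α → ℕ, Set.InjOn ψ s ∧
    (∀ x ∈ s, ψ x < s.ncard) ∧ (a ∈ s → ψ a = 0) := by
  classical
  have := hs.to_subtype
  let e := Finite.equivFin s
  have hN : Nat.card s = s.ncard := rfl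
  by_cases ha : a ∈ s
  · let k : ℕ := e ⟨a, ha⟩
    refine ⟨fun x => if h : x ∈ s then Equiv.swap k 0 (e ⟨x, h⟩ : ℕ) else 0, ?_, ?_, ?_⟩
    · intro x hx y hy hxy
      simp only [hx, hy, dif_pos] at hxy
      have := e.injective (Fin.ext ((Equiv.swap k 0).injective hxy))
      simpa using this
    · intro x hx
      simp only [hx, dif_pos]
      have h1 := (e ⟨x, hx⟩).2
      have h2 := (e ⟨a, ha⟩).2
      replace h1 := h1.trans_eq hN
      replace h2 := h2.trans_eq hN
      rw [Equiv.swap_apply_def]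
      split_ifs
      · omega
      · exact h2
      · exact h1
    · intro _
      simp only [ha, dif_pos]
      exact Equiv.swap_apply_left _ _
  · refine ⟨fun x => if h : x ∈ s then (e ⟨x, h⟩ : ℕ) else 0, ?_, ?_, fun h => absurd h ha⟩
    · intro x hx y hy hxy
      simp only [hx, hy, dif_pos] at hxy
      have := e.injective (Fin.ext hxy)
      simpa using this
    · intro x hx
      simp only [hx, dif_pos]
      have h1 := (e ⟨x, hx⟩).2
      exact h1.trans_eq hN

theorem digit {X : Type*} (x0 : X) (E F : Setoid X) (hEF : ∀ x y, E x y → F x y) (p q : ℕ)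
    (hp : 0 < p) (hq : 0 < q) (hE : ∀ x, Set.ncard {y | E x y} = p) (hF : ∀ x, Set.ncard {y | F x y} = q) :
    ∃ (N : ℕ) (d : X → ℕ), q = N * p ∧ (∀ x, d x < N) ∧ d x0 = 0 ∧ (∀ x y, E x y → d x = d y) ∧
      (∀ x y, F x y → d x = d y → E x y) := by
  classical
  let a : X → X := fun x => (Quotient.mk E x).out
  let b : X → X := fun x => (Quotient.mk F x).out
  have ha : ∀ x y, E x y ↔ a x = a y := by
    intro x y
    simp only [a, Quotient.out_inj]
    exact Quotient.eq.symm
  have hb : ∀ x y, F x y ↔ b x = b y := by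
    intro x y
    simp only [b, Quotient.out_inj]
    exact Quotient.eq.symm
  have hax : ∀ x, E (a x) x := fun x => Quotient.mk_out x
  have hbx : ∀ x, F (b x) x := fun x => Quotient.mk_out x
  have fE : ∀ x, {y | E x y}.Finite := fun x => Set.finite_of_ncard_pos (by rw [hE]; exact hp)
  have fF : ∀ x, {y | F x y}.Finite := fun x => Set.finite_of_ncard_pos (by rw [hF]; exact hq)
  have hcard : ∀ z, q = (a '' {y | F z y}).ncard * p := by
    intro z
    have h1 := Finset.card_eq_sum_card_image a (fF z).toFinset
    rw [Finset.sum_const_nat (m := p)] at h1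
    · rw [← Set.ncard_eq_toFinset_card _ (fF z), hF] at h1
      rw [h1, ← Set.ncard_coe_finset]
      congr 2
      simp
    · intro w hw
      simp only [Finset.mem_image, Set.Finite.mem_toFinset, Set.mem_ofPred_eq] at hw
      obtain ⟨y, hy, rfl⟩ := hw
      rw [← hE y, ← Set.ncard_coe_finset]
      congr 1
      ext v
      simp only [Finset.coe_filter, Set.Finite.mem_toFinset, Set.mem_ofPred_eq]
      rw [← ha]
      constructor
      · rintro ⟨-, h⟩; exact E.symm' h
      · intro h; exact ⟨F.trans' hy (hEF _ _ h), E.symm' h⟩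
  choose ψ h1 h2 h3 using fun z => enum_set (a '' {y | F z y}) ((fF z).image a) (a x0)
  have hN : ∀ z, (a '' {y | F z y}).ncard = (a '' {y | F x0 y}).ncard := by
    intro z
    exact Nat.eq_of_mul_eq_mul_right hp ((hcard z).symm.trans (hcard x0))
  have hmem : ∀ x, a x ∈ a '' {y | F (b x) y} := fun x => ⟨x, hbx x, rfl⟩
  refine ⟨(a '' {y | F x0 y}).ncard, fun x => ψ (b x) (a x), hcard x0, ?_, ?_, ?_, ?_⟩
  · intro x
    rw [← hN (b x)]
    exact h2 _ _ (hmem x)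
  · exact h3 _ (hmem x0)
  · intro x y hxy
    simp only [(ha x y).1 hxy, (hb x y).1 (hEF _ _ hxy)]
  · intro x y hF' hd
    simp only [(hb x y).1 hF'] at hd
    rw [ha]
    refine h1 (b y) ?_ (hmem y) hd
    rw [← (hb x y).1 hF']
    exact hmem x

theorem coords0 {X : Type*} (x0 : X) (E : ℕ → Setoid X) (mono : ∀ n x y, E n x y → E (n + 1) x y)
    (tot : ∀ x y, ∃ n, E n x y) (p : ℕ → ℕ) (hp : ∀ n, 0 < p n)
    (card : ∀ n x, Set.ncard {y | E n x y} = p n) (hu : ∀ K, ∃ n, K < p n)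
    (hE0 : ∀ x y, E 0 x y → x = y) :
    (∀ n, p n ∣ p (n + 1)) ∧ ∃ e : X ≃ ℕ, ∀ n x y, E n x y ↔ e x / p n = e y / p n := by
  choose N d hN hlt hd0 hd1 hd2 using fun n =>
    digit x0 (E n) (E (n + 1)) (mono n) (p n) (p (n + 1)) (hp _) (hp _) (card _) (card _)
  have hdvd : ∀ n, p n ∣ p (n + 1) := fun n => ⟨N n, by rw [hN n, mul_comm]⟩
  refine ⟨hdvd, ?_⟩
  have mono' : ∀ m n x y, m ≤ n → E m x y → E n x y := by
    intro m n x y h hE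
    induction n, h using Nat.le_induction with
    | base => exact hE
    | succ n _ ih => exact mono _ _ _ ih
  let s : ℕ → X → ℕ := fun n x => ∑ m ∈ Finset.range n, d m x * p m
  have ss : ∀ n x, s (n + 1) x = s n x + d n x * p n := fun n x => Finset.sum_range_succ _ _
  have slt : ∀ n x, s n x < p n := by
    intro n x
    induction n with
    | zero => exact hp 0
    | succ n ih =>
      rw [ss, hN]
      have := hlt n x
      nlinarith
  have key : ∀ n m x y, n ≤ m → E m x y → (s m x / p n = s m y / p n ↔ E n x y) := by
    intro n m x y h
    induction m, h using Nat.le_induction with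
    | base =>
      intro hE
      rw [Nat.div_eq_of_lt (slt n x), Nat.div_eq_of_lt (slt n y)]
      simp [hE]
    | succ m hnm ih =>
      intro hE
      obtain ⟨c, hc⟩ := dvd_seq hdvd hnm
      have e1 : ∀ x, s (m + 1) x / p n = s m x / p n + d m x * c := by
        intro x
        rw [ss, hc, mul_left_comm, Nat.add_mul_div_left _ _ (hp n)]
      constructor
      · intro h
        have h1 := NumDat.div_eq_of_dvd (dvd_seq hdvd hnm) h
        rw [ss, ss, Nat.add_mul_div_right _ _ (hp m), Nat.add_mul_div_right _ _ (hp m),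
          Nat.div_eq_of_lt (slt m x), Nat.div_eq_of_lt (slt m y)] at h1
        have h2 : d m x = d m y := by omega
        rw [e1, e1, h2] at h
        exact (ih (hd2 m x y hE h2)).1 (by omega)
      · intro h
        have hm := mono' _ _ _ _ hnm h
        rw [e1, e1, hd1 m x y hm, (ih hm).2 h]
  choose L hL using fun x => tot x0 x
  have sL : ∀ x n, L x ≤ n → s n x = s (L x) x := by
    intro x n h
    induction n, h using Nat.le_induction with
    | base => rfl
    | succ n h ih =>
      rw [ss, ih, ← hd1 n x0 x (mono' _ _ _ _ h (hL x)), hd0, zero_mul, add_zero]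
  let e : X → ℕ := fun x => s (L x) x
  have he : ∀ n x y, E n x y ↔ e x / p n = e y / p n := by
    intro n x y
    set m := max n (max (L x) (L y))
    show _ ↔ s (L x) x / _ = s (L y) y / _
    rw [← sL x m (by omega), ← sL y m (by omega)]
    exact (key n m x y (by omega) ((E m).trans' ((E m).symm' (mono' _ _ _ _ (by omega) (hL x)))
      (mono' _ _ _ _ (by omega) (hL y)))).symm
  have hinj : Function.Injective e := by
    intro x y h
    exact hE0 _ _ ((he 0 x y).2 (by rw [h]))
  have e0 : e x0 = 0 := Finset.sum_eq_zero fun m _ => by rw [hd0, zero_mul]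
  have hsurj : Function.Surjective e := by
    intro y
    obtain ⟨n, hn⟩ := hu y
    have hsub : e '' {z | E n x0 z} ⊆ (Finset.range (p n) : Set ℕ) := by
      rintro _ ⟨z, hz, rfl⟩
      have := (he n x0 z).1 hz
      rw [e0, Nat.zero_div] at this
      rw [Finset.coe_range, Set.mem_Iio]
      exact (Nat.div_eq_zero_iff_lt (hp n)).1 this.symm
    have heq := Set.eq_of_subset_of_ncard_le hsub (by
      rw [Set.ncard_image_of_injective _ hinj, card, Set.ncard_coe_finset, Finset.card_range])
      (Finset.finite_toSet _)
    have : y ∈ e '' {z | E n x0 z} := by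
      rw [heq]; simpa using hn
    obtain ⟨z, -, hz⟩ := this
    exact ⟨z, hz⟩
  exact ⟨Equiv.ofBijective e ⟨hinj, hsurj⟩, he⟩

theorem coords {X : Type*} (x0 : X) (E : ℕ → Setoid X) (mono : ∀ n x y, E n x y → E (n + 1) x y)
    (tot : ∀ x y, ∃ n, E n x y) (p : ℕ → ℕ) (hp : ∀ n, 0 < p n)
    (card : ∀ n x, Set.ncard {y | E n x y} = p n) (hu : ∀ K, ∃ n, K < p n) :
    (∀ n, p n ∣ p (n + 1)) ∧ ∃ e : X ≃ ℕ, ∀ n x y, E n x y ↔ e x / p n = e y / p n := by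
  let E' : ℕ → Setoid X := fun n => Nat.casesOn n ⊥ E
  let p' : ℕ → ℕ := fun n => Nat.casesOn n 1 p
  obtain ⟨h1, e, h2⟩ := coords0 x0 E' (by
      rintro (_ | n) x y h
      · cases h; exact (E 0).refl' _
      · exact mono n x y h) (by
      intro x y
      obtain ⟨n, hn⟩ := tot x y
      exact ⟨n + 1, hn⟩) p' (by
      rintro (_ | n)
      · exact one_pos
      · exact hp n) (by
      rintro (_ | n) x
      · show Set.ncard {y | x = y} = 1
        rw [Set.ncard_eq_one]
        exact ⟨x, by ext; simp [eq_comm]⟩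
      · exact card n x) (by
      intro K
      obtain ⟨n, hn⟩ := hu K
      exact ⟨n + 1, hn⟩) (fun x y h => h)
  exact ⟨fun n => h1 (n + 1), e, fun n => h2 (n + 1)⟩

theorem tree_lemma {X Y : Type*} (x0 : X) (y0 : Y) (E : ℕ → Setoid X) (F : ℕ → Setoid Y)
    (Emono : ∀ n x y, E n x y → E (n + 1) x y) (Fmono : ∀ n x y, F n x y → F (n + 1) x y)
    (Etot : ∀ x y, ∃ n, E n x y) (Ftot : ∀ x y, ∃ n, F n x y)
    (p r : ℕ → ℕ) (hp : ∀ n, 0 < p n) (hr : ∀ n, 0 < r n)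
    (Ecard : ∀ n x, Set.ncard {y | E n x y} = p n) (Fcard : ∀ n x, Set.ncard {y | F n x y} = r n)
    (hup : ∀ K, ∃ n, K < p n) (hur : ∀ K, ∃ n, K < r n) :
    ∃ (f : X → Y) (g : Y → X), (∃ m, ∀ y, F m (f (g y)) y) ∧ (∃ m, ∀ x, E m (g (f x)) x) ∧
      (∀ n, ∃ m, ∀ x x', E n x x' → F m (f x) (f x')) ∧
      (∀ n, ∃ m, ∀ y y', F n y y' → E m (g y) (g y')) := by
  obtain ⟨hdp, e, he⟩ := coords x0 E Emono Etot p hp Ecard hup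
  obtain ⟨hdr, e', he'⟩ := coords y0 F Fmono Ftot r hr Fcard hur
  obtain ⟨f, g, h1, ⟨m, h2⟩, h3, h4⟩ := nat_tree p r hp hr hdp hdr hup hur
  refine ⟨fun x => e'.symm (f (e x)), fun y => e.symm (g (e' y)), ⟨0, ?_⟩, ⟨m, ?_⟩, ?_, ?_⟩
  · intro y; simp [h1]
  · intro x; rw [he]; simpa using h2 (e x)
  · intro n
    obtain ⟨m, hm⟩ := h3 n
    refine ⟨m, fun x x' h => ?_⟩
    rw [he']; simpa using hm _ _ ((he _ _ _).1 h)
  · intro n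
    obtain ⟨m, hm⟩ := h4 n
    refine ⟨m, fun x x' h => ?_⟩
    rw [he]; simpa using hm _ _ ((he' _ _ _).1 h)

end M2a

section M5a

variable {G : Type} [Group G]

theorem lfa_fin (hG : LocallyFiniteByAbelian G) (K : Subgroup G) (hK : K.FG) :
    ∃ N : Subgroup G, (N : Set G).Finite ∧ ⁅K, K⁆ ≤ N := by
  obtain ⟨N, -, hfin, hN⟩ := hG K ((Group.fg_iff_subgroup_fg K).2 hK)
  refine ⟨N.map K.subtype, ?_, ?_⟩
  · rw [Subgroup.coe_map]
    exact (Set.toFinite (N : Set K)).image _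
  · rw [Subgroup.commutator_le]
    intro a ha b hb
    exact ⟨_, hN ⟨a, ha⟩ ⟨b, hb⟩, rfl⟩

theorem finOrder_of_comm (hG : LocallyFiniteByAbelian G) (x : G) (hx : x ∈ commutator G) :
    IsOfFinOrder x := by
  classical
  have key : ∃ K : Subgroup G, K.FG ∧ x ∈ ⁅K, K⁆ := by
    rw [commutator_eq_closure] at hx
    induction hx using Subgroup.closure_induction with
    | mem x hx =>
      obtain ⟨a, b, rfl⟩ := hx
      refine ⟨Subgroup.closure {a, b}, ⟨{a, b}, by simp⟩, ?_⟩
      exact Subgroup.commutator_mem_commutator (Subgroup.subset_closure (by simp))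
        (Subgroup.subset_closure (by simp))
    | one => exact ⟨⊥, ⟨∅, by simp⟩, one_mem _⟩
    | mul x y _ _ hx hy =>
      obtain ⟨K, hK, hx⟩ := hx
      obtain ⟨L, hL, hy⟩ := hy
      exact ⟨K ⊔ L, hK.sup hL, mul_mem (Subgroup.commutator_mono le_sup_left le_sup_left hx)
        (Subgroup.commutator_mono le_sup_right le_sup_right hy)⟩
    | inv x _ hx =>
      obtain ⟨K, hK, hx⟩ := hx
      exact ⟨K, hK, inv_mem hx⟩
  obtain ⟨K, hK, hxK⟩ := key
  obtain ⟨N, hN, hle⟩ := lfa_fin hG K hK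
  have : Finite N := hN.to_subtype
  have h := isOfFinOrder_of_finite (⟨x, hle hxK⟩ : N)
  exact Submonoid.isOfFinOrder_coe (H := N.toSubmonoid).2 h

theorem fin_comm_set (hG : LocallyFiniteByAbelian G) (K : Subgroup G) (hK : K.FG) :
    Finite (commutatorSet K) := by
  obtain ⟨N, -, hfin, hN⟩ := hG K ((Group.fg_iff_subgroup_fg K).2 hK)
  have : commutatorSet K ⊆ (N : Set K) := by
    rintro _ ⟨a, b, rfl⟩
    exact hN a b
  exact ((Set.toFinite (N : Set K)).subset this).to_subtype

theorem cent_pow (hG : LocallyFiniteByAbelian G) (K : Subgroup G) (hK : K.FG) :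
    ∃ p : ℕ, 2 ≤ p ∧ ∀ g ∈ K, ∀ h ∈ K, Commute (g ^ p) h := by
  have := fin_comm_set hG K hK
  have : Group.FG K := (Group.fg_iff_subgroup_fg K).2 hK
  have hi : (Subgroup.center K).index ≠ 0 := Subgroup.FiniteIndex.index_ne_zero
  refine ⟨2 * (Subgroup.center K).index, by omega, fun g hg h hh => ?_⟩
  have h1 := Subgroup.pow_index_mem (Subgroup.center K) (⟨g, hg⟩ : K)
  have h2 := Subgroup.pow_mem _ h1 2
  rw [← pow_mul, mul_comm] at h2
  have h3 := Subgroup.mem_center_iff.1 h2 ⟨h, hh⟩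
  have h4 := congrArg Subtype.val h3
  exact h4.symm

theorem tors_fin_comm_aux (A : Type) [CommGroup A] [Group.FG A] : {z : A | IsOfFinOrder z}.Finite := by
  have hfg : AddGroup.FG (Additive A) := inferInstance
  have : Module.Finite ℤ (Additive A) := Module.Finite.iff_addGroup_fg.mpr hfg
  have hf := Module.finite_of_fg_torsion (Submodule.torsion ℤ (Additive A))
    Submodule.torsion_isTorsion
  have := Set.toFinite (Submodule.torsion ℤ (Additive A) : Set (Additive A))
  refine (this.image Additive.toMul).subset ?_
  intro z hz
  refine ⟨Additive.ofMul z, ?_, rfl⟩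
  obtain ⟨n, hn, hz⟩ := isOfFinOrder_iff_pow_eq_one.1 hz
  rw [SetLike.mem_coe, Submodule.mem_torsion_iff]
  refine ⟨⟨(n : ℤ), mem_nonZeroDivisors_of_ne_zero (by omega)⟩, ?_⟩
  show (n : ℤ) • Additive.ofMul z = 0
  rw [natCast_zsmul, ← ofMul_pow, hz]; rfl

theorem tors_fin_comm (A : Type) [h : Group A] [Group.FG A] (hc : ∀ a b : A, a * b = b * a) :
    {z : A | IsOfFinOrder z}.Finite :=
  letI : CommGroup A := { h with mul_comm := hc }
  tors_fin_comm_aux A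

theorem tors_fin (hG : LocallyFiniteByAbelian G) (K : Subgroup G) (hK : K.FG) :
    {g : G | g ∈ K ∧ IsOfFinOrder g}.Finite := by
  have := fin_comm_set hG K hK
  have : Group.FG K := (Group.fg_iff_subgroup_fg K).2 hK
  have hZ : Group.FG (Subgroup.center K) := inferInstance
  have hT : {z : Subgroup.center K | IsOfFinOrder z}.Finite := tors_fin_comm _
    (fun a b => Subtype.ext (Subgroup.mem_center_iff.1 b.2 a))
  have hKf : {g : K | IsOfFinOrder g}.Finite := by
    refine Set.Finite.of_finite_fibers (QuotientGroup.mk (s := Subgroup.center K)) (Set.toFinite _) ?_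
    intro q _
    by_cases hne : ∃ t : K, IsOfFinOrder t ∧ (t : K ⧸ Subgroup.center K) = q
    · obtain ⟨t, ht, rfl⟩ := hne
      refine (hT.image (fun z : Subgroup.center K => t * (z : K))).subset ?_
      rintro t' ⟨ht', hq⟩
      have hz : t⁻¹ * t' ∈ Subgroup.center K := QuotientGroup.eq.1 hq.symm
      refine ⟨⟨t⁻¹ * t', hz⟩, ?_, by simp⟩
      show IsOfFinOrder _
      refine Submonoid.isOfFinOrder_coe (H := (Subgroup.center K).toSubmonoid).1 ?_
      show IsOfFinOrder (t⁻¹ * t')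
      have hc : Commute t⁻¹ t' := by
        have := Subgroup.mem_center_iff.1 hz t
        have h2 : t' = t⁻¹ * t' * t := by rw [← this]; group
        show t⁻¹ * t' = t' * t⁻¹
        conv_rhs => rw [h2]
        group
      exact hc.isOfFinOrder_mul ht.inv ht'
    · convert Set.finite_empty
      ext t
      simp only [Set.mem_inter_iff, Set.mem_empty_iff_false, iff_false]
      rintro ⟨h1, h2⟩
      exact hne ⟨t, h1, h2⟩
  refine (hKf.image (K.subtype)).subset ?_
  rintro g ⟨hg, ho⟩
  refine ⟨⟨g, hg⟩, ?_, rfl⟩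
  show IsOfFinOrder _
  exact Submonoid.isOfFinOrder_coe (H := K.toSubmonoid).1 ho

end M5a

section M5b

variable {G : Type} [Group G]

theorem exists_phi (hG : LocallyFiniteByAbelian G) : ∃ (ι : Type) (φ : G → (ι →₀ ℚ)) (b : ι → G),
    (∀ x y, φ (x * y) = φ x + φ y) ∧ (∀ i, φ (b i) = Finsupp.single i 1) ∧
    (∀ x, φ x = 0 → IsOfFinOrder x) := by
  let A := Additive (Abelianization G)
  let V := TensorProduct ℤ ℚ A
  let f : A →ₗ[ℤ] V := TensorProduct.mk ℤ ℚ A 1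
  let F : G → V := fun x => f (Additive.ofMul (Abelianization.of x))
  have hF : ∀ a : A, ∃ x, F x = f a := by
    intro a
    obtain ⟨x, hx⟩ := QuotientGroup.mk_surjective (Additive.toMul a)
    exact ⟨x, by show f _ = f a; congr 1⟩
  have hspan : (⊤ : Submodule ℚ V) ≤ Submodule.span ℚ (Set.range F) := by
    intro v _
    induction v using TensorProduct.induction_on with
    | zero => exact zero_mem _
    | tmul q a =>
      obtain ⟨x, hx⟩ := hF a
      have : q ⊗ₜ[ℤ] a = q • F x := by
        rw [hx]
        show _ = q • ((1 : ℚ) ⊗ₜ[ℤ] a)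
        rw [TensorProduct.smul_tmul']; simp
      rw [this]
      exact Submodule.smul_mem _ _ (Submodule.subset_span ⟨x, rfl⟩)
    | add v w hv hw => exact add_mem (hv trivial) (hw trivial)
  let B := Module.Basis.ofSpan hspan
  have hB : ∀ i, ∃ x, F x = B i := fun i => Module.Basis.ofSpan_subset hspan ⟨i, rfl⟩
  choose b hb using hB
  refine ⟨_, fun x => B.repr (F x), b, ?_, ?_, ?_⟩
  · intro x y
    have : F (x * y) = F x + F y := by
      show f _ = f _ + f _
      rw [← map_add]; congr 1
    show B.repr (F (x * y)) = B.repr (F x) + B.repr (F y)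
    rw [← map_add, this]
  · intro i
    show B.repr (F (b i)) = _
    rw [hb, Module.Basis.repr_self]
  · intro x hx
    have h0 : F x = 0 := by
      have : B.repr (F x) = 0 := hx
      simpa using this
    have hloc : IsLocalizedModule (nonZeroDivisors ℤ) f :=
      (isLocalizedModule_iff_isBaseChange (nonZeroDivisors ℤ) ℚ f).2 (TensorProduct.isBaseChange ℤ A ℚ)
    obtain ⟨c, hc⟩ := (IsLocalizedModule.eq_zero_iff (nonZeroDivisors ℤ) f).1 h0
    have hc' : (c : ℤ) • Additive.ofMul (Abelianization.of x) = 0 := hc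
    rw [← ofMul_zpow, ← map_zpow] at hc'
    have hmem : x ^ (c : ℤ) ∈ commutator G := by
      rw [← Abelianization.ker_of]
      exact hc'
    have := finOrder_of_comm hG _ hmem
    obtain ⟨n, hn, hxn⟩ := isOfFinOrder_iff_pow_eq_one.1 this
    rw [← zpow_natCast, ← zpow_mul] at hxn
    refine isOfFinOrder_iff_zpow_eq_one.2 ⟨_, ?_, hxn⟩
    exact mul_ne_zero (nonZeroDivisors.coe_ne_zero c) (by omega)

/-- Preliminary model. -/
structure PreM (G : Type) [Group G] where
  ι : Type
  φ : G → (ι →₀ ℚ)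
  φ_mul : ∀ x y, φ (x * y) = φ x + φ y
  e : ι → G
  φ_e : ∀ i, φ (e i) = Finsupp.single i 1
  e_comm : ∀ i j, Commute (e i) (e j)
  Gn : ℕ → Subgroup G
  Gn_mono : ∀ {m n}, m ≤ n → Gn m ≤ Gn n
  Gn_ex : ∀ x, ∃ n, x ∈ Gn n
  Gn_fg : ∀ n, (Gn n).FG
  I : ℕ → Finset ι
  I_mono : ∀ {m n}, m ≤ n → I m ⊆ I n
  I_ex : ∀ i, ∃ n, i ∈ I n
  supp : ∀ n, ∀ g ∈ Gn n, ∀ i, i ∉ I n → φ g i = 0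
  e_mem : ∀ n, ∀ i ∈ I n, e i ∈ Gn n
  cent : ∀ n, ∀ i, i ∉ I n → ∀ g ∈ Gn n, Commute (e i) g
  fin : ∀ n (c : ℚ), {g : G | g ∈ Gn n ∧ ∀ i, |φ g i| ≤ c}.Finite
  b : ι → G
  b_mem : ∀ n, ∀ i ∈ I n, b i ∈ Gn n
  b_fl : ∀ i j, ⌊φ (b i) j⌋ = 0
  b_inj : Function.Injective b

theorem fin_bounded {ι : Type} (I : Finset ι) (D : ℕ) (hD : 0 < D) (c : ℚ) :
    {v : ι →₀ ℚ | (∀ i, i ∉ I → v i = 0) ∧ (∀ i, ∃ k : ℤ, D * v i = k) ∧ ∀ i, |v i| ≤ c}.Finite := by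
  classical
  have hfin : (Set.pi Set.univ (fun _ : I => ((fun k : ℤ => (k : ℚ) / D) '' Set.Icc (-⌈D * c⌉) ⌈D * c⌉))).Finite :=
    Set.Finite.pi fun _ => (Set.finite_Icc _ _).image _
  refine Set.Finite.of_finite_image (f := fun v : ι →₀ ℚ => fun i : I => v i) (hfin.subset ?_) ?_
  · rintro _ ⟨v, ⟨h1, h2, h3⟩, rfl⟩ i -
    obtain ⟨k, hk⟩ := h2 i
    have hD' : (0 : ℚ) < D := by exact_mod_cast hD
    refine ⟨k, ?_, ?_⟩
    · have h4 := abs_le.1 (h3 i)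
      have h5 := Int.le_ceil (D * c : ℚ)
      constructor
      · have : (-(⌈D * c⌉ : ℤ) : ℚ) ≤ k := by
          rw [← hk]; nlinarith [h4.1]
        exact_mod_cast this
      · have : (k : ℚ) ≤ (⌈(D * c : ℚ)⌉ : ℤ) := by
          rw [← hk]; nlinarith [h4.2]
        exact_mod_cast this
    · show (k : ℚ) / D = v i
      rw [← hk]; field_simp
  · rintro v ⟨h1, -⟩ w ⟨h2, -⟩ h
    ext i
    by_cases hi : i ∈ I
    · exact congrFun h ⟨i, hi⟩
    · rw [h1 i hi, h2 i hi]

theorem exists_den {ι : Type} (φ : G → (ι →₀ ℚ)) (φ_mul : ∀ x y, φ (x * y) = φ x + φ y)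
    (K : Subgroup G) (hK : K.FG) : ∃ D : ℕ, 0 < D ∧ ∀ g ∈ K, ∀ i, ∃ k : ℤ, D * φ g i = k := by
  classical
  obtain ⟨T, rfl⟩ := hK
  have h1 : φ 1 = 0 := by have := φ_mul 1 1; simpa using this
  have hinv : ∀ x, φ x⁻¹ = - φ x := by
    intro x
    have := φ_mul x x⁻¹
    rw [mul_inv_cancel, h1] at this
    exact (neg_eq_of_add_eq_zero_right this.symm).symm
  let D : ℕ := ∏ t ∈ T, ∏ i ∈ (φ t).support, (φ t i).den
  refine ⟨D, Finset.prod_pos fun t _ => Finset.prod_pos fun i _ => Rat.den_pos _, ?_⟩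
  intro g hg
  induction hg using Subgroup.closure_induction with
  | mem t ht =>
    intro i
    by_cases hi : i ∈ (φ t).support
    · have hd : (φ t i).den ∣ D :=
        (Finset.dvd_prod_of_mem (fun i => (φ t i).den) hi).trans
          (Finset.dvd_prod_of_mem (fun t => ∏ i ∈ (φ t).support, (φ t i).den) ht)
      obtain ⟨c, hc⟩ := hd
      refine ⟨c * (φ t i).num, ?_⟩
      rw [hc]
      push_cast
      have := Rat.den_mul_eq_num (φ t i)
      rw [← this]; ring
    · refine ⟨0, ?_⟩
      rw [Finsupp.notMem_support_iff.1 hi]; simp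
  | one => intro i; exact ⟨0, by rw [h1]; simp⟩
  | mul x y _ _ hx hy =>
    intro i
    obtain ⟨k, hk⟩ := hx i
    obtain ⟨l, hl⟩ := hy i
    exact ⟨k + l, by rw [φ_mul, Finsupp.add_apply]; push_cast; rw [← hk, ← hl]; ring⟩
  | inv x _ hx =>
    intro i
    obtain ⟨k, hk⟩ := hx i
    exact ⟨-k, by rw [hinv, Finsupp.neg_apply]; push_cast; rw [← hk]; ring⟩

theorem exists_preM [Countable G] (hG : LocallyFiniteByAbelian G) : Nonempty (PreM G) := by
  classical
  obtain ⟨ι, φ, b, φ_mul, φ_b, φ_ker⟩ := exists_phi hG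
  have h1 : φ 1 = 0 := by have := φ_mul 1 1; simpa using this
  have hinv : ∀ x, φ x⁻¹ = - φ x := by
    intro x
    have := φ_mul x x⁻¹
    rw [mul_inv_cancel, h1] at this
    exact (neg_eq_of_add_eq_zero_right this.symm).symm
  obtain ⟨x, hx⟩ := exists_surjective_nat G
  let I : ℕ → Finset ι := fun n => (Finset.range n).biUnion fun j => (φ (x j)).support
  let T : ℕ → Finset G := fun n => (Finset.range n).image x ∪ (I n).image b
  let Gn : ℕ → Subgroup G := fun n => Subgroup.closure (T n : Set G)
  have I_mono : ∀ {m n}, m ≤ n → I m ⊆ I n := by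
    intro m n h
    exact Finset.biUnion_subset_biUnion_of_subset_left _ (Finset.range_mono h)
  have Gn_mono : ∀ {m n}, m ≤ n → Gn m ≤ Gn n := by
    intro m n h
    apply Subgroup.closure_mono
    have : T m ⊆ T n := Finset.union_subset_union (Finset.image_subset_image (Finset.range_mono h))
      (Finset.image_subset_image (I_mono h))
    exact_mod_cast this
  have Gn_ex : ∀ y, ∃ n, y ∈ Gn n := by
    intro y
    obtain ⟨j, rfl⟩ := hx y
    refine ⟨j + 1, Subgroup.subset_closure ?_⟩
    rw [Finset.mem_coe]
    exact Finset.mem_union_left _ (Finset.mem_image_of_mem _ (by simp))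
  have Gn_fg : ∀ n, (Gn n).FG := fun n => ⟨T n, rfl⟩
  have I_ex : ∀ i, ∃ n, i ∈ I n := by
    intro i
    obtain ⟨j, hj⟩ := hx (b i)
    refine ⟨j + 1, Finset.mem_biUnion.2 ⟨j, by simp, ?_⟩⟩
    rw [hj, φ_b]; simp
  have b_mem : ∀ n, ∀ i ∈ I n, b i ∈ Gn n := by
    intro n i hi
    apply Subgroup.subset_closure
    rw [Finset.mem_coe]
    exact Finset.mem_union_right _ (Finset.mem_image_of_mem _ hi)
  have supp : ∀ n, ∀ g ∈ Gn n, ∀ i, i ∉ I n → φ g i = 0 := by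
    intro n g hg i hi
    induction hg using Subgroup.closure_induction with
    | mem t ht =>
      rw [Finset.mem_coe] at ht
      rcases Finset.mem_union.1 ht with ht | ht
      · obtain ⟨j, hj, rfl⟩ := Finset.mem_image.1 ht
        by_contra hne
        exact hi (Finset.mem_biUnion.2 ⟨j, hj, Finsupp.mem_support_iff.2 hne⟩)
      · obtain ⟨j, hj, rfl⟩ := Finset.mem_image.1 ht
        rw [φ_b, Finsupp.single_apply, if_neg]
        rintro rfl
        exact hi hj
    | one => rw [h1]; rfl
    | mul x y _ _ hx hy => rw [φ_mul, Finsupp.add_apply, hx, hy, add_zero]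
    | inv x _ hx => rw [hinv, Finsupp.neg_apply, hx, neg_zero]
  let m : ι → ℕ := fun i => Nat.find (I_ex i)
  have hm : ∀ i, i ∈ I (m i) := fun i => Nat.find_spec (I_ex i)
  have hm' : ∀ i n, i ∉ I n → n ≤ m i := by
    intro i n hi
    by_contra h
    exact hi (I_mono (by omega) (hm i))
  choose p hp2 hpc using fun i => cent_pow hG (Gn (m i)) (Gn_fg (m i))
  have hpow : ∀ (y : G) (n : ℕ), φ (y ^ n) = (n : ℚ) • φ y := by
    intro y n
    induction n with
    | zero => simp [h1]
    | succ n ih => rw [pow_succ, φ_mul, ih]; push_cast; rw [add_smul, one_smul]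
  have hcomm : ∀ i j, m i ≤ m j → Commute (b i ^ p i) (b j ^ p j) := fun i j h =>
    (hpc j _ (b_mem _ _ (hm j)) _ (Subgroup.pow_mem _ (Gn_mono h (b_mem _ _ (hm i))) _)).symm
  have hp0 : ∀ i, (p i : ℚ) ≠ 0 := fun i => by have := hp2 i; exact_mod_cast (by omega)
  -- rescaled map
  let ψ : G → (ι →₀ ℚ) := fun g => Finsupp.onFinset (φ g).support (fun i => φ g i / p i) (by
    intro i hi
    rw [Finsupp.mem_support_iff]
    intro h0
    rw [h0, zero_div] at hi
    exact hi rfl)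
  have ψ_ap : ∀ g i, ψ g i = φ g i / p i := fun g i => rfl
  have ψ_mul : ∀ x y, ψ (x * y) = ψ x + ψ y := by
    intro x y
    ext i
    rw [Finsupp.add_apply, ψ_ap, ψ_ap, ψ_ap, φ_mul, Finsupp.add_apply, add_div]
  have ψ_eq : ∀ x y, ψ x = ψ y → φ x = φ y := by
    intro x y h
    ext i
    have := DFunLike.congr_fun h i
    rw [ψ_ap, ψ_ap] at this
    field_simp [hp0 i] at this
    exact this
  have ψ_supp : ∀ n, ∀ g ∈ Gn n, ∀ i, i ∉ I n → ψ g i = 0 := by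
    intro n g hg i hi
    rw [ψ_ap, supp n g hg i hi, zero_div]
  refine ⟨⟨ι, ψ, ψ_mul, fun i => b i ^ p i, ?_, ?_, Gn, Gn_mono, Gn_ex, Gn_fg, I, I_mono, I_ex,
    ψ_supp, ?_, ?_, ?_, b, b_mem, ?_, ?_⟩⟩
  · intro i
    ext j
    rw [ψ_ap, hpow, φ_b, Finsupp.smul_apply, smul_eq_mul]
    by_cases h : i = j
    · subst h; simp [hp0 i]
    · simp [Finsupp.single_apply, h]
  · intro i j
    rcases le_total (m i) (m j) with h | h
    · exact hcomm i j h
    · exact (hcomm j i h).symm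
  · intro n i hi
    exact Subgroup.pow_mem _ (b_mem n i hi) _
  · intro n i hi g hg
    exact hpc i _ (b_mem _ _ (hm i)) _ (Gn_mono (hm' i n hi) hg)
  · intro n c
    obtain ⟨D, hD, hDg⟩ := exists_den ψ ψ_mul (Gn n) (Gn_fg n)
    refine Set.Finite.of_finite_fibers ψ ((fin_bounded (I n) D hD c).subset ?_) ?_
    · rintro _ ⟨g, ⟨hg, hb⟩, rfl⟩
      exact ⟨ψ_supp n g hg, hDg g hg, hb⟩
    · rintro _ ⟨g, ⟨hg, -⟩, rfl⟩
      refine ((tors_fin hG (Gn n) (Gn_fg n)).image (fun t => g * t)).subset ?_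
      rintro y ⟨⟨hy, -⟩, hyg⟩
      refine ⟨g⁻¹ * y, ⟨mul_mem (inv_mem hg) hy, φ_ker _ ?_⟩, by group⟩
      rw [φ_mul, hinv, ψ_eq y g hyg, neg_add_cancel]
  · intro i j
    rw [ψ_ap, φ_b, Finsupp.single_apply, Int.floor_eq_iff]
    have h2 : (2 : ℚ) ≤ p i := by exact_mod_cast hp2 i
    split_ifs with h
    · subst h
      constructor
      · push_cast; positivity
      · push_cast; rw [div_lt_iff₀ (by linarith)]; linarith
    · simp
  · intro i j h
    have h2 : φ (b i) = φ (b j) := by rw [h]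
    rw [φ_b, φ_b] at h2
    exact (Finsupp.single_left_inj one_ne_zero).1 h2

end M5b

section M5c

variable {G : Type} [Group G]

theorem exists_sigma (M : PreM G) : ∃ σ : (M.ι →₀ ℤ) → G,
    (∀ k l, σ (k + l) = σ k * σ l) ∧ ∀ i a, σ (Finsupp.single i a) = M.e i ^ a := by
  have hc : ∀ x ∈ Set.range M.e, ∀ y ∈ Set.range M.e, x * y = y * x := by
    rintro _ ⟨i, rfl⟩ _ ⟨j, rfl⟩
    exact M.e_comm i j
  let _ : CommGroup (Subgroup.closure (Set.range M.e)) := Subgroup.closureCommGroupOfComm hc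
  let e' : M.ι → Additive (Subgroup.closure (Set.range M.e)) := fun i =>
    Additive.ofMul ⟨M.e i, Subgroup.subset_closure ⟨i, rfl⟩⟩
  let F : (M.ι →₀ ℤ) →+ Additive (Subgroup.closure (Set.range M.e)) :=
    Finsupp.liftAddHom (fun i => (zmultiplesHom _ (e' i)))
  refine ⟨fun k => ((F k).toMul : Subgroup.closure (Set.range M.e)).1, ?_, ?_⟩
  · intro k l
    show ((F (k + l)).toMul : Subgroup.closure (Set.range M.e)).1 = _
    rw [map_add]
    rfl
  · intro i a
    have : F (Finsupp.single i a) = a • e' i := by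
      simp [F]
    show ((F (Finsupp.single i a)).toMul : Subgroup.closure (Set.range M.e)).1 = _
    rw [this]
    rfl

namespace PreM

variable (M : PreM G)

/-- The section of the lattice. -/
noncomputable def σ : (M.ι →₀ ℤ) → G := Classical.choose (exists_sigma M)

theorem σ_add (k l) : M.σ (k + l) = M.σ k * M.σ l := (Classical.choose_spec (exists_sigma M)).1 k l

theorem σ_single (i a) : M.σ (Finsupp.single i a) = M.e i ^ a :=
  (Classical.choose_spec (exists_sigma M)).2 i a

theorem σ_zero : M.σ 0 = 1 := by
  have := M.σ_add 0 0
  simpa using this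

theorem σ_neg (k) : M.σ (-k) = (M.σ k)⁻¹ := by
  have := M.σ_add (-k) k
  rw [neg_add_cancel, M.σ_zero] at this
  exact eq_inv_of_mul_eq_one_left this.symm

theorem φ_one : M.φ 1 = 0 := by have := M.φ_mul 1 1; simpa using this

theorem φ_inv (x) : M.φ x⁻¹ = - M.φ x := by
  have := M.φ_mul x x⁻¹
  rw [mul_inv_cancel, M.φ_one] at this
  exact (neg_eq_of_add_eq_zero_right this.symm).symm

theorem φ_zpow (x) (a : ℤ) : M.φ (x ^ a) = (a : ℚ) • M.φ x := by
  induction a using Int.induction_on with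
  | zero => simp [M.φ_one]
  | succ n ih => rw [zpow_add_one, M.φ_mul, ih]; push_cast; rw [add_smul, one_smul]
  | pred n ih => rw [zpow_sub_one, M.φ_mul, ih, M.φ_inv]; push_cast; rw [sub_smul, one_smul, sub_eq_add_neg]

theorem φ_σ (k i) : M.φ (M.σ k) i = (k i : ℚ) := by
  classical
  induction k using Finsupp.induction_linear with
  | zero => rw [M.σ_zero, M.φ_one]; simp
  | add k l hk hl => rw [M.σ_add, M.φ_mul, Finsupp.add_apply, hk, hl]; simp
  | single j a =>
    rw [M.σ_single, M.φ_zpow, M.φ_e]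
    by_cases h : j = i
    · subst h; simp
    · simp [h]

theorem σ_mem (L : Subgroup G) (k : M.ι →₀ ℤ) (h : ∀ i, k i ≠ 0 → M.e i ∈ L) : M.σ k ∈ L := by
  classical
  induction k using Finsupp.induction with
  | zero => rw [M.σ_zero]; exact one_mem _
  | single_add i a f hi ha ih =>
    rw [M.σ_add, M.σ_single]
    have hfi : f i = 0 := Finsupp.notMem_support_iff.1 hi
    refine mul_mem (Subgroup.zpow_mem _ (h i ?_) _) (ih fun j hj => h j ?_)
    · simpa [hfi] using ha
    · have : i ≠ j := by rintro rfl; exact hj hfi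
      simpa [this] using hj

theorem σ_mem_Gn (n) (k : M.ι →₀ ℤ) (h : ∀ i, i ∉ M.I n → k i = 0) : M.σ k ∈ M.Gn n :=
  M.σ_mem _ k fun i hi => M.e_mem n i (by by_contra h'; exact hi (h i h'))

theorem σ_comm (n) (k : M.ι →₀ ℤ) (h : ∀ i, i ∈ M.I n → k i = 0) (g) (hg : g ∈ M.Gn n) :
    Commute (M.σ k) g := by
  have : M.σ k ∈ Subgroup.centralizer {g} := M.σ_mem _ k fun i hi => by
    rw [Subgroup.mem_centralizer_singleton_iff]
    exact (M.cent n i (fun h' => hi (h i h')) g hg)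
  rw [Subgroup.mem_centralizer_singleton_iff] at this
  exact this

theorem σ_conj (n) (k : M.ι →₀ ℤ) (g) (hg : g ∈ M.Gn n) : M.σ k * g * (M.σ k)⁻¹ ∈ M.Gn n := by
  classical
  have hk := Finsupp.filter_add_filter_not k (fun i => i ∈ M.I n)
  set k1 := k.filter (fun i => i ∈ M.I n) with hk1
  set k2 := k.filter (fun i => ¬ i ∈ M.I n) with hk2
  have h1 : M.σ k1 ∈ M.Gn n := M.σ_mem_Gn n k1 fun i hi => by
    rw [hk1, Finsupp.filter_apply_neg _ _ hi]
  have h2 : Commute (M.σ k2) g := M.σ_comm n k2 (fun i hi => by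
    simp [hk2, hi]) g hg
  have : M.σ k * g * (M.σ k)⁻¹ = M.σ k1 * g * (M.σ k1)⁻¹ := by
    rw [← hk, M.σ_add, mul_inv_rev, mul_assoc (M.σ k1), h2.eq]; group
  rw [this]
  exact mul_mem (mul_mem h1 hg) (inv_mem h1)

/-- Integer part. -/
noncomputable def fl (x : G) : M.ι →₀ ℤ := (M.φ x).mapRange Int.floor Int.floor_zero

theorem fl_apply (x i) : M.fl x i = ⌊M.φ x i⌋ := rfl

theorem fl_mul_σ (x k) : M.fl (x * M.σ k) = M.fl x + k := by
  ext i
  rw [Finsupp.add_apply, fl_apply, fl_apply, M.φ_mul, Finsupp.add_apply, M.φ_σ, Int.floor_add_intCast]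

/-- Fractional part. -/
noncomputable def pr (x : G) : G := x * M.σ (-(M.fl x))

theorem pr_mul_σ (x k) : M.pr (x * M.σ k) = M.pr x := by
  rw [pr, pr, fl_mul_σ, mul_assoc, ← M.σ_add]
  congr 2; abel

theorem fl_pr (x) : M.fl (M.pr x) = 0 := by
  rw [pr, fl_mul_σ, add_neg_cancel]

theorem pr_of_fl (x) (h : M.fl x = 0) : M.pr x = x := by
  rw [pr, h, neg_zero, M.σ_zero, mul_one]

theorem pr_mul (x) : M.pr x * M.σ (M.fl x) = x := by
  rw [pr, mul_assoc, ← M.σ_add, neg_add_cancel, M.σ_zero, mul_one]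

theorem fl_supp (n x) (hx : x ∈ M.Gn n) (i) (hi : i ∉ M.I n) : M.fl x i = 0 := by
  rw [fl_apply, M.supp n x hx i hi, Int.floor_zero]

theorem pr_mem (n x) (hx : x ∈ M.Gn n) : M.pr x ∈ M.Gn n := by
  refine mul_mem hx (M.σ_mem_Gn n _ fun i hi => ?_)
  rw [Finsupp.neg_apply, M.fl_supp n x hx i hi, neg_zero]

theorem φ_diff (x y i) : M.φ y i = M.φ x i + M.φ (x⁻¹ * y) i := by
  rw [M.φ_mul, M.φ_inv, Finsupp.add_apply, Finsupp.neg_apply]; ring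

theorem fl_diff (n x y) (h : x⁻¹ * y ∈ M.Gn n) (i) (hi : i ∉ M.I n) : M.fl y i = M.fl x i := by
  rw [fl_apply, fl_apply, M.φ_diff x y, M.supp n _ h i hi, add_zero]

theorem E_pr (n x y) (h : x⁻¹ * y ∈ M.Gn n) : (M.pr x)⁻¹ * M.pr y ∈ M.Gn n := by
  have : (M.pr x)⁻¹ * M.pr y =
      (M.σ (M.fl x) * (x⁻¹ * y) * (M.σ (M.fl x))⁻¹) * M.σ (M.fl x - M.fl y) := by
    rw [pr, pr, sub_eq_add_neg, M.σ_add, M.σ_neg]; group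
  rw [this]
  refine mul_mem (M.σ_conj n _ _ h) (M.σ_mem_Gn n _ fun i hi => ?_)
  rw [Finsupp.sub_apply, M.fl_diff n x y h i hi, sub_self]

theorem E_pr_conv (n x y) (h : (M.pr x)⁻¹ * M.pr y ∈ M.Gn n)
    (h2 : ∀ i, i ∉ M.I n → M.fl y i = M.fl x i) : x⁻¹ * y ∈ M.Gn n := by
  have : x⁻¹ * y =
      (M.σ (-M.fl x) * ((M.pr x)⁻¹ * M.pr y) * (M.σ (-M.fl x))⁻¹) * M.σ (M.fl y - M.fl x) := by
    rw [pr, pr, sub_eq_add_neg, add_comm, M.σ_add, M.σ_neg, M.σ_neg]; group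
  rw [this]
  refine mul_mem (M.σ_conj n _ _ h) (M.σ_mem_Gn n _ fun i hi => ?_)
  rw [Finsupp.sub_apply, h2 i hi, sub_self]

/-- The fractional slice. -/
def S : Type := {x : G // M.fl x = 0}

/-- The level equivalence relations. -/
def E (n : ℕ) : Setoid M.S where
  r s t := s.1⁻¹ * t.1 ∈ M.Gn n
  iseqv := by
    refine ⟨fun x => ?_, fun {x y} h => ?_, fun {x y z} h1 h2 => ?_⟩
    · rw [inv_mul_cancel]; exact one_mem _
    · have := inv_mem h
      rwa [mul_inv_rev, inv_inv] at this
    · have := mul_mem h1 h2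
      rwa [mul_assoc, mul_inv_cancel_left] at this

theorem E_def (n) (s t : M.S) : M.E n s t ↔ s.1⁻¹ * t.1 ∈ M.Gn n := Iff.rfl

theorem fin_S (n) : {g : M.S | g.1 ∈ M.Gn n}.Finite := by
  refine Set.Finite.of_finite_image (f := Subtype.val) ((M.fin n 1).subset ?_)
    Subtype.val_injective.injOn
  rintro _ ⟨g, hg, rfl⟩
  refine ⟨hg, fun i => ?_⟩
  have h0 : ⌊M.φ g.1 i⌋ = 0 := by rw [← M.fl_apply, g.2]; rfl
  rw [Int.floor_eq_zero_iff] at h0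
  rw [abs_le]
  exact ⟨by linarith [h0.1], h0.2.le⟩

theorem card_E (n) (x : M.S) : Set.ncard {y | M.E n x y} = Set.ncard {g : M.S | g.1 ∈ M.Gn n} := by
  symm
  refine Set.ncard_congr (fun g _ => (⟨M.pr (x.1 * g.1), M.fl_pr _⟩ : M.S)) ?_ ?_ ?_
  · intro g hg
    have := M.E_pr n x.1 (x.1 * g.1) (by rw [inv_mul_cancel_left]; exact hg)
    rw [M.pr_of_fl _ x.2] at this
    exact this
  · intro g h hg hh heq
    have key : ∀ g : M.S, M.pr (x.1⁻¹ * M.pr (x.1 * g.1)) = g.1 := by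
      intro g
      have : x.1⁻¹ * M.pr (x.1 * g.1) = g.1 * M.σ (-(M.fl (x.1 * g.1))) := by
        rw [pr]; group
      rw [this, M.pr_mul_σ, M.pr_of_fl _ g.2]
    have h1 := congrArg Subtype.val heq
    have h2 : M.pr (x.1 * g.1) = M.pr (x.1 * h.1) := h1
    apply Subtype.ext
    rw [← key g, ← key h, h2]
  · intro y hy
    have hy' : x.1⁻¹ * y.1 ∈ M.Gn n := hy
    refine ⟨⟨M.pr (x.1⁻¹ * y.1), M.fl_pr _⟩, M.pr_mem n _ hy', ?_⟩
    apply Subtype.ext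
    show M.pr (x.1 * M.pr (x.1⁻¹ * y.1)) = y.1
    have : x.1 * M.pr (x.1⁻¹ * y.1) = y.1 * M.σ (-(M.fl (x.1⁻¹ * y.1))) := by
      rw [pr]; group
    rw [this, M.pr_mul_σ, M.pr_of_fl _ y.2]

end PreM
end M5c

section M5d

/-- Product model of a group. -/
structure GModel (G : Type) [Group G] [MetricSpace G] where
  ι : Type
  S : Type
  s0 : S
  E : ℕ → Setoid S
  mono : ∀ n x y, E n x y → E (n + 1) x y
  tot : ∀ x y, ∃ n, E n x y
  s : ℕ → ℕ
  spos : ∀ n, 0 < s n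
  card : ∀ n x, Set.ncard {y | E n x y} = s n
  pr : G → S
  fl : G → (ι →₀ ℤ)
  mkk : S → (ι →₀ ℤ) → G
  pr_mk : ∀ s k, pr (mkk s k) = s
  fl_mk : ∀ s k, fl (mkk s k) = k
  mk_pr_fl : ∀ x, mkk (pr x) (fl x) = x
  A : ∀ R : ℝ, ∃ (n : ℕ) (J : Finset ι) (C : ℕ), ∀ x y, dist x y ≤ R → E n (pr x) (pr y) ∧
    (∀ i, i ∉ J → fl x i = fl y i) ∧ ∀ i, |fl x i - fl y i| ≤ C
  B : ∀ (n : ℕ) (J : Finset ι) (C : ℕ), ∃ R : ℝ, 0 ≤ R ∧ ∀ x y, E n (pr x) (pr y) →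
    (∀ i, i ∉ J → fl x i = fl y i) → (∀ i, |fl x i - fl y i| ≤ C) → dist x y ≤ R
  fg_fin : Group.FG G → Finite S
  fg_of_bdd : (∃ K, ∀ n, s n ≤ K) → Group.FG G
  count : Countable ι

theorem mono_max {α : Type} (f : ℕ → Set α) (hmono : ∀ {m n}, m ≤ n → f m ⊆ f n)
    (hf : ∀ n, (f n).Finite) (K : ℕ) (hK : ∀ n, (f n).ncard ≤ K) : ∃ n0, ∀ n, f n ⊆ f n0 := by
  have hb : BddAbove (Set.range fun n => (f n).ncard) := ⟨K, by rintro _ ⟨n, rfl⟩; exact hK n⟩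
  obtain ⟨n0, hn0⟩ := Nat.sSup_mem (Set.range_nonempty _) hb
  refine ⟨n0, fun n => ?_⟩
  have h1 : (f (max n n0)).ncard ≤ (f n0).ncard := by
    show _ ≤ (fun n => (f n).ncard) n0
    rw [hn0]
    exact le_csSup hb ⟨_, rfl⟩
  have h2 := Set.eq_of_subset_of_ncard_le (hmono (le_max_right n n0)) h1 (hf _)
  exact (hmono (le_max_left n n0)).trans h2.symm.subset

variable {G : Type} [Group G]

theorem PreM.fg_aux (M : PreM G) (h : Group.FG G) : ∃ n, M.Gn n = ⊤ := by
  obtain ⟨T, hT⟩ := (Group.fg_def.1 h)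
  choose f hf using M.Gn_ex
  refine ⟨T.sup f, top_le_iff.1 ?_⟩
  rw [← hT, Subgroup.closure_le]
  intro t ht
  exact M.Gn_mono (Finset.le_sup (f := f) ht) (hf t)

theorem PreM.fg_of_bdd (M : PreM G) (K : ℕ)
    (hK : ∀ n, Set.ncard {g : M.S | g.1 ∈ M.Gn n} ≤ K) : Group.FG G := by
  obtain ⟨n0, hn0⟩ := mono_max (fun n => {g : M.S | g.1 ∈ M.Gn n})
    (fun {m n} h g hg => M.Gn_mono h hg) M.fin_S K hK
  obtain ⟨n1, hn1⟩ := mono_max (fun n => (M.I n : Set M.ι))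
    (fun {m n} h => by exact_mod_cast M.I_mono h) (fun n => Finset.finite_toSet _) K (by
      intro n
      refine le_trans ?_ (hK n)
      refine Set.ncard_le_ncard_of_injOn (fun i => (⟨M.b i, ?_⟩ : M.S)) ?_ ?_ (M.fin_S n)
      · ext j; rw [M.fl_apply, M.b_fl]; rfl
      · intro i hi
        exact M.b_mem n i hi
      · intro i _ j _ h
        exact M.b_inj (congrArg Subtype.val h))
  have : M.Gn (max n0 n1) = ⊤ := by
    rw [eq_top_iff]
    intro x _
    rw [← M.pr_mul x]
    refine mul_mem (M.Gn_mono (le_max_left _ _) ?_) (M.Gn_mono (le_max_right _ _) ?_)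
    · obtain ⟨n, hn⟩ := M.Gn_ex (M.pr x)
      exact hn0 n (show (⟨M.pr x, M.fl_pr x⟩ : M.S) ∈ {g : M.S | g.1 ∈ M.Gn n} from hn)
    · refine M.σ_mem_Gn n1 _ fun i hi => ?_
      obtain ⟨n, hn⟩ := M.I_ex i
      exact absurd (hn1 n hn) hi
  rw [Group.fg_def, ← this]
  exact M.Gn_fg _

theorem exists_model [Countable G] [MetricSpace G]
    (hGinv : ∀ g x y : G, dist (g * x) (g * y) = dist x y)
    (hGprop : ∀ (x : G) (r : ℝ), {y : G | dist x y ≤ r}.Finite)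
    (hG : LocallyFiniteByAbelian G) : Nonempty (GModel G) := by
  classical
  obtain ⟨M⟩ := exists_preM hG
  have hd : ∀ x y : G, dist x y = dist 1 (x⁻¹ * y) := by
    intro x y
    rw [← hGinv x⁻¹ x y, inv_mul_cancel]
  have hfl1 : M.fl 1 = 0 := by ext i; rw [M.fl_apply, M.φ_one]; simp
  refine ⟨⟨M.ι, M.S, ⟨1, hfl1⟩, M.E, ?_, ?_, fun n => Set.ncard {g : M.S | g.1 ∈ M.Gn n}, ?_,
    M.card_E, fun x => ⟨M.pr x, M.fl_pr x⟩, M.fl, fun s k => s.1 * M.σ k, ?_, ?_, M.pr_mul, ?_, ?_,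
    ?_, ?_, ?_⟩⟩
  · intro n x y h
    exact M.Gn_mono (Nat.le_succ n) h
  · intro x y
    exact M.Gn_ex _
  · intro n
    rw [Set.ncard_pos (M.fin_S n)]
    exact ⟨⟨1, hfl1⟩, show (1 : G) ∈ M.Gn n from one_mem _⟩
  · intro s k
    apply Subtype.ext
    show M.pr (s.1 * M.σ k) = s.1
    rw [M.pr_mul_σ, M.pr_of_fl _ s.2]
  · intro s k
    rw [M.fl_mul_σ, s.2, zero_add]
  · intro R
    have hfin := hGprop 1 R
    choose f hf using M.Gn_ex
    have hC : ∀ g : G, ∃ C : ℕ, ∀ i, |M.φ g i| ≤ C := by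
      intro g
      refine ⟨(M.φ g).support.sup fun i => ⌈|M.φ g i|⌉₊, fun i => ?_⟩
      by_cases hi : i ∈ (M.φ g).support
      · exact (Nat.le_ceil _).trans (by
          exact_mod_cast Finset.le_sup (f := fun i => ⌈|M.φ g i|⌉₊) hi)
      · rw [Finsupp.notMem_support_iff.1 hi]; simp
    choose C hC using hC
    refine ⟨hfin.toFinset.sup f, M.I (hfin.toFinset.sup f), hfin.toFinset.sup C + 1, ?_⟩
    intro x y hxy
    rw [hd] at hxy
    have hmem : x⁻¹ * y ∈ hfin.toFinset := by rw [Set.Finite.mem_toFinset]; exact hxy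
    have hg : x⁻¹ * y ∈ M.Gn (hfin.toFinset.sup f) :=
      M.Gn_mono (Finset.le_sup (f := f) hmem) (hf _)
    refine ⟨M.E_pr _ x y hg, fun i hi => (M.fl_diff _ x y hg i hi).symm, fun i => ?_⟩
    have h1 : |M.φ (x⁻¹ * y) i| ≤ (hfin.toFinset.sup C : ℕ) :=
      (hC _ i).trans (by exact_mod_cast Finset.le_sup (f := C) hmem)
    rw [M.fl_apply, M.fl_apply]
    have h2 := M.φ_diff x y i
    have a1 := Int.floor_le (M.φ x i)
    have a2 := Int.lt_floor_add_one (M.φ x i)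
    have a3 := Int.floor_le (M.φ y i)
    have a4 := Int.lt_floor_add_one (M.φ y i)
    rw [abs_le] at h1 ⊢
    constructor
    · have : (-((hfin.toFinset.sup C + 1 : ℕ) : ℤ) : ℚ) ≤ (⌊M.φ x i⌋ - ⌊M.φ y i⌋ : ℤ) := by
        push_cast; linarith
      exact_mod_cast this
    · have : ((⌊M.φ x i⌋ - ⌊M.φ y i⌋ : ℤ) : ℚ) ≤ ((hfin.toFinset.sup C + 1 : ℕ) : ℤ) := by
        push_cast; linarith
      exact_mod_cast this
  · intro n J C
    choose f hf using M.I_ex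
    let n' := max n (J.sup f)
    have hfin := M.fin n' (C + 1)
    obtain ⟨R, hR⟩ := (hfin.image (fun g => dist 1 g)).bddAbove
    refine ⟨max R 0, le_max_right _ _, ?_⟩
    intro x y hE hJ hCb
    rw [hd]
    refine le_trans (hR ⟨x⁻¹ * y, ⟨?_, fun i => ?_⟩, rfl⟩) (le_max_left _ _)
    · refine M.E_pr_conv n' x y (M.Gn_mono (le_max_left _ _) hE) fun i hi => (hJ i ?_).symm
      intro hiJ
      exact hi (M.I_mono ((Finset.le_sup (f := f) hiJ).trans (le_max_right _ _)) (hf i))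
    · have h2 := M.φ_diff x y i
      have h1 := hCb i
      rw [M.fl_apply, M.fl_apply] at h1
      have a1 := Int.floor_le (M.φ x i)
      have a2 := Int.lt_floor_add_one (M.φ x i)
      have a3 := Int.floor_le (M.φ y i)
      have a4 := Int.lt_floor_add_one (M.φ y i)
      have h3 : |((⌊M.φ x i⌋ : ℚ) - ⌊M.φ y i⌋)| ≤ C := by exact_mod_cast h1
      rw [abs_le] at h3 ⊢
      constructor <;> linarith [h3.1, h3.2]
  · intro h
    obtain ⟨n, hn⟩ := M.fg_aux h
    have := M.fin_S n
    rw [hn] at this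
    have h2 : (Set.univ : Set M.S).Finite := this.subset fun x _ => show x.1 ∈ (⊤ : Subgroup G) from Subgroup.mem_top _
    exact Set.finite_univ_iff.1 h2
  · rintro ⟨K, hK⟩
    exact M.fg_of_bdd K hK
  · exact M.b_inj.countable

end M5d

section M6

variable {G H : Type} [Group G] [Group H] [MetricSpace G] [MetricSpace H]

theorem GModel.asdim_lower (M : GModel G) (n : ℕ) (h : ASDimLE G n) (j : Fin (n + 1) ↪ M.ι) :
    False := by
  classical
  let F : (Fin (n + 1) → ℤ) → (M.ι →₀ ℤ) := fun v =>
    Finsupp.embDomain j (Finsupp.equivFunOnFinite.symm v)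
  have F1 : ∀ v i, F v (j i) = v i := by
    intro v i
    show Finsupp.embDomain j _ (j i) = _
    rw [Finsupp.embDomain_apply_self]; rfl
  have F2 : ∀ v a, a ∉ Set.range j → F v a = 0 := by
    intro v a ha
    exact Finsupp.embDomain_notin_range _ _ _ ha
  obtain ⟨R, hR0, hR⟩ := M.B 0 (Finset.univ.map j) 2
  obtain ⟨c, u, B, hb, hs⟩ := h.color R hR0
  obtain ⟨m, J, C, hA⟩ := M.A B
  refine lebesgue (ι := Fin (n + 1)) (fun v => c (M.mkk M.s0 (F v)))
    (fun v => u (M.mkk M.s0 (F v))) C ?_ ?_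
  · intro x y hc hu i
    have := (hA _ _ (hb _ _ hc hu)).2.2 (j i)
    rwa [M.fl_mk, M.fl_mk, F1, F1] at this
  · intro x y hc hxy
    refine hs _ _ hc (hR _ _ ?_ ?_ ?_)
    · rw [M.pr_mk, M.pr_mk]
    · intro a ha
      have ha' : a ∉ Set.range j := by simpa using ha
      rw [M.fl_mk, M.fl_mk, F2 _ _ ha', F2 _ _ ha']
    · intro a
      rw [M.fl_mk, M.fl_mk]
      by_cases ha : a ∈ Set.range j
      · obtain ⟨i, rfl⟩ := ha
        rw [F1, F1]
        exact_mod_cast hxy i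
      · rw [F2 _ _ ha, F2 _ _ ha]; simp

theorem GModel.asdim_upper (M : GModel G) [Fintype M.ι] : ASDimLE G (Fintype.card M.ι) := by
  refine ASDimLE.of_color fun D hD => ?_
  obtain ⟨n, J, C, hA⟩ := M.A D
  obtain ⟨c, u, L, hL, hs⟩ := kolm (ι := M.ι) C
  obtain ⟨R, hR0, hR⟩ := M.B n Finset.univ L.toNat
  refine ⟨(M.ι → ℤ) × Quotient (M.E n), fun x => c (M.fl x),
    fun x => (u (M.fl x), Quotient.mk (M.E n) (M.pr x)), R, ?_, ?_⟩
  · intro x y hc hu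
    have h1 := congrArg Prod.fst hu
    have h2 := congrArg Prod.snd hu
    refine hR x y (Quotient.exact h2) (fun i hi => absurd (Finset.mem_univ i) hi) fun i => ?_
    exact (hL _ _ hc h1 i).trans (Int.self_le_toNat L)
  · intro x y hc hxy
    have h := hA x y hxy
    exact Prod.ext (hs _ _ hc h.2.2) (Quotient.sound h.1)

theorem GModel.asdim_eq (M : GModel G) : asdim G = ENat.card M.ι := by
  classical
  apply le_antisymm
  · rcases finite_or_infinite M.ι with hf | hi
    · have := Fintype.ofFinite M.ι
      rw [ENat.card_eq_coe_fintype_card]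
      exact iInf₂_le (Fintype.card M.ι) M.asdim_upper
    · rw [ENat.card_eq_top_of_infinite]; exact le_top
  · refine le_iInf₂ fun n hn => ?_
    by_contra hlt
    rw [not_le] at hlt
    have : Nonempty (Fin (n + 1) ↪ M.ι) := by
      rcases finite_or_infinite M.ι with hf | hi
      · have := Fintype.ofFinite M.ι
        rw [ENat.card_eq_coe_fintype_card] at hlt
        apply Function.Embedding.nonempty_of_card_le
        rw [Fintype.card_fin]
        exact_mod_cast hlt
      · exact ⟨Fin.valEmbedding.trans (Infinite.natEmbedding M.ι)⟩
    exact this.elim fun j => M.asdim_lower n hn j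

theorem equiv_of_card {α β : Type} [Countable α] [Countable β] (h : ENat.card α = ENat.card β) :
    Nonempty (α ≃ β) := by
  rcases finite_or_infinite α with ha | ha
  · rcases finite_or_infinite β with hb | hb
    · refine Finite.card_eq.1 ?_
      rw [ENat.card_eq_coe_natCard, ENat.card_eq_coe_natCard] at h
      exact_mod_cast h
    · rw [ENat.card_eq_top_of_infinite (α := β), ENat.card_eq_coe_natCard] at h
      exact absurd h (by simp)
  · rcases finite_or_infinite β with hb | hb
    · rw [ENat.card_eq_top_of_infinite (α := α), ENat.card_eq_coe_natCard] at h
      exact absurd h.symm (by simp)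
    · obtain ⟨_⟩ := nonempty_denumerable α
      obtain ⟨_⟩ := nonempty_denumerable β
      exact ⟨(Denumerable.eqv α).trans (Denumerable.eqv β).symm⟩

theorem born_model (M : GModel G) (N : GModel H) (e : M.ι ≃ N.ι) (f : M.S → N.S)
    (hf : ∀ n, ∃ m, ∀ x x', M.E n x x' → N.E m (f x) (f x')) :
    Bornologous fun x : G => N.mkk (f (M.pr x)) ((M.fl x).equivMapDomain e) := by
  classical
  intro δ hδ
  obtain ⟨n, J, C, hA⟩ := M.A δ
  obtain ⟨m, hm⟩ := hf n
  obtain ⟨R, hR0, hR⟩ := N.B m (J.map e.toEmbedding) C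
  refine ⟨R, hR0, fun x y hxy => ?_⟩
  obtain ⟨h1, h2, h3⟩ := hA x y hxy
  refine hR _ _ ?_ ?_ ?_
  · rw [N.pr_mk, N.pr_mk]; exact hm _ _ h1
  · intro i hi
    rw [N.fl_mk, N.fl_mk, Finsupp.equivMapDomain_apply, Finsupp.equivMapDomain_apply]
    apply h2
    intro h
    exact hi (Finset.mem_map.2 ⟨_, h, by simp⟩)
  · intro i
    rw [N.fl_mk, N.fl_mk, Finsupp.equivMapDomain_apply, Finsupp.equivMapDomain_apply]
    exact h3 _

theorem close_model (M : GModel G) (N : GModel H) (e : M.ι ≃ N.ι) (f : M.S → N.S) (g : N.S → M.S)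
    (h : ∃ m, ∀ x, M.E m (g (f x)) x) :
    ∃ K : ℝ, 0 ≤ K ∧ ∀ x : G,
      dist (M.mkk (g (N.pr (N.mkk (f (M.pr x)) ((M.fl x).equivMapDomain e))))
        ((N.fl (N.mkk (f (M.pr x)) ((M.fl x).equivMapDomain e))).equivMapDomain e.symm)) x ≤ K := by
  obtain ⟨m, hm⟩ := h
  obtain ⟨R, hR0, hR⟩ := M.B m ∅ 0
  have key : ∀ x i, (M.fl (M.mkk (g (N.pr (N.mkk (f (M.pr x)) ((M.fl x).equivMapDomain e))))
        ((N.fl (N.mkk (f (M.pr x)) ((M.fl x).equivMapDomain e))).equivMapDomain e.symm))) i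
        = M.fl x i := by
    intro x i
    rw [M.fl_mk, N.fl_mk, Finsupp.equivMapDomain_apply, Finsupp.equivMapDomain_apply]
    simp
  refine ⟨R, hR0, fun x => hR _ _ ?_ ?_ ?_⟩
  · rw [M.pr_mk, N.pr_mk]; exact hm _
  · intro i _; exact key x i
  · intro i; rw [key x i]; simp

theorem coarse_model (M : GModel G) (N : GModel H) (e : M.ι ≃ N.ι) (f : M.S → N.S) (g : N.S → M.S)
    (h1 : ∃ m, ∀ y, N.E m (f (g y)) y) (h2 : ∃ m, ∀ x, M.E m (g (f x)) x)
    (h3 : ∀ n, ∃ m, ∀ x x', M.E n x x' → N.E m (f x) (f x'))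
    (h4 : ∀ n, ∃ m, ∀ y y', N.E n y y' → M.E m (g y) (g y')) : CoarseEquiv G H := by
  obtain ⟨K, hK0, hK⟩ := close_model M N e f g h2
  obtain ⟨L, hL0, hL⟩ := close_model N M e.symm g f h1
  refine ⟨_, _, max K L, le_max_of_le_left hK0, born_model M N e f h3,
    born_model N M e.symm g h4, fun x => (hK x).trans (le_max_left _ _),
    fun y => (hL y).trans (le_max_right _ _)⟩

theorem GModel.mono' (M : GModel G) {m n : ℕ} (hmn : m ≤ n) (x y) (h : M.E m x y) : M.E n x y := by
  induction n, hmn using Nat.le_induction with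
  | base => exact h
  | succ n _ ih => exact M.mono n x y ih

theorem GModel.level (M : GModel G) (h : Finite M.S) : ∃ m, ∀ x y, M.E m x y := by
  have := Fintype.ofFinite M.S
  choose f hf using M.tot
  refine ⟨Finset.univ.sup fun p : M.S × M.S => f p.1 p.2, fun x y => ?_⟩
  exact M.mono' (Finset.le_sup (f := fun p : M.S × M.S => f p.1 p.2) (Finset.mem_univ (x, y)))
    x y (hf x y)

end M6

/-- Two countable locally finite-by-abelian groups with proper left-invariant metrics
are coarsely equivalent iff their asymptotic dimensions coincide and they are either
both finitely generated or both infinitely generated. -/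
theorem coarse_equiv_iff_asdim_eq_of_locallyFiniteByAbelian
    (G H : Type) [Group G] [Group H] [Countable G] [Countable H]
    [MetricSpace G] [MetricSpace H]
    (hGinv : ∀ g x y : G, dist (g * x) (g * y) = dist x y)
    (hGprop : ∀ (x : G) (r : ℝ), {y : G | dist x y ≤ r}.Finite)
    (hHinv : ∀ g x y : H, dist (g * x) (g * y) = dist x y)
    (hHprop : ∀ (x : H) (r : ℝ), {y : H | dist x y ≤ r}.Finite)
    (hG : LocallyFiniteByAbelian G) (hH : LocallyFiniteByAbelian H) :
    CoarseEquiv G H ↔ (asdim G = asdim H ∧ (Group.FG G ↔ Group.FG H)) := by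
  constructor
  · intro h
    exact ⟨asdim_eq_of_coarse h, fg_of_coarse hGinv hHinv hHprop h,
      fg_of_coarse hHinv hGinv hGprop h.symm'⟩
  · rintro ⟨hdim, hfg⟩
    obtain ⟨M⟩ := exists_model hGinv hGprop hG
    obtain ⟨N⟩ := exists_model hHinv hHprop hH
    rw [M.asdim_eq, N.asdim_eq] at hdim
    have := M.count
    have := N.count
    obtain ⟨e⟩ := equiv_of_card hdim
    by_cases hF : Group.FG G
    · obtain ⟨m, hm⟩ := M.level (M.fg_fin hF)
      obtain ⟨n, hn⟩ := N.level (N.fg_fin (hfg.1 hF))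
      exact coarse_model M N e (fun _ => N.s0) (fun _ => M.s0) ⟨n, fun _ => hn _ _⟩
        ⟨m, fun _ => hm _ _⟩ (fun _ => ⟨n, fun _ _ _ => hn _ _⟩) (fun _ => ⟨m, fun _ _ _ => hm _ _⟩)
    · have hF' : ¬ Group.FG H := fun h => hF (hfg.2 h)
      have hup : ∀ K, ∃ n, K < M.s n := by
        intro K
        by_contra hcon
        push Not at hcon
        exact hF (M.fg_of_bdd ⟨K, hcon⟩)
      have hur : ∀ K, ∃ n, K < N.s n := by
        intro K
        by_contra hcon
        push Not at hcon
        exact hF' (N.fg_of_bdd ⟨K, hcon⟩)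
      obtain ⟨f, g, h1, h2, h3, h4⟩ := tree_lemma M.s0 N.s0 M.E N.E M.mono N.mono M.tot N.tot
        M.s N.s M.spos N.spos M.card N.card hup hur
      exact coarse_model M N e f g h1 h2 h3 h4
end
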